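/- arXiv:1708.01211 — 2 statements merged into one kernel-verified Lean document; each statement's English description precedes it below -/
import Mathlib

section
/- Fix an integer r ≥ 2. For every ε > 0, with high probability as n → ∞ there exists an r-edge-coloring of the random 2r-regular graph G(n,2r) such that every monochromatic component has at most εn vertices. -/
open Polynomial

noncomputable def gP {ι R : Type*} [DecidableEq ι] [CommRing R] :
    List (ι → R) → Finset ι → (ι → R) → R
  | [], S, y => ∏ i ∈ S, y i
  | (a :: as), S, y => ∑ i ∈ S, a i * gP as (S.erase i) y

section gurvits
variable {ι : Type*} [DecidableEq ι]

theorem gP_map {R R' : Type*} [CommRing R] [CommRing R'] (f : R →+* R') (as : List (ι → R))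
    (S : Finset ι) (y : ι → R) :
    f (gP as S y) = gP (as.map (fun a i => f (a i))) S (fun i => f (y i)) := by
  induction as generalizing S with
  | nil => simp [gP, map_prod]
  | cons a as ih => simp [gP, map_sum, ih]

theorem gP_homog {R : Type*} [CommRing R] (as : List (ι → R)) (S : Finset ι)
    (h : as.length ≤ S.card) (u : R) (y : ι → R) :
    gP as S (fun i => u * y i) = u ^ (S.card - as.length) * gP as S y := by
  induction as generalizing S with
  | nil => simp [gP, Finset.prod_mul_distrib]
  | cons a as ih =>
    simp only [gP, Finset.mul_sum, List.length_cons] at *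
    refine Finset.sum_congr rfl fun i hi => ?_
    have hc := Finset.card_erase_of_mem hi
    rw [ih _ (by omega), hc, show S.card - 1 - as.length = S.card - (as.length + 1) by omega]
    ring

theorem gP_deriv {R : Type*} [CommRing R] (as : List (ι → R)) (S : Finset ι) (a y : ι → R) :
    derivative (gP (as.map fun b i => C (b i)) S (fun i => C (y i) + C (a i) * X)) =
      gP ((a :: as).map fun b i => C (b i)) S (fun i => C (y i) + C (a i) * X) := by
  induction as generalizing S with
  | nil => 
    simp only [gP, List.map, derivative_prod_finset]
    refine Finset.sum_congr rfl fun i hi => ?_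
    simp only [derivative_add, derivative_C, zero_add, derivative_mul, derivative_X, zero_mul, mul_one]
    ring
  | cons b as ih =>
    have : ∀ T, derivative (gP ((b :: as).map fun b i => C (b i)) T (fun i => C (y i) + C (a i) * X)) = ∑ i ∈ T, C (b i) * derivative (gP (as.map fun b i => C (b i)) (T.erase i) (fun i => C (y i) + C (a i) * X)) := by
      intro T
      simp [gP]
    rw [this]
    simp only [ih]
    simp only [gP, List.map, Finset.mul_sum]
    rw [Finset.sum_comm' (t' := S) (s' := fun i => S.erase i)]
    · refine Finset.sum_congr rfl fun i hi => Finset.sum_congr rfl fun j hj => ?_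
      rw [Finset.erase_right_comm]; ring
    · intro i j; simp; tauto

theorem gP_natDegree {R : Type*} [CommRing R] (as : List (ι → R)) (S : Finset ι) (a y : ι → R) :
    (gP (as.map fun b i => C (b i)) S (fun i => C (y i) + C (a i) * X)).natDegree ≤ S.card - as.length := by
  induction as generalizing S with
  | nil => 
    simp only [gP, List.map]
    refine (natDegree_prod_le _ _).trans ?_
    simp only [List.length_nil, Nat.sub_zero, Finset.card_eq_sum_ones]
    refine Finset.sum_le_sum fun i _ => ?_
    compute_degree
  | cons b as ih =>
    simp only [gP, List.map]
    refine natDegree_sum_le_of_forall_le _ _ fun i hi => ?_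
    refine (natDegree_C_mul_le _ _).trans ((ih _).trans ?_)
    have hc := Finset.card_erase_of_mem hi
    simp; omega

open Classical in
theorem gP_natDegree' {R : Type*} [CommRing R] (as : List (ι → R)) (S : Finset ι) (a y : ι → R) :
    (gP (as.map fun b i => C (b i)) S (fun i => C (y i) + C (a i) * X)).natDegree ≤ (S.filter fun i => a i ≠ 0).card := by
  induction as generalizing S with
  | nil => 
    simp only [gP, List.map]
    refine (natDegree_prod_le _ _).trans ?_
    rw [Finset.card_filter]
    refine Finset.sum_le_sum fun i _ => ?_
    split_ifs with h
    · compute_degree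
    · push Not at h; simp [h]
  | cons b as ih =>
    simp only [gP, List.map]
    refine natDegree_sum_le_of_forall_le _ _ fun i hi => ?_
    refine (natDegree_C_mul_le _ _).trans ((ih _).trans ?_)
    exact Finset.card_le_card (Finset.filter_subset_filter _ (Finset.erase_subset _ _))

theorem gP_coeff {R : Type*} [CommRing R] (as : List (ι → R)) (S : Finset ι) (h : as.length ≤ S.card) (a y : ι → R) :
    (gP (as.map fun b i => C (b i)) S (fun i => C (y i) + C (a i) * X)).coeff (S.card - as.length) = gP as S a := by
  induction as generalizing S with
  | nil => 
    simp only [gP, List.map, List.length_nil, Nat.sub_zero]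
    have := coeff_prod_of_natDegree_le S (fun i => C (y i) + C (a i) * X) 1 (fun i _ => by compute_degree)
    simpa using this
  | cons b as ih =>
    simp only [gP, List.map, finsetSum_coeff, coeff_C_mul, List.length_cons] at *
    refine Finset.sum_congr rfl fun i hi => ?_
    have hc := Finset.card_erase_of_mem hi
    rw [← ih _ (by omega), hc, show S.card - 1 - as.length = S.card - (as.length + 1) by omega]

theorem gP_eval {R : Type*} [CommRing R] (as : List (ι → R)) (S : Finset ι) (a y : ι → R) (t : R) :
    (gP (as.map fun b i => C (b i)) S (fun i => C (y i) + C (a i) * X)).eval t = gP as S (fun i => y i + a i * t) := by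
  rw [← coe_evalRingHom, gP_map]
  simp [Function.comp_def]

theorem gP_nonneg (as : List (ι → ℝ)) (has : ∀ b ∈ as, ∀ i, 0 ≤ b i) (S : Finset ι) (y : ι → ℝ) (hy : ∀ i, 0 ≤ y i) : 0 ≤ gP as S y := by
  induction as generalizing S with
  | nil => exact Finset.prod_nonneg fun i _ => hy i
  | cons b as ih =>
    simp only [List.mem_cons, forall_eq_or_imp] at has
    exact Finset.sum_nonneg fun i _ => mul_nonneg (has.1 i) (ih has.2 _)

theorem gP_pos (as : List (ι → ℝ)) (has : ∀ b ∈ as, ∀ i, 0 < b i) (S : Finset ι) (h : as.length ≤ S.card) (y : ι → ℝ) (hy : ∀ i, 0 < y i) : 0 < gP as S y := by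
  induction as generalizing S with
  | nil => exact Finset.prod_pos fun i _ => hy i
  | cons b as ih =>
    simp only [List.mem_cons, forall_eq_or_imp, List.length_cons] at has h
    refine Finset.sum_pos (fun i hi => mul_pos (has.1 i) (ih has.2 _ ?_)) (Finset.card_pos.1 (by omega))
    have hc := Finset.card_erase_of_mem hi
    omega

theorem gP_mono (as : List (ι → ℝ)) (has : ∀ b ∈ as, ∀ i, 0 ≤ b i) (S : Finset ι) (y z : ι → ℝ) (hy : ∀ i, 0 ≤ y i) (hyz : ∀ i, y i ≤ z i) : gP as S y ≤ gP as S z := by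
  induction as generalizing S with
  | nil => exact Finset.prod_le_prod (fun i _ => hy i) (fun i _ => hyz i)
  | cons b as ih =>
    simp only [List.mem_cons, forall_eq_or_imp] at has
    exact Finset.sum_le_sum fun i _ => mul_le_mul_of_nonneg_left (ih has.2 _) (has.1 i)

theorem gP_ne_zero (as : List (ι → ℝ)) (has : ∀ b ∈ as, ∀ i, 0 < b i) (S : Finset ι)
    (h : as.length ≤ S.card) (y : ι → ℂ) (hy : ∀ i, 0 < (y i).im) :
    gP (as.map fun b i => (b i : ℂ)) S y ≠ 0 := by
  induction as generalizing y with
  | nil => 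
    simp only [gP, List.map]
    refine Finset.prod_ne_zero_iff.2 fun i _ h0 => ?_
    have := hy i; simp [h0] at this
  | cons a as ih =>
    simp only [List.mem_cons, forall_eq_or_imp, List.length_cons] at has h
    set as' := as.map fun b i => (b i : ℂ) with has'
    set a' : ι → ℂ := fun i => (a i : ℂ) with ha'
    have hl : as'.length = as.length := by simp [as']
    set Rp := gP (as'.map fun b i => C (b i)) S (fun i => C (y i) + C (a' i) * X) with hR
    have hroot : ∀ t : ℂ, 0 ≤ t.im → Rp.eval t ≠ 0 := by
      intro t ht
      rw [hR, gP_eval]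
      refine ih has.2 (by omega) _ fun i => ?_
      simp only [a', Complex.add_im, Complex.mul_im, Complex.ofReal_re, Complex.ofReal_im]
      have := hy i; have := has.1 i; nlinarith [mul_nonneg (has.1 i).le ht]
    have hco : Rp.coeff (S.card - as'.length) ≠ 0 := by
      rw [hR, gP_coeff _ _ (by omega)]
      have := gP_map Complex.ofRealHom as S a
      simp only [Complex.ofRealHom_eq_coe] at this
      rw [has', ha', ← this]
      exact_mod_cast (gP_pos as has.2 S (by omega) a has.1).ne'
    have hd : 0 < Rp.natDegree := by
      have := le_natDegree_of_ne_zero hco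
      omega
    have hder : derivative Rp ≠ 0 := by
      intro h0
      have := derivative_eq_zero.1 h0
      omega
    have key := gP_deriv as' S a' y
    have : gP (List.map (fun b i ↦ (b i : ℂ)) (a :: as)) S y = (derivative Rp).eval 0 := by
      rw [hR, key, gP_eval]; simp [as', a']
    rw [this]
    intro h0
    have hm : (0:ℂ) ∈ (derivative Rp).rootSet ℂ := by
      rw [mem_rootSet]; exact ⟨hder, by simpa using h0⟩
    have h1 := Polynomial.rootSet_derivative_subset_convexHull_rootSet (P := Rp) (natDegree_pos_iff_degree_pos.1 hd) hm
    have h2 : convexHull ℝ (Rp.rootSet ℂ) ⊆ {z : ℂ | z.im < 0} := by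
      refine convexHull_min ?_ (convex_halfSpace_im_lt 0)
      intro z hz
      rw [mem_rootSet] at hz
      by_contra hc
      exact hroot z (not_lt.1 hc) (by simpa using hz.2)
    simpa using h2 h1
end gurvits
section gurvits2
variable {ι : Type*} [DecidableEq ι]

theorem gP_cont {R : Type*} [CommRing R] [TopologicalSpace R] [IsTopologicalRing R]
    (as : List (ι → ℝ → R)) (has : ∀ b ∈ as, ∀ i, Continuous (b i)) (S : Finset ι) (y : ι → ℝ → R)
    (hy : ∀ i, Continuous (y i)) :
    Continuous fun δ : ℝ => gP (as.map fun b i => b i δ) S (fun i => y i δ) := by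
  induction as generalizing S with
  | nil => simp only [gP, List.map]; exact continuous_finsetProd _ fun i _ => hy i
  | cons b as ih =>
    simp only [List.mem_cons, forall_eq_or_imp] at has
    simp only [gP, List.map]
    exact continuous_finsetSum _ fun i _ => (has.1 i).mul (ih has.2 _)

theorem gP_norm_pos (as : List (ι → ℝ)) (has : ∀ b ∈ as, ∀ i, 0 < b i) (S : Finset ι)
    (h : as.length ≤ S.card) (x η : ι → ℝ) (hη : ∀ i, 0 < η i) :
    gP as S η ≤ ‖gP (as.map fun b i => (b i : ℂ)) S (fun i => (x i : ℂ) + (η i : ℂ) * Complex.I)‖ := by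
  set as' := as.map fun b i => (b i : ℂ) with has'
  have hl : as'.length = as.length := by simp [as']
  set Rp := gP (as'.map fun b i => C (b i)) S (fun i => C (x i : ℂ) + C (η i : ℂ) * X) with hR
  have hco : Rp.coeff (S.card - as'.length) = ((gP as S η : ℝ) : ℂ) := by
    rw [hR, gP_coeff _ _ (by omega) (fun i => (η i : ℂ)) (fun i => (x i : ℂ))]
    have := gP_map Complex.ofRealHom as S η
    simp only [Complex.ofRealHom_eq_coe] at this
    rw [has', ← this]
  have hpos := gP_pos as has S h η hη
  have hroot : ∀ t : ℂ, t.im ≠ 0 → Rp.eval t ≠ 0 := by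
    intro t ht
    rw [hR, gP_eval as' S (fun i => (η i : ℂ)) (fun i => (x i : ℂ)) t]
    rcases lt_or_gt_of_ne ht with ht | ht
    · intro h0
      have := gP_homog as' S (by omega) (-1) (fun i => (x i : ℂ) + (η i : ℂ) * t)
      rw [h0, mul_zero] at this
      refine gP_ne_zero as has S h _ (fun i => ?_) this
      simp
      nlinarith [hη i]
    · refine gP_ne_zero as has S h _ (fun i => ?_)
      simp
      nlinarith [hη i]
  have hdeg : Rp.natDegree = S.card - as'.length := by
    refine le_antisymm (gP_natDegree as' S (fun i => (η i : ℂ)) (fun i => (x i : ℂ))) (le_natDegree_of_ne_zero ?_)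
    rw [hco]; exact_mod_cast hpos.ne'
  have hlead : Rp.leadingCoeff = ((gP as S η : ℝ) : ℂ) := by
    rw [leadingCoeff, hdeg, hco]
  have hev := (IsAlgClosed.splits Rp).eval_eq_prod_roots Complex.I
  rw [hR, gP_eval as' S (fun i => (η i : ℂ)) (fun i => (x i : ℂ)) Complex.I, ← hR] at hev
  rw [hev, norm_mul, hlead, Complex.norm_real, Real.norm_of_nonneg hpos.le]
  have hRne : Rp ≠ 0 := by
    intro h0; rw [h0] at hlead; rw [leadingCoeff_zero] at hlead; exact hpos.ne (by exact_mod_cast hlead)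
  have : ∀ m : Multiset ℂ, (∀ z ∈ m, z.im = 0) → 1 ≤ ‖(m.map fun z => Complex.I - z).prod‖ := by
    intro m
    induction m using Multiset.induction with
    | empty => simp
    | cons a m ih =>
      intro hm
      simp only [Multiset.mem_cons, forall_eq_or_imp] at hm
      rw [Multiset.map_cons, Multiset.prod_cons, norm_mul]
      have h1 := ih hm.2
      have h2 : 1 ≤ ‖Complex.I - a‖ := by
        have := Complex.abs_im_le_norm (Complex.I - a)
        simpa [hm.1] using this
      nlinarith
  have h1 := this Rp.roots (by
    intro z hz
    by_contra hc
    exact hroot z hc ((mem_roots hRne).1 hz))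
  nlinarith

theorem gP_norm (as : List (ι → ℝ)) (has : ∀ b ∈ as, ∀ i, 0 ≤ b i) (S : Finset ι)
    (h : as.length ≤ S.card) (x η : ι → ℝ) (hη : ∀ i, 0 ≤ η i) :
    gP as S η ≤ ‖gP (as.map fun b i => (b i : ℂ)) S (fun i => (x i : ℂ) + (η i : ℂ) * Complex.I)‖ := by
  have c1 := gP_cont (R := ℝ) (as.map fun b i δ => b i + δ) (by
    intro b hb i
    obtain ⟨b', _, rfl⟩ := List.mem_map.1 hb
    fun_prop) S (fun i δ => η i + δ) (by intro i; fun_prop)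
  have c2 := gP_cont (R := ℂ) (as.map fun b i δ => ((b i + δ : ℝ) : ℂ)) (by
    intro b hb i
    obtain ⟨b', _, rfl⟩ := List.mem_map.1 hb
    fun_prop) S (fun i δ => (x i : ℂ) + ((η i + δ : ℝ) : ℂ) * Complex.I) (by intro i; fun_prop)
  have t1 := (c1.tendsto 0).mono_left (nhdsWithin_le_nhds (s := Set.Ioi 0))
  have t2 := (c2.norm.tendsto 0).mono_left (nhdsWithin_le_nhds (s := Set.Ioi 0))
  have := le_of_tendsto_of_tendsto t1 t2 (by
    filter_upwards [self_mem_nhdsWithin] with δ hδ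
    have hδ : 0 < δ := hδ
    have := gP_norm_pos (as.map fun b i => b i + δ) (by
      intro b hb i
      obtain ⟨b', hb', rfl⟩ := List.mem_map.1 hb
      have := has b' hb' i
      simp only; positivity) S (by simpa using h) x (fun i => η i + δ) (fun i => by have := hη i; positivity)
    simpa [List.map_map, Function.comp_def] using this)
  simpa [List.map_map, Function.comp_def] using this

theorem gP_splits (as : List (ι → ℝ)) (has : ∀ b ∈ as, ∀ i, 0 ≤ b i) (S : Finset ι)
    (h : as.length ≤ S.card) (a c : ι → ℝ) (hc : ∀ i, 0 ≤ c i) (h0 : 0 < gP as S c) :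
    (gP (as.map fun b i => C (b i)) S (fun i => C (c i) + C (a i) * X)).Splits := by
  set Rp := gP (as.map fun b i => C (b i)) S (fun i => C (c i) + C (a i) * X) with hR
  have hne : Rp ≠ 0 := by
    intro h1
    have := gP_eval as S a c 0
    rw [← hR, h1] at this
    simp at this; linarith
  have hev : ∀ τ : ℂ, (Rp.map Complex.ofRealHom).eval τ = gP (as.map fun b i => (b i : ℂ)) S (fun i => (c i : ℂ) + (a i : ℂ) * τ) := by
    intro τ
    rw [eval_map, ← coe_eval₂RingHom, hR, gP_map]
    simp [Function.comp_def]
  have key : ∀ τ : ℂ, 0 < τ.im → (Rp.map Complex.ofRealHom).eval τ ≠ 0 := by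
    intro τ hτ h1
    rw [hev] at h1
    set s : ℝ := -τ.re / τ.im with hs
    set u : ℂ := s + Complex.I with hu
    have hom := gP_homog (as.map fun b i => (b i : ℂ)) S (by simpa using h) u (fun i => (c i : ℂ) + (a i : ℂ) * τ)
    rw [h1, mul_zero] at hom
    have h2 : ∀ i, u * ((c i : ℂ) + (a i : ℂ) * τ) = ((s * c i + a i * (s * τ.re - τ.im) : ℝ) : ℂ) + ((c i : ℝ) : ℂ) * Complex.I := by
      intro i
      have h3 : s * τ.im + τ.re = 0 := by rw [hs]; field_simp; ring
      apply Complex.ext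
      · simp [hu]; ring
      · simp [hu]; linear_combination (a i) * h3
    simp only [h2] at hom
    have := gP_norm as has S h (fun i => s * c i + a i * (s * τ.re - τ.im)) c hc
    rw [hom] at this
    simp at this; linarith
  refine Splits.of_splits_map Complex.ofRealHom (IsAlgClosed.splits _) fun z hz => ?_
  have hz := (mem_roots'.1 hz).2
  by_cases him : z.im = 0
  · exact ⟨z.re, by apply Complex.ext <;> simp [him]⟩
  exfalso
  rcases lt_or_gt_of_ne him with ht | ht
  · refine key (starRingEnd ℂ z) (by simpa using ht) ?_
    have h5 : (Rp.map Complex.ofRealHom).eval z = 0 := hz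
    rw [hev] at h5 ⊢
    have := gP_map (starRingEnd ℂ) (as.map fun b i => (b i : ℂ)) S (fun i => (c i : ℂ) + (a i : ℂ) * z)
    rw [h5, map_zero] at this
    rw [this]
    simp [Function.comp_def]
  · exact key z ht hz
end gurvits2
section gurvits3

theorem ms_exp (m : Multiset ℝ) (hm : ∀ a ∈ m, 0 ≤ a) (t lam : ℝ) (ht : 0 ≤ t) (hlam : 0 < lam) :
    (m.map fun a => 1 + a * t).prod ≤ (lam * Real.exp (1 / lam - 1)) ^ (Multiset.card m) * Real.exp (t * m.sum / lam) := by
  induction m using Multiset.induction with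
  | empty => simp
  | cons a m ih =>
    simp only [Multiset.mem_cons, forall_eq_or_imp] at hm
    rw [Multiset.map_cons, Multiset.prod_cons, Multiset.card_cons, Multiset.sum_cons]
    have h1 := ih hm.2
    have h2 : 1 + a * t ≤ lam * Real.exp (1 / lam - 1) * Real.exp (t * a / lam) := by
      have := Real.add_one_le_exp ((1 + a * t) / lam - 1)
      rw [mul_assoc, ← Real.exp_add]
      have e : 1 / lam - 1 + t * a / lam = (1 + a * t) / lam - 1 := by field_simp; ring
      rw [e]
      have : (1 + a * t) / lam ≤ Real.exp ((1 + a * t) / lam - 1) := by linarith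
      rw [div_le_iff₀ hlam] at this
      linarith
    have h3 : 0 ≤ (m.map fun a => 1 + a * t).prod := by
      refine Multiset.prod_nonneg fun x hx => ?_
      obtain ⟨b, hb, rfl⟩ := Multiset.mem_map.1 hx
      have := hm.2 b hb
      positivity
    calc _ ≤ (lam * Real.exp (1 / lam - 1) * Real.exp (t * a / lam)) * ((lam * Real.exp (1 / lam - 1)) ^ (Multiset.card m) * Real.exp (t * m.sum / lam)) :=
          mul_le_mul h2 h1 h3 (by positivity)
      _ = _ := by
        rw [show t * (a + m.sum) / lam = t * a / lam + t * m.sum / lam by ring, Real.exp_add]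
        ring

noncomputable def gg (k : ℕ) : ℝ := (((k : ℝ) - 1) / k) ^ (k - 1)

theorem gg_le_one (k : ℕ) (hk : 1 ≤ k) : gg k ≤ 1 := by
  have : (1:ℝ) ≤ k := by exact_mod_cast hk
  refine pow_le_one₀ (div_nonneg (by linarith) (by linarith)) ?_
  rw [div_le_one (by linarith)]; linarith

theorem gg_nonneg (k : ℕ) (hk : 1 ≤ k) : 0 ≤ gg k := by
  have : (1:ℝ) ≤ k := by exact_mod_cast hk
  exact pow_nonneg (div_nonneg (by linarith) (by linarith)) _

theorem gur_step_pos (k : ℕ) (hk : 1 ≤ k) (K R0 : ℝ) (hK : 0 ≤ K) (hR0 : 0 < R0) (m : Multiset ℝ) (hm : ∀ a ∈ m, 0 ≤ a)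
    (hc : Multiset.card m ≤ k) (h : ∀ t : ℝ, 0 < t → K * t ≤ R0 * (m.map fun a => 1 + a * t).prod) :
    gg k * K ≤ R0 * m.sum := by
  have hs : 0 ≤ m.sum := Multiset.sum_nonneg hm
  rcases hs.eq_or_lt with hs0 | hs0
  · have : K ≤ 0 := by
      by_contra hKp
      push Not at hKp
      have h1 := h ((R0 + 1) / K) (by positivity)
      have h2 := ms_exp m hm ((R0 + 1) / K) 1 (by positivity) one_pos
      simp [← hs0] at h2
      rw [mul_div_cancel₀ _ hKp.ne'] at h1
      nlinarith
    have := gg_nonneg k hk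
    nlinarith
  rcases hk.eq_or_lt with rfl | hk2
  · simp only [gg, Nat.sub_self, pow_zero, one_mul]
    have hp : ∀ t : ℝ, (m.map fun a => 1 + a * t).prod = 1 + m.sum * t := by
      intro t
      rcases Nat.le_one_iff_eq_zero_or_eq_one.1 hc with h0 | h0
      · rw [Multiset.card_eq_zero] at h0; simp [h0]
      · obtain ⟨a, rfl⟩ := Multiset.card_eq_one.1 h0; simp
    by_contra hcon
    push Not at hcon
    have hd : 0 < K - R0 * m.sum := by linarith
    have h1 := h ((R0 + 1) / (K - R0 * m.sum)) (by positivity)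
    rw [hp] at h1
    have : (K - R0 * m.sum) * ((R0 + 1) / (K - R0 * m.sum)) = R0 + 1 := by field_simp
    nlinarith
  have hk' : (2:ℝ) ≤ k := by exact_mod_cast hk2
  set lam : ℝ := k / (k - 1) with hlam
  have hk1 : (0:ℝ) < k - 1 := by linarith
  have hlp : 0 < lam := by positivity
  set t : ℝ := lam / m.sum with ht
  have htp : 0 < t := by positivity
  have h1 := h t htp
  have h2 := ms_exp m hm t lam htp.le hlp
  have h3 : t * m.sum / lam = 1 := by rw [ht]; field_simp
  rw [h3] at h2
  have h4 : 1 ≤ lam * Real.exp (1 / lam - 1) := by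
    have := Real.add_one_le_exp (1 / lam - 1)
    have : 1 / lam ≤ Real.exp (1 / lam - 1) := by linarith
    rwa [div_le_iff₀' hlp] at this
  have h5 : (lam * Real.exp (1 / lam - 1)) ^ (Multiset.card m) ≤ (lam * Real.exp (1 / lam - 1)) ^ k :=
    pow_le_pow_right₀ h4 hc
  have h6 : (lam * Real.exp (1 / lam - 1)) ^ k * Real.exp 1 = lam ^ k := by
    rw [mul_pow, ← Real.exp_nat_mul, mul_assoc, ← Real.exp_add]
    have : k * (1 / lam - 1) + 1 = 0 := by rw [hlam]; field_simp; ring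
    rw [this]; simp
  have h7 : (m.map fun a => 1 + a * t).prod ≤ lam ^ k := by
    rw [← h6]; exact h2.trans (mul_le_mul_of_nonneg_right h5 (Real.exp_pos _).le)
  have h8 : K * t ≤ R0 * lam ^ k := h1.trans (mul_le_mul_of_nonneg_left h7 hR0.le)
  have h9 : gg k * lam ^ (k - 1) = 1 := by
    rw [gg, ← mul_pow, hlam]
    rw [show ((k:ℝ) - 1) / k * (k / (k - 1)) = 1 by field_simp, one_pow]
  have h10 : lam ^ k = lam ^ (k-1) * lam := by rw [← pow_succ]; congr 1; omega
  have h11 : K ≤ R0 * m.sum * lam ^ (k - 1) := by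
    rw [h10, ht] at h8
    have : K * (lam / m.sum) = K / m.sum * lam := by ring
    rw [this, ← mul_assoc] at h8
    have := le_of_mul_le_mul_right h8 hlp
    rw [div_le_iff₀ hs0] at this
    linarith
  calc gg k * K ≤ gg k * (R0 * m.sum * lam ^ (k - 1)) := mul_le_mul_of_nonneg_left h11 (gg_nonneg k hk)
    _ = (gg k * lam ^ (k - 1)) * (R0 * m.sum) := by ring
    _ = _ := by rw [h9, one_mul]

theorem gur_step (k : ℕ) (hk : 1 ≤ k) (K : ℝ) (hK : 0 ≤ K) (R : ℝ[X]) (hs : 0 < R.eval 0 → R.Splits) (hd : R.natDegree ≤ k)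
    (h0 : ∀ t : ℝ, 0 ≤ t → R.eval 0 ≤ R.eval t) (h00 : 0 ≤ R.eval 0)
    (h : ∀ t : ℝ, 0 < t → K * t ≤ R.eval t) : gg k * K ≤ R.derivative.eval 0 := by
  rcases h00.eq_or_lt with h00 | h00
  · have h1 : ∀ t : ℝ, 0 < t → K ≤ R.divX.eval t := by
      intro t ht
      have h2 := h t ht
      have h3 : R.eval t = R.divX.eval t * t := by
        conv_lhs => rw [← divX_mul_X_add R]
        rw [← coeff_zero_eq_eval_zero] at h00
        simp [← h00]
      rw [h3] at h2
      exact le_of_mul_le_mul_right h2 ht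
    have h2 : K ≤ R.divX.eval 0 := by
      refine ge_of_tendsto (((R.divX.continuous).tendsto 0).mono_left (nhdsWithin_le_nhds (s := Set.Ioi 0))) ?_
      filter_upwards [self_mem_nhdsWithin] with t ht using h1 t ht
    have h3 : R.derivative.eval 0 = R.divX.eval 0 := by
      rw [← coeff_zero_eq_eval_zero, ← coeff_zero_eq_eval_zero, coeff_derivative, coeff_divX]; simp
    rw [h3]
    have := gg_le_one k hk
    nlinarith
  have hs := hs h00
  have hRne : R ≠ 0 := by rintro rfl; simp at h00
  rw [hs.eval_derivative_eq_eval_mul_sum h00.ne']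
  have hneg : ∀ z ∈ R.roots, z < 0 := by
    intro z hz
    by_contra hc
    have := h0 z (not_lt.1 hc)
    have h1 : R.eval z = 0 := (mem_roots'.1 hz).2
    linarith
  have hprod : ∀ m : Multiset ℝ, (∀ z ∈ m, z < 0) → ∀ t : ℝ, (m.map fun z => t - z).prod = (m.map fun z => 0 - z).prod * ((m.map fun z => 1 / (0 - z)).map fun a => 1 + a * t).prod := by
    intro m
    induction m using Multiset.induction with
    | empty => simp
    | cons a m ih =>
      intro hm t
      simp only [Multiset.mem_cons, forall_eq_or_imp] at hm
      simp only [Multiset.map_cons, Multiset.prod_cons]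
      rw [ih hm.2 t]
      have : t - a = (0 - a) * (1 + 1 / (0 - a) * t) := by
        have : (0 - a) ≠ 0 := by linarith [hm.1]
        field_simp
        ring
      rw [this]; ring
  refine gur_step_pos k hk K _ hK h00 _ ?_ ?_ ?_
  · intro a ha
    obtain ⟨z, hz, rfl⟩ := Multiset.mem_map.1 ha
    have := hneg z hz
    exact div_nonneg zero_le_one (by linarith)
  · rw [Multiset.card_map]; exact (card_roots' R).trans hd
  · intro t ht
    refine (h t ht).trans (le_of_eq ?_)
    rw [hs.eval_eq_prod_roots t, hprod _ hneg t, hs.eval_eq_prod_roots 0]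
    ring
end gurvits3
section gurvits4
variable {V : Type*} [DecidableEq V] [Fintype V]

open Classical in
theorem gur_ind (k : ℕ) (hk : 1 ≤ k) (a : V → V → ℝ) (ha : ∀ j i, 0 ≤ a j i)
    (hrow : ∀ i, ∑ j, a j i = 1) (hcol : ∀ j, ∑ i, a j i = 1)
    (hsupp : ∀ j, (Finset.univ.filter fun i => a j i ≠ 0).card ≤ k) (L : List V) (hL : L.Nodup)
    (x : V → ℝ) (hx : ∀ j, 0 < x j) :
    gg k ^ L.length * ∏ j ∈ Finset.univ \ L.toFinset, x j ≤
      gP (L.map a) Finset.univ (fun i => ∑ j ∈ Finset.univ \ L.toFinset, x j * a j i) := by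
  induction L generalizing x with
  | nil =>
    simp only [List.length_nil, pow_zero, one_mul, List.toFinset_nil, Finset.sdiff_empty, List.map_nil, gP]
    have h1 : ∀ i, ∏ j, x j ^ a j i ≤ ∑ j, x j * a j i := by
      intro i
      have := Real.geom_mean_le_arith_mean_weighted Finset.univ (fun j => a j i) x (fun j _ => ha j i) (hrow i) (fun j _ => (hx j).le)
      simpa [mul_comm] using this
    refine le_trans (le_of_eq ?_) (Finset.prod_le_prod (fun i _ => Finset.prod_nonneg fun j _ => Real.rpow_nonneg (hx j).le _) fun i _ => h1 i)
    rw [Finset.prod_comm]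
    refine Finset.prod_congr rfl fun j _ => ?_
    rw [← Real.rpow_sum_of_pos (hx j), hcol, Real.rpow_one]
  | cons j L ih =>
    rw [List.nodup_cons] at hL
    set U := Finset.univ \ (j :: L).toFinset with hU
    have hjU : j ∉ U := by simp [hU]
    have hins : Finset.univ \ L.toFinset = insert j U := by
      ext i; by_cases hij : i = j
      · subst hij; simp [hL.1]
      · simp [hU, hij]
    have hlen : L.length ≤ (Finset.univ : Finset V).card := hL.2.length_le_card
    set c : V → ℝ := fun i => ∑ j ∈ U, x j * a j i with hc
    have hc0 : ∀ i, 0 ≤ c i := fun i => Finset.sum_nonneg fun j _ => mul_nonneg (hx j).le (ha j i)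
    have hasn : ∀ b ∈ L.map a, ∀ i, 0 ≤ b i := by
      intro b hb i
      obtain ⟨j, _, rfl⟩ := List.mem_map.1 hb
      exact ha j i
    set R := gP ((L.map a).map fun b i => C (b i)) Finset.univ (fun i => C (c i) + C (a j i) * X) with hR
    have hev : ∀ t, R.eval t = gP (L.map a) Finset.univ (fun i => c i + a j i * t) := fun t => gP_eval _ _ _ _ t
    have hev0 : R.eval 0 = gP (L.map a) Finset.univ c := by rw [hev]; simp
    have step := gur_step k hk (gg k ^ L.length * ∏ j ∈ U, x j)
      (mul_nonneg (pow_nonneg (gg_nonneg k hk) _) (Finset.prod_nonneg fun j _ => (hx j).le)) R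
      (fun h => gP_splits _ hasn _ (by simpa using hlen) _ _ hc0 (by rwa [hev0] at h))
      ((gP_natDegree' _ _ _ _).trans (by convert hsupp j))
      (fun t ht => by
        rw [hev0, hev]
        exact gP_mono _ hasn _ _ _ hc0 fun i => by have := mul_nonneg (ha j i) ht; linarith)
      (by rw [hev0]; exact gP_nonneg _ hasn _ _ hc0)
      (fun t ht => by
        have h1 := ih hL.2 (Function.update x j t) (fun i => by
          by_cases hij : i = j
          · subst hij; simpa using ht
          · simpa [hij] using hx i)
        rw [hins, Finset.prod_insert hjU] at h1
        simp only [Finset.sum_insert hjU, Function.update_self] at h1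
        have e1 : ∏ i ∈ U, Function.update x j t i = ∏ i ∈ U, x i :=
          Finset.prod_congr rfl fun i hi => by
            rw [Function.update_of_ne]; rintro rfl; exact hjU hi
        have e2 : ∀ l, ∑ i ∈ U, Function.update x j t i * a i l = c l := fun l =>
          Finset.sum_congr rfl fun i hi => by
            rw [Function.update_of_ne]; rintro rfl; exact hjU hi
        simp only [e1, e2] at h1
        rw [hev]
        refine le_trans (le_of_eq (by ring)) (h1.trans (le_of_eq ?_))
        congr 1
        ext l; ring)
    rw [hR, gP_deriv, gP_eval] at step
    simp only [mul_zero, add_zero] at step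
    rw [List.length_cons, pow_succ, List.map_cons]
    refine le_trans (le_of_eq (by ring)) step

open Classical in
theorem gP_count (k : ℕ) (A : V → V → Prop) (L : List V) (hL : L.Nodup) (S : Finset V) :
    gP (L.map fun j i => if A j i then (1 / k : ℝ) else 0) S (fun _ => 0) ≤ (1 / k : ℝ) ^ L.length *
      ((Finset.univ : Finset (V → V)).filter fun f => (∀ j ∈ L, f j ∈ S ∧ A j (f j)) ∧
        (∀ i ∈ L, ∀ j ∈ L, f i = f j → i = j) ∧ ∀ j, j ∉ L → f j = j).card := by
  induction L generalizing S with
  | nil =>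
    have : ((Finset.univ : Finset (V → V)).filter fun f => (∀ j ∈ ([] : List V), f j ∈ S ∧ A j (f j)) ∧
        (∀ i ∈ ([] : List V), ∀ j ∈ ([] : List V), f i = f j → i = j) ∧ ∀ j, j ∉ ([] : List V) → f j = j) = {id} := by
      ext f; simp [funext_iff]
    rw [this]
    simp only [gP, List.map_nil, Finset.prod_const, List.length_nil, pow_zero, one_mul, Finset.card_singleton, Nat.cast_one]
    exact pow_le_one₀ le_rfl zero_le_one
  | cons j L ih =>
    rw [List.nodup_cons] at hL
    rw [List.map_cons, gP]
    have h1 : ∀ i ∈ S, (if A j i then (1 / k : ℝ) else 0) * gP (L.map fun j i => if A j i then (1 / k : ℝ) else 0) (S.erase i) (fun _ => 0) ≤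
        if A j i then (1 / k : ℝ) ^ (j :: L).length * (((Finset.univ : Finset (V → V)).filter fun f => (∀ j ∈ L, f j ∈ S.erase i ∧ A j (f j)) ∧
        (∀ i ∈ L, ∀ j ∈ L, f i = f j → i = j) ∧ ∀ j, j ∉ L → f j = j).card : ℝ) else 0 := by
      intro i _
      split_ifs
      · rw [List.length_cons, pow_succ', mul_assoc]
        exact mul_le_mul_of_nonneg_left (ih hL.2 _) (by positivity)
      · simp
    refine (Finset.sum_le_sum h1).trans ?_
    rw [← Finset.sum_filter, ← Finset.mul_sum]
    refine mul_le_mul_of_nonneg_left ?_ (by positivity)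
    rw [← Nat.cast_sum, ← Finset.card_sigma, Nat.cast_le]
    refine Finset.card_le_card_of_injOn (fun p => Function.update p.2 j p.1) ?_ ?_
    · rintro ⟨i, f⟩ hp
      simp only [Finset.coe_sigma, Set.mem_sigma_iff, Finset.mem_coe, Finset.mem_filter, Finset.mem_univ, true_and, Finset.mem_erase] at hp ⊢
      obtain ⟨⟨hiS, hA⟩, h2, h3, h4⟩ := hp
      have hne : ∀ l ∈ L, l ≠ j := fun l hl => by rintro rfl; exact hL.1 hl
      refine ⟨?_, ?_, ?_⟩
      · intro l hl
        rcases List.mem_cons.1 hl with rfl | hl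
        · simp [hiS, hA]
        · simp [hne l hl, (h2 l hl).1.2, (h2 l hl).2]
      · intro l hl l' hl'
        rcases List.mem_cons.1 hl with e1 | m1
        all_goals rcases List.mem_cons.1 hl' with e2 | m2
        · intro _; rw [e1, e2]
        · subst e1
          simp only [Function.update_self, Function.update_of_ne (hne l' m2)]
          intro h; exact absurd h.symm (h2 l' m2).1.1
        · subst e2
          simp only [Function.update_self, Function.update_of_ne (hne l m1)]
          intro h; exact absurd h (h2 l m1).1.1
        · simp only [Function.update_of_ne (hne l m1), Function.update_of_ne (hne l' m2)]
          exact h3 l m1 l' m2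
      · intro l hl
        rw [List.mem_cons, not_or] at hl
        rw [Function.update_of_ne hl.1]; exact h4 l hl.2
    · rintro ⟨i, f⟩ hp ⟨i', f'⟩ hp' he
      simp only [Finset.coe_sigma, Set.mem_sigma_iff, Finset.mem_coe, Finset.mem_filter, Finset.mem_univ, true_and, Finset.mem_erase] at hp hp' he
      have hi : i = i' := by simpa using congrFun he j
      subst hi
      have hf : f = f' := by
        ext l
        by_cases hl : l = j
        · subst hl; rw [hp.2.2.2 _ hL.1, hp'.2.2.2 _ hL.1]
        · simpa [hl] using congrFun he l
      subst hf; rfl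

open Classical in
/-- Schrijver's lower bound on the number of perfect matchings. -/
theorem schrijver (k : ℕ) (hk : 1 ≤ k) (A : V → V → Prop) (hrow : ∀ u, (Finset.univ.filter fun v => A u v).card = k)
    (hcol : ∀ v, (Finset.univ.filter fun u => A u v).card = k) :
    (k * gg k) ^ Fintype.card V ≤ (((Finset.univ : Finset (Equiv.Perm V)).filter fun π => ∀ u, A u (π u)).card : ℝ) := by
  have hk0 : (k:ℝ) ≠ 0 := by positivity
  have h1 := gur_ind k hk (fun j i => if A j i then (1 / k : ℝ) else 0) (fun j i => by split_ifs <;> positivity)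
    (fun i => by rw [← Finset.sum_filter, Finset.sum_const, hcol, nsmul_eq_mul]; field_simp)
    (fun i => by rw [← Finset.sum_filter, Finset.sum_const, hrow, nsmul_eq_mul]; field_simp)
    (fun j => by
      rw [← hrow j]
      refine Finset.card_le_card fun i => ?_
      simp only [Finset.mem_filter, Finset.mem_univ, true_and]
      intro h; by_contra h'; simp [h'] at h)
    Finset.univ.toList (Finset.nodup_toList _) (fun _ => 1) (fun _ => one_pos)
  have h2 := gP_count k A Finset.univ.toList (Finset.nodup_toList _) Finset.univ
  simp only [Finset.length_toList, Finset.toList_toFinset, Finset.sdiff_self, Finset.prod_empty, mul_one, Finset.sum_empty, Finset.card_univ] at h1 h2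
  have h3 := h1.trans h2
  rw [mul_pow]
  rw [one_div, inv_pow, inv_mul_eq_div, le_div_iff₀ (by positivity), mul_comm] at h3
  refine h3.trans ?_
  rw [Nat.cast_le]
  refine Finset.card_le_card_of_surjOn (fun π => (π : V → V)) ?_
  intro f hf
  simp only [Finset.mem_coe, Finset.mem_filter, Finset.mem_univ, true_and, Finset.mem_toList, forall_true_left] at hf
  have hinj : Function.Injective f := fun i j h => hf.2.1 i j h
  refine ⟨Equiv.ofBijective f (Finite.injective_iff_bijective.1 hinj), ?_, ?_⟩
  · simpa using fun u => (hf.1 u)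
  · ext; simp
end gurvits4
section gurvits5
variable {V : Type*} [DecidableEq V] [Fintype V]

noncomputable def hh (k : ℕ) : ℝ := (k.factorial : ℝ) ^ 2 / (k : ℝ) ^ k

theorem hh_succ (k : ℕ) : hh (k + 1) = (((k + 1 : ℕ) : ℝ) * gg (k + 1)) * hh k := by
  rcases Nat.eq_zero_or_pos k with rfl | hk
  · simp [hh, gg]
  · simp only [hh, gg, Nat.factorial_succ]
    push_cast
    have : (k:ℝ) ≠ 0 := by positivity
    have h2 : (k:ℝ) + 1 ≠ 0 := by positivity
    simp only [add_sub_cancel_right, add_tsub_cancel_right, div_pow]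
    field_simp
    ring

open Classical in
theorem tuples (k : ℕ) (A : V → V → Prop) (hrow : ∀ u, (Finset.univ.filter fun v => A u v).card = k)
    (hcol : ∀ v, (Finset.univ.filter fun u => A u v).card = k) :
    hh k ^ Fintype.card V ≤
      (((Finset.univ : Finset (Fin k → Equiv.Perm V)).filter fun π => ∀ u v : V, A u v ↔ ∃ j, π j u = v).card : ℝ) := by
  induction k generalizing A with
  | zero =>
    have : ((Finset.univ : Finset (Fin 0 → Equiv.Perm V)).filter fun π => ∀ u v : V, A u v ↔ ∃ j, π j u = v) = Finset.univ := by
      refine Finset.filter_true_of_mem fun π _ u v => ?_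
      have := hrow u
      rw [Finset.card_eq_zero, Finset.filter_eq_empty_iff] at this
      simpa using this (Finset.mem_univ v)
    rw [this]
    simp [hh]
  | succ k ih =>
    have h1 := schrijver (k + 1) (by omega) A hrow hcol
    rw [hh_succ, mul_pow]
    have h2 : ∀ π0 ∈ (Finset.univ : Finset (Equiv.Perm V)).filter (fun π => ∀ u, A u (π u)),
      hh k ^ Fintype.card V ≤ (((Finset.univ : Finset (Fin k → Equiv.Perm V)).filter fun π => ∀ u v, (A u v ∧ π0 u ≠ v) ↔ ∃ j, π j u = v).card : ℝ) := by
      intro π0 hπ0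
      simp only [Finset.mem_filter, Finset.mem_univ, true_and] at hπ0
      have hh1 := ih (fun u v => A u v ∧ π0 u ≠ v) ?_ ?_
      · convert hh1
      · intro u
        have : (Finset.univ.filter fun v => A u v ∧ π0 u ≠ v) = (Finset.univ.filter fun v => A u v).erase (π0 u) := by
          ext v; simp [and_comm, eq_comm]
        trans ((Finset.univ.filter fun v => A u v).erase (π0 u)).card
        · rw [← this]; congr
        · rw [Finset.card_erase_of_mem (by simp [hπ0]), hrow]; rfl
      · intro v
        have : (Finset.univ.filter fun u => A u v ∧ π0 u ≠ v) = (Finset.univ.filter fun u => A u v).erase (π0.symm v) := by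
          ext u; simp [and_comm, Equiv.eq_symm_apply]
        trans ((Finset.univ.filter fun u => A u v).erase (π0.symm v)).card
        · rw [← this]; congr
        · rw [Finset.card_erase_of_mem (by simpa using hπ0 (π0.symm v)), hcol]; rfl
    have h3 := Finset.card_nsmul_le_sum _ _ _ h2
    rw [nsmul_eq_mul, ← Nat.cast_sum, ← Finset.card_sigma] at h3
    have hpos : 0 ≤ hh k ^ Fintype.card V := by unfold hh; positivity
    refine (mul_le_mul_of_nonneg_right h1 hpos).trans (h3.trans ?_)
    rw [Nat.cast_le]
    refine Finset.card_le_card_of_injOn (fun p => Fin.cons p.1 p.2) ?_ ?_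
    · rintro ⟨π0, π⟩ hp
      simp only [Finset.coe_sigma, Set.mem_sigma_iff, Finset.mem_coe, Finset.mem_filter, Finset.mem_univ, true_and] at hp ⊢
      intro u v
      rw [Fin.exists_fin_succ]
      simp only [Fin.cons_zero, Fin.cons_succ]
      rw [← hp.2 u v]
      by_cases h : π0 u = v
      · subst h; simp [hp.1 u]
      · simp [h]
    · rintro ⟨π0, π⟩ _ ⟨π0', π'⟩ _ he
      have he : (Fin.cons π0 π : Fin (k+1) → Equiv.Perm V) = Fin.cons π0' π' := he
      rw [Fin.cons_inj] at he
      obtain ⟨rfl, rfl⟩ := he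
      rfl
end gurvits5
section eulerian

theorem two_col {D : Type*} (a b : D → D) (ha : ∀ d, a (a d) = d) (hb : ∀ d, b (b d) = d)
    (ha' : ∀ d, a d ≠ d) (hb' : ∀ d, b d ≠ d) :
    ∃ o : D → Prop, (∀ d, o (a d) ↔ ¬ o d) ∧ (∀ d, o (b d) ↔ ¬ o d) := by
  classical
  set pa : Equiv.Perm D := Function.Involutive.toPerm a ha with hpa
  set pb : Equiv.Perm D := Function.Involutive.toPerm b hb with hpb
  have hpa1 : pa * pa = 1 := by ext d; exact ha d
  have hpb1 : pb * pb = 1 := by ext d; exact hb d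
  have hpai : pa⁻¹ = pa := inv_eq_of_mul_eq_one_left hpa1
  have hpbi : pb⁻¹ = pb := inv_eq_of_mul_eq_one_left hpb1
  set ρ : Equiv.Perm D := pa * pb with hρ
  have hconj : pa * ρ * pa⁻¹ = ρ⁻¹ := by
    rw [hρ, mul_inv_rev, hpai, hpbi]
    calc pa * (pa * pb) * pa = (pa * pa) * (pb * pa) := by group
      _ = _ := by rw [hpa1, one_mul]
  have hconjz : ∀ k : ℤ, ∀ d, pa ((ρ ^ k) d) = (ρ ^ (-k)) (pa d) := by
    intro k d
    have h1 : pa * ρ ^ k * pa⁻¹ = ρ ^ (-k) := by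
      rw [← conj_zpow, hconj, inv_zpow, zpow_neg]
    have h2 : pa * ρ ^ k = ρ ^ (-k) * pa := by rw [← h1]; group
    exact congrArg (fun e : Equiv.Perm D => e d) h2
  have hns : ∀ d, ¬ ρ.SameCycle d (a d) := by
    rintro d ⟨k, hk⟩
    rcases Int.even_or_odd' k with ⟨m, rfl | rfl⟩
    · apply ha' ((ρ ^ m) d)
      have := hconjz m d
      change a ((ρ ^ m) d) = (ρ ^ (-m)) (a d) at this
      rw [this, ← hk, ← Equiv.Perm.mul_apply, ← zpow_add]
      congr 2; ring
    · apply hb' ((ρ ^ m) d)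
      have h1 := hconjz m d
      change a ((ρ ^ m) d) = (ρ ^ (-m)) (a d) at h1
      rw [← hk, ← Equiv.Perm.mul_apply, ← zpow_add, show -m + (2 * m + 1) = 1 + m by ring, zpow_add, zpow_one] at h1
      have h2 : a ((ρ ^ m) d) = a (b ((ρ ^ m) d)) := h1
      have := congrArg a h2
      rw [ha, ha] at this
      exact this.symm
  let st := Equiv.Perm.SameCycle.setoid ρ
  let q : D → Quotient st := Quotient.mk st
  have hq : ∀ x y, ρ.SameCycle x y → q x = q y := fun x y h => Quotient.sound h
  have hq' : ∀ x y, q x = q y → ρ.SameCycle x y := fun x y h => Quotient.exact h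
  let _ : LinearOrder (Quotient st) := linearOrderOfSTO WellOrderingRel
  have hba : ∀ d, q (b d) = q (a d) := by
    intro d
    refine hq _ _ ⟨1, ?_⟩
    have : a (b (b d)) = a d := by rw [hb]
    rw [zpow_one]; exact this
  have hab : ∀ d, q (a (b d)) = q d := by
    intro d
    refine (hq _ _ ⟨1, ?_⟩).symm
    rw [zpow_one]; rfl
  have hne : ∀ d, q d ≠ q (a d) := fun d h => hns d (hq' _ _ h)
  refine ⟨fun d => q d < q (a d), ?_, ?_⟩
  · intro d
    simp only [ha, not_lt]
    exact ⟨le_of_lt, fun h => lt_of_le_of_ne h (hne d).symm⟩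
  · intro d
    simp only [hab, hba, not_lt]
    exact ⟨le_of_lt, fun h => lt_of_le_of_ne h (hne d).symm⟩

theorem lab_bit {r : ℕ} {N : Type*} (out : N → Prop) (e : Fin r × Bool ≃ N)
    (h : ∀ i, out (e (i, true)) ↔ ¬ out (e (i, false))) :
    ∃ bit : Fin r → Bool, ∀ i b, out (e (i, b)) ↔ b = bit i := by
  classical
  refine ⟨fun i => decide (out (e (i, true))), ?_⟩
  intro i b
  have := h i
  cases b <;> by_cases h1 : out (e (i, true)) <;> simp_all

theorem lab_card {r : ℕ} {N : Type*} [Finite N] (out : N → Prop) (e : Fin r × Bool ≃ N)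
    (h : ∀ i, out (e (i, true)) ↔ ¬ out (e (i, false))) :
    Nat.card {x // out x} = r ∧ Nat.card {x // ¬ out x} = r := by
  obtain ⟨bit, hb⟩ := lab_bit out e h
  constructor
  · have : Fin r ≃ {x // out x} :=
      { toFun := fun i => ⟨e (i, bit i), by rw [hb]⟩
        invFun := fun x => (e.symm x).1
        left_inv := fun i => by simp
        right_inv := fun ⟨x, hx⟩ => by
          obtain ⟨⟨i, b⟩, rfl⟩ := e.surjective x
          rw [hb] at hx
          simp [hx] }
    rw [← Nat.card_congr this]; simp
  · have : Fin r ≃ {x // ¬ out x} :=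
      { toFun := fun i => ⟨e (i, !(bit i)), by rw [hb]; simp⟩
        invFun := fun x => (e.symm x).1
        left_inv := fun i => by simp
        right_inv := fun ⟨x, hx⟩ => by
          obtain ⟨⟨i, b⟩, rfl⟩ := e.surjective x
          rw [hb] at hx
          have : b = !(bit i) := by cases b <;> cases h1 : bit i <;> simp_all
          simp [this] }
    rw [← Nat.card_congr this]; simp

theorem lab_count {r : ℕ} {N : Type*} [Finite N] (out : N → Prop) :
    Nat.card {e : Fin r × Bool ≃ N // ∀ i, out (e (i, true)) ↔ ¬ out (e (i, false))} ≤
      2 ^ r * (r.factorial * r.factorial) := by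
  classical
  cases isEmpty_or_nonempty {e : Fin r × Bool ≃ N // ∀ i, out (e (i, true)) ↔ ¬ out (e (i, false))} with
  | inl h => simp
  | inr h =>
    obtain ⟨e0, he0⟩ := h
    have := Fintype.ofFinite N
    have hc := lab_card out e0 he0
    have hcard : Nat.card ((Fin r → Bool) × ((Fin r ↪ {x // out x}) × (Fin r ↪ {x // ¬ out x}))) = 2 ^ r * (r.factorial * r.factorial) := by
      rw [Nat.card_prod, Nat.card_prod]
      simp only [Nat.card_eq_fintype_card, Fintype.card_embedding_eq] at hc ⊢
      rw [hc.1, hc.2]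
      simp [Nat.descFactorial_self]
    rw [← hcard]
    choose bit hbit using fun e : {e : Fin r × Bool ≃ N // ∀ i, out (e (i, true)) ↔ ¬ out (e (i, false))} => lab_bit out e.1 e.2
    refine Nat.card_le_card_of_injective (fun e => (bit e,
      (⟨fun i => ⟨e.1 (i, bit e i), by rw [hbit]⟩, fun i j h => by
        have := e.1.injective (Subtype.ext_iff.1 h); simpa using congrArg Prod.fst this⟩,
       ⟨fun i => ⟨e.1 (i, !(bit e i)), by rw [hbit]; simp⟩, fun i j h => by
        have := e.1.injective (Subtype.ext_iff.1 h); simpa using congrArg Prod.fst this⟩))) ?_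
    intro e e' h
    simp only [Prod.mk.injEq] at h
    obtain ⟨h1, h2, h3⟩ := h
    apply Subtype.ext
    ext ⟨i, b⟩
    have h2 := congrArg (fun f => (f i).1) h2
    have h3 := congrArg (fun f => (f i).1) h3
    simp only [Function.Embedding.coeFn_mk, ← h1] at h2 h3
    by_cases hb : b = bit e i
    · rw [hb]; exact h2
    · have : b = !(bit e i) := by cases b <;> cases h1 : bit e i <;> simp_all
      rw [this]; exact h3

variable {V : Type*} [Fintype V] [DecidableEq V]

def IsEO (r : ℕ) (G : SimpleGraph V) (o : V → V → Prop) : Prop :=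
  (∀ u v, G.Adj u v ↔ o u v ∨ o v u) ∧ (∀ u v, o u v → ¬ o v u) ∧
    (∀ u, Nat.card {v // o u v} = r) ∧ (∀ v, Nat.card {u // o u v} = r)

theorem eo_exists (r : ℕ) (G : SimpleGraph V) (l : ∀ v, Fin r × Bool ≃ G.neighborSet v) :
    ∃ o, IsEO r G o ∧ ∀ v i, o v (l v (i, true)) ↔ ¬ o v (l v (i, false)) := by
  let D := Σ v, G.neighborSet v
  let a : D → D := fun d => ⟨d.2.1, ⟨d.1, G.adj_symm d.2.2⟩⟩
  let b : D → D := fun d => ⟨d.1, l d.1 (((l d.1).symm d.2).1, !((l d.1).symm d.2).2)⟩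
  obtain ⟨c, hca, hcb⟩ := two_col a b (fun d => rfl) (fun d => by simp [b])
    (fun d h => by
      have h1 : d.2.1 = d.1 := congrArg Sigma.fst h
      have h2 : G.Adj d.1 d.2.1 := d.2.2
      rw [h1] at h2; exact G.loopless.irrefl _ h2)
    (fun d h => by
      obtain ⟨v, w⟩ := d
      have h1 : l v (((l v).symm w).1, !((l v).symm w).2) = w := by
        exact eq_of_heq (Sigma.mk.inj h).2
      have h2 := (Equiv.eq_symm_apply _).2 h1
      have := congrArg Prod.snd h2
      simp at this)
  let o : V → V → Prop := fun u v => ∃ h : G.Adj u v, c ⟨u, ⟨v, h⟩⟩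
  have ho : ∀ v (w : G.neighborSet v), o v w ↔ c ⟨v, w⟩ := fun v w => ⟨fun ⟨h, h'⟩ => h', fun h => ⟨w.2, h⟩⟩
  have hcomp : ∀ v i, o v (l v (i, true)) ↔ ¬ o v (l v (i, false)) := by
    intro v i
    rw [ho, ho]
    have := hcb ⟨v, l v (i, false)⟩
    simpa [b] using this
  have hrev : ∀ u v, G.Adj u v → (o v u ↔ ¬ o u v) := by
    intro u v h
    have := hca ⟨u, ⟨v, h⟩⟩
    rw [← ho, ← ho] at this
    exact this
  have hoadj : ∀ u v, o u v → G.Adj u v := fun u v h => h.1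
  refine ⟨o, ⟨?_, ?_, ?_, ?_⟩, hcomp⟩
  · intro u v
    constructor
    · intro h; have := hrev u v h; tauto
    · rintro (h | h)
      · exact h.1
      · exact h.1.symm
  · intro u v h; have := hrev u v h.1; tauto
  · intro u
    rw [← (lab_card (fun w : G.neighborSet u => o u w) (l u) (hcomp u)).1]
    refine Nat.card_congr ⟨fun v => ⟨⟨v.1, hoadj _ _ v.2⟩, v.2⟩, fun v => ⟨v.1.1, v.2⟩, fun _ => rfl, fun _ => rfl⟩
  · intro u
    rw [← (lab_card (fun w : G.neighborSet u => o u w) (l u) (hcomp u)).2]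
    refine Nat.card_congr ⟨fun v => ⟨⟨v.1, (hoadj _ _ v.2).symm⟩, (hrev _ _ (hoadj _ _ v.2)).not.2 (not_not.2 v.2)⟩, fun v => ⟨v.1.1, (hrev _ _ v.1.2).2 v.2⟩, fun _ => rfl, fun _ => rfl⟩

theorem eo_count (r : ℕ) (G : SimpleGraph V) (hG : ∀ v, (G.neighborSet v).ncard = 2 * r) :
    (2 * r).factorial ^ Fintype.card V ≤
      Nat.card {o // IsEO r G o} * (2 ^ r * (r.factorial * r.factorial)) ^ Fintype.card V := by
  classical
  have hN : ∀ v, Nat.card (G.neighborSet v) = 2 * r := hG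
  have hlab : Nat.card (∀ v, Fin r × Bool ≃ G.neighborSet v) = (2 * r).factorial ^ Fintype.card V := by
    rw [Nat.card_pi]
    rw [Finset.prod_congr rfl (g := fun _ => (2 * r).factorial)]
    · simp
    · intro v _
      have e : Fin r × Bool ≃ G.neighborSet v := by
        refine Fintype.equivOfCardEq ?_
        rw [← Nat.card_eq_fintype_card (α := G.neighborSet v), hN]; simp [mul_comm]
      rw [Nat.card_eq_fintype_card, Fintype.card_equiv e]
      simp [mul_comm]
  choose f hf hf' using fun l => eo_exists r G l
  rw [← hlab]
  have h1 : Nat.card (∀ v, Fin r × Bool ≃ G.neighborSet v) ≤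
      Nat.card (Σ o : {o // IsEO r G o}, {l : ∀ v, Fin r × Bool ≃ G.neighborSet v // ∀ v, ∀ i, o.1 v (l v (i, true)) ↔ ¬ o.1 v (l v (i, false))}) := by
    refine Nat.card_le_card_of_injective (fun l => ⟨⟨f l, hf l⟩, ⟨l, hf' l⟩⟩) ?_
    intro l l' h
    have := congrArg (fun p : (Σ o : {o // IsEO r G o}, {l : ∀ v, Fin r × Bool ≃ G.neighborSet v // ∀ v, ∀ i, o.1 v (l v (i, true)) ↔ ¬ o.1 v (l v (i, false))}) => p.2.1) h
    exact this
  refine h1.trans ?_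
  have := Fintype.ofFinite {o // IsEO r G o}
  rw [Nat.card_sigma, Nat.card_eq_fintype_card (α := {o // IsEO r G o}), ← smul_eq_mul]
  refine Finset.sum_le_card_nsmul _ _ _ fun o _ => ?_
  rw [Nat.card_congr (Equiv.subtypePiEquivPi (p := fun v (e : Fin r × Bool ≃ G.neighborSet v) => ∀ i, o.1 v (e (i, true)) ↔ ¬ o.1 v (e (i, false)))), Nat.card_pi]
  refine (Finset.prod_le_pow_card _ _ _ fun v _ => lab_count (fun w : G.neighborSet v => o.1 v w)).trans ?_
  simp
end eulerian
section decsec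
variable {V : Type*} [Fintype V] [DecidableEq V]

def IsDec (r : ℕ) (G : SimpleGraph V) (π : Fin r → Equiv.Perm V) : Prop :=
  ∀ u v, G.Adj u v ↔ ∃ j, π j u = v ∨ π j v = u

theorem dec_count (r : ℕ) (G : SimpleGraph V) (hG : ∀ v, (G.neighborSet v).ncard = 2 * r) (hr : 1 ≤ r) :
    (((2 * r).factorial : ℝ) / (2 * r : ℝ) ^ r) ^ Fintype.card V ≤ (Nat.card {π // IsDec r G π} : ℝ) := by
  classical
  have h1 : (((2 * r).factorial ^ Fintype.card V : ℕ) : ℝ) ≤ _ := Nat.cast_le.2 (eo_count r G hG)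
  have := Fintype.ofFinite {o // IsEO r G o}
  have h2 : (Nat.card {o // IsEO r G o} : ℝ) * hh r ^ Fintype.card V ≤ (Nat.card {π // IsDec r G π} : ℝ) := by
    have h3 : Nat.card (Σ o : {o // IsEO r G o}, {π : Fin r → Equiv.Perm V // ∀ u v, o.1 u v ↔ ∃ j, π j u = v}) ≤ Nat.card {π // IsDec r G π} := by
      refine Nat.card_le_card_of_injective (fun p => ⟨p.2.1, ?_⟩) ?_
      · intro u v
        rw [p.1.2.1 u v, p.2.2 u v, p.2.2 v u, ← exists_or]
      · rintro ⟨⟨o, ho⟩, ⟨π, hπ⟩⟩ ⟨⟨o', ho'⟩, ⟨π', hπ'⟩⟩ h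
        have h : π = π' := congrArg Subtype.val h
        subst h
        have : o = o' := by ext u v; exact (hπ u v).trans (hπ' u v).symm
        subst this
        rfl
    refine le_trans ?_ (Nat.cast_le.2 h3)
    rw [Nat.card_sigma, Nat.card_eq_fintype_card, ← nsmul_eq_mul, Nat.cast_sum]
    refine Finset.card_nsmul_le_sum _ _ _ fun o _ => ?_
    have h4 := tuples r o.1 (fun u => by
      have := o.2.2.2.1 u
      rw [Nat.card_eq_fintype_card, Fintype.card_subtype] at this
      convert this) (fun u => by
      have := o.2.2.2.2 u
      rw [Nat.card_eq_fintype_card, Fintype.card_subtype] at this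
      convert this)
    refine h4.trans (le_of_eq ?_)
    rw [Nat.card_eq_fintype_card, Fintype.card_subtype]
  refine le_trans ?_ h2
  push_cast at h1
  have hr0 : (r:ℝ) ≠ 0 := by positivity
  have e1 : (2:ℝ) ^ r * (r.factorial * r.factorial) * (((2 * r).factorial : ℝ) / (2 * r : ℝ) ^ r) = (2 * r).factorial * hh r := by
    rw [hh, mul_pow]; field_simp
  have hpos : (0:ℝ) < ((2:ℝ) ^ r * (r.factorial * r.factorial)) ^ Fintype.card V := by positivity
  refine le_of_mul_le_mul_left ?_ hpos
  rw [← mul_pow, e1, mul_pow]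
  have hh0 : 0 ≤ hh r ^ Fintype.card V := by unfold hh; positivity
  calc _ ≤ _ := mul_le_mul_of_nonneg_right h1 hh0
    _ = _ := by ring
end decsec
section insertion
variable {V : Type*}

abbrev RG (V : Type*) (d : ℕ) := {G : SimpleGraph V // ∀ v, (G.neighborSet v).ncard = d}

theorem RG_card_le {V W : Type*} [Finite V] [Finite W] (e : V ≃ W) (d : ℕ) : Nat.card (RG V d) ≤ Nat.card (RG W d) := by
  refine Nat.card_le_card_of_injective (fun G => ⟨G.1.comap e.symm, fun v => ?_⟩) ?_
  · refine Eq.trans ?_ (G.2 (e.symm v))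
    have : (G.1.comap e.symm).neighborSet v = e.symm ⁻¹' (G.1.neighborSet (e.symm v)) := by
      ext w; simp
    rw [this]
    exact Set.ncard_preimage_of_injective_subset_range e.symm.injective (by simp)
  · intro G G' h
    have h : G.1.comap e.symm = G'.1.comap e.symm := congrArg Subtype.val h
    apply Subtype.ext
    ext u v
    have := congrArg (fun H : SimpleGraph W => H.Adj (e u) (e v)) h
    simpa using this

def epf {m : ℕ} (w : Fin m → V × V) : Fin m × Bool → V := fun p => bif p.2 then (w p.1).2 else (w p.1).1

def WV (G : SimpleGraph V) {m : ℕ} (w : Fin m → V × V) : Prop :=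
  (∀ i, G.Adj (w i).1 (w i).2) ∧ Function.Injective (epf w)

theorem epf_range {m : ℕ} (w : Fin m → V × V) (x : V) : x ∈ Set.range (epf w) ↔ ∃ i, (w i).1 = x ∨ (w i).2 = x := by
  simp [epf, Set.mem_range, Prod.exists, exists_or]

theorem WV_cons (G : SimpleGraph V) {m : ℕ} (w : Fin m → V × V) (h : WV G w) (p : V × V) (hp : G.Adj p.1 p.2)
    (h1 : p.1 ∉ Set.range (epf w)) (h2 : p.2 ∉ Set.range (epf w)) : WV G (Fin.cons p w : Fin (m+1) → V × V) := by
  constructor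
  · intro i
    refine Fin.cases ?_ (fun i => ?_) i
    · simpa using hp
    · simpa using h.1 i
  · have e0 : ∀ b, epf (Fin.cons p w : Fin (m+1) → V × V) (0, b) = bif b then p.2 else p.1 := fun b => by simp [epf]
    have es : ∀ i b, epf (Fin.cons p w : Fin (m+1) → V × V) (i.succ, b) = epf w (i, b) := fun i b => by simp [epf]
    have hb : ∀ b, (bif b then p.2 else p.1) ∉ Set.range (epf w) := by
      rintro (_ | _)
      · exact h1
      · exact h2
    rintro ⟨i, b⟩ ⟨i', b'⟩
    refine Fin.cases ?_ (fun i => ?_) i <;> refine Fin.cases ?_ (fun i' => ?_) i'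
    · rw [e0, e0]
      have := G.ne_of_adj hp
      cases b <;> cases b' <;> simp [this, this.symm]
    · rw [e0, es]; intro h; exact absurd ⟨_, h.symm⟩ (hb b)
    · rw [e0, es]; intro h; exact absurd ⟨_, h⟩ (hb b')
    · rw [es, es]; intro hh
      have := h.2 hh
      simp at this; simp [this]

open Classical in
theorem WV_count [Fintype V] (r : ℕ) (G : SimpleGraph V) (hG : ∀ v, (G.neighborSet v).ncard = 2 * r) (m : ℕ) (hm : m ≤ r) :
    (2 * r * Fintype.card V - 8 * r * (r - 1)) ^ m ≤ ((Finset.univ : Finset (Fin m → V × V)).filter fun w => WV G w).card := by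
  have hdeg : ∀ v, (Finset.univ.filter fun u => G.Adj v u).card = 2 * r := by
    intro v; rw [← hG v, Set.ncard_eq_toFinset_card']; congr 1; ext u; simp
  induction m with
  | zero =>
    simp only [pow_zero]
    refine Finset.card_pos.2 ⟨default, ?_⟩
    simp only [Finset.mem_filter, Finset.mem_univ, true_and]
    exact ⟨fun i => i.elim0, fun p => p.1.elim0⟩
  | succ m ih =>
    have ih := ih (by omega)
    have key : ∀ w ∈ (Finset.univ : Finset (Fin m → V × V)).filter (fun w => WV G w),
        2 * r * Fintype.card V - 8 * r * (r - 1) ≤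
        ((Finset.univ : Finset (V × V)).filter fun p => G.Adj p.1 p.2 ∧ p.1 ∉ Set.range (epf w) ∧ p.2 ∉ Set.range (epf w)).card := by
      intro w hw
      set X : Finset V := Finset.univ.filter fun x => x ∈ Set.range (epf w) with hX
      have hXc : X.card ≤ 2 * m := by
        have : X = Finset.univ.image (epf w) := by ext; simp [hX]
        rw [this]
        refine Finset.card_image_le.trans ?_
        simp [mul_comm]
      have c1 : ∀ Y : Finset V, ((Finset.univ : Finset (V × V)).filter fun p => G.Adj p.1 p.2 ∧ p.1 ∈ Y).card = Y.card * (2 * r) := by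
        intro Y
        have : ((Finset.univ : Finset (V × V)).filter fun p => G.Adj p.1 p.2 ∧ p.1 ∈ Y) =
          (Y.sigma fun v => Finset.univ.filter fun u => G.Adj v u).map (Equiv.sigmaEquivProd V V).toEmbedding := by
          ext ⟨u, v⟩; simp [Finset.mem_map_equiv, and_comm]
        rw [this, Finset.card_map, Finset.card_sigma, Finset.sum_congr rfl fun v _ => hdeg v]
        simp
      have c2 : ∀ Y : Finset V, ((Finset.univ : Finset (V × V)).filter fun p => G.Adj p.1 p.2 ∧ p.2 ∈ Y).card = Y.card * (2 * r) := by
        intro Y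
        rw [← c1 Y]
        refine Finset.card_bij (fun p _ => p.swap) ?_ ?_ ?_
        · rintro ⟨u, v⟩ h; simp at h ⊢; exact ⟨h.1.symm, h.2⟩
        · rintro ⟨u, v⟩ _ ⟨u', v'⟩ _ h; simp at h ⊢; tauto
        · rintro ⟨u, v⟩ h; simp at h ⊢; exact ⟨h.1.symm, h.2⟩
      have hsub : ((Finset.univ : Finset (V × V)).filter fun p => G.Adj p.1 p.2 ∧ p.1 ∈ (Finset.univ : Finset V)) ⊆
         (((Finset.univ : Finset (V × V)).filter fun p => G.Adj p.1 p.2 ∧ p.1 ∉ Set.range (epf w) ∧ p.2 ∉ Set.range (epf w)) ∪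
          ((Finset.univ : Finset (V × V)).filter fun p => G.Adj p.1 p.2 ∧ p.1 ∈ X)) ∪ ((Finset.univ : Finset (V × V)).filter fun p => G.Adj p.1 p.2 ∧ p.2 ∈ X) := by
        intro p hp
        simp only [hX, Finset.mem_union, Finset.mem_filter, Finset.mem_univ, true_and] at hp ⊢
        tauto
      have := Finset.card_le_card hsub
      have h3 := this.trans (Finset.card_union_le _ _)
      have h4 := h3.trans (Nat.add_le_add_right (Finset.card_union_le _ _) _)
      rw [c1, c1, c2, Finset.card_univ] at h4
      have h5 : X.card * (2 * r) ≤ (2 * (r - 1)) * (2 * r) := Nat.mul_le_mul_right _ (hXc.trans (by omega))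
      rw [Nat.sub_le_iff_le_add]
      nlinarith
    have h3 := Finset.card_nsmul_le_sum _ _ _ key
    rw [smul_eq_mul, ← Finset.card_sigma] at h3
    rw [pow_succ]
    refine (Nat.mul_le_mul_right _ ih).trans (h3.trans ?_)
    refine Finset.card_le_card_of_injOn (fun p => Fin.cons p.2 p.1) ?_ ?_
    · rintro ⟨w, p⟩ hp
      simp only [Finset.coe_sigma, Set.mem_sigma_iff, Finset.mem_coe, Finset.mem_filter, Finset.mem_univ, true_and] at hp ⊢
      exact WV_cons G w hp.1 p hp.2.1 hp.2.2.1 hp.2.2.2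
    · rintro ⟨w, p⟩ _ ⟨w', p'⟩ _ he
      have he : (Fin.cons p w : Fin (m+1) → V × V) = Fin.cons p' w' := he
      rw [Fin.cons_inj] at he
      obtain ⟨rfl, rfl⟩ := he
      rfl

def insA (G : SimpleGraph V) {r : ℕ} (w : Fin r → V × V) : Option V → Option V → Prop
  | none, none => False
  | none, some v => v ∈ Set.range (epf w)
  | some u, none => u ∈ Set.range (epf w)
  | some u, some v => G.Adj u v ∧ ¬ ∃ i, w i = (u, v) ∨ w i = (v, u)

def insG (G : SimpleGraph V) {r : ℕ} (w : Fin r → V × V) : SimpleGraph (Option V) where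
  Adj := insA G w
  symm := ⟨by
    rintro (_ | u) (_ | v) h
    · exact h
    · exact h
    · exact h
    · exact ⟨h.1.symm, fun ⟨i, hi⟩ => h.2 ⟨i, hi.symm⟩⟩⟩
  loopless := ⟨by
    rintro (_ | u) h
    · exact h
    · exact G.loopless.irrefl _ h.1⟩

theorem insG_reg [Fintype V] (r : ℕ) (G : SimpleGraph V) (hG : ∀ v, (G.neighborSet v).ncard = 2 * r) (w : Fin r → V × V)
    (hw : WV G w) (v : Option V) : ((insG G w).neighborSet v).ncard = 2 * r := by
  rcases v with _ | v
  · have : (insG G w).neighborSet none = some '' Set.range (epf w) := by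
      ext (_ | u)
      · simp [insG, insA]
      · simp [insG, insA]
    rw [this, Set.ncard_image_of_injective _ (Option.some_injective _), ← Set.image_univ, Set.ncard_image_of_injective _ hw.2]
    simp [Set.ncard_univ, mul_comm]
  · by_cases hv : v ∈ Set.range (epf w)
    · obtain ⟨⟨i, b⟩, hib⟩ := hv
      set z := epf w (i, !b) with hz
      have hadj : G.Adj v z := by
        rw [hz, ← hib]
        have := hw.1 i
        cases b
        · simpa [epf] using this
        · simpa [epf] using this.symm
      have hiff : ∀ u, (∃ i, w i = (v, u) ∨ w i = (u, v)) ↔ u = z := by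
        intro u
        constructor
        · rintro ⟨i', h | h⟩
          · have h1 : epf w (i', false) = v := by simp [epf, h]
            have h2 : epf w (i', true) = u := by simp [epf, h]
            have h3 := hw.2 (h1.trans hib.symm)
            simp only [Prod.mk.injEq] at h3
            rw [← h2, hz, h3.1, ← h3.2]; rfl
          · have h1 : epf w (i', true) = v := by simp [epf, h]
            have h2 : epf w (i', false) = u := by simp [epf, h]
            have h3 := hw.2 (h1.trans hib.symm)
            simp only [Prod.mk.injEq] at h3
            rw [← h2, hz, h3.1, ← h3.2]; rfl
        · rintro rfl
          refine ⟨i, ?_⟩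
          cases b
          · left; ext
            · simpa [epf] using hib
            · simp [hz, epf]
          · right; ext
            · simp [hz, epf]
            · simpa [epf] using hib
      have : (insG G w).neighborSet (some v) = insert none (some '' (G.neighborSet v \ {z})) := by
        ext (_ | u)
        · simp only [SimpleGraph.mem_neighborSet, insG, insA, Set.mem_insert_iff, true_or, iff_true]
          exact ⟨_, hib⟩
        · simp [insG, insA, -not_exists, hiff u]
      rw [this, Set.ncard_insert_of_notMem (by simp), Set.ncard_image_of_injective _ (Option.some_injective _),
        Set.ncard_sdiff_singleton_add_one (by exact hadj), hG]
    · have : (insG G w).neighborSet (some v) = some '' (G.neighborSet v) := by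
        ext (_ | u)
        · simp only [SimpleGraph.mem_neighborSet, insG, insA, hv]; simp
        · have : ¬ ∃ i, w i = (v, u) ∨ w i = (u, v) := by
            rintro ⟨i, h | h⟩ <;> exact hv ((epf_range w v).2 ⟨i, by simp [h]⟩)
          simp [insG, insA, -not_exists, this]
      rw [this, Set.ncard_image_of_injective _ (Option.some_injective _), hG]

theorem ins_step (V : Type*) [Fintype V] (r : ℕ) :
    Nat.card (RG V (2 * r)) * (2 * r * Fintype.card V - 8 * r * (r - 1)) ^ r ≤ Nat.card (RG (Option V) (2 * r)) * (2 * r).factorial := by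
  classical
  have f1 := Fintype.ofFinite (RG V (2 * r))
  have f2 := Fintype.ofFinite (RG (Option V) (2 * r))
  have h1 : Nat.card (Σ G : RG V (2 * r), {w : Fin r → V × V // WV G.1 w}) ≤
      Nat.card (Σ G : RG (Option V) (2 * r), (Fin r × Bool ↪ G.1.neighborSet none)) := by
    refine Nat.card_le_card_of_injective (fun p => ⟨⟨insG p.1.1 p.2.1, insG_reg r p.1.1 p.1.2 p.2.1 p.2.2⟩,
      ⟨fun x => ⟨some (epf p.2.1 x), ⟨x, rfl⟩⟩, fun x y h => p.2.2.2 (Option.some_injective _ (congrArg Subtype.val h))⟩⟩) ?_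
    rintro ⟨⟨G, hG⟩, ⟨w, hw⟩⟩ ⟨⟨G', hG'⟩, ⟨w', hw'⟩⟩ h
    have hI : insG G w = insG G' w' := by
      have := congrArg (fun p : (Σ G : RG (Option V) (2 * r), (Fin r × Bool ↪ G.1.neighborSet none)) => p.1.1) h
      exact this
    have he : ∀ x, epf w x = epf w' x := by
      intro x
      have := congrArg (fun p : (Σ G : RG (Option V) (2 * r), (Fin r × Bool ↪ G.1.neighborSet none)) => (p.2 x).1) h
      exact Option.some_injective _ this
    have hww : w = w' := by
      ext i
      · simpa [epf] using he (i, false)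
      · simpa [epf] using he (i, true)
    subst hww
    have hGG : G = G' := by
      ext u v
      have h1 : insA G w (some u) (some v) ↔ insA G' w (some u) (some v) := by
        change (insG G w).Adj (some u) (some v) ↔ (insG G' w).Adj (some u) (some v); rw [hI]
      simp only [insA] at h1
      by_cases h2 : ∃ i, w i = (u, v) ∨ w i = (v, u)
      · obtain ⟨i, h2 | h2⟩ := h2
        · have a1 := hw.1 i; have a2 := hw'.1 i; simp only [h2] at a1 a2; exact ⟨fun _ => a2, fun _ => a1⟩
        · have a1 := hw.1 i; have a2 := hw'.1 i; simp only [h2] at a1 a2; exact ⟨fun _ => a2.symm, fun _ => a1.symm⟩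
      · simpa [-not_exists, h2] using h1
    subst hGG
    rfl
  have h2 : Nat.card (RG V (2 * r)) * (2 * r * Fintype.card V - 8 * r * (r - 1)) ^ r ≤ Nat.card (Σ G : RG V (2 * r), {w : Fin r → V × V // WV G.1 w}) := by
    rw [Nat.card_sigma, Nat.card_eq_fintype_card (α := RG V (2 * r)), ← smul_eq_mul]
    refine Finset.card_nsmul_le_sum _ _ _ fun G _ => ?_
    refine (WV_count r G.1 G.2 r le_rfl).trans (le_of_eq ?_)
    rw [Nat.card_eq_fintype_card, Fintype.card_subtype]
  refine h2.trans (h1.trans ?_)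
  rw [Nat.card_sigma, Nat.card_eq_fintype_card (α := RG (Option V) (2 * r))]
  refine Finset.sum_le_card_nsmul Finset.univ _ ((2 * r).factorial) fun G _ => ?_
  have := G.2 none
  have hc : Nat.card (G.1.neighborSet none) = 2 * r := this
  have f3 := Fintype.ofFinite (G.1.neighborSet none)
  rw [Nat.card_eq_fintype_card] at hc ⊢
  rw [Fintype.card_embedding_eq, hc]
  simp [mul_comm r 2, Nat.descFactorial_self]

theorem RG_base (r : ℕ) : 1 ≤ Nat.card (RG (Fin (4 * r)) (2 * r)) := by
  have e : Fin (2 * r) ⊕ Fin (2 * r) ≃ Fin (4 * r) := finSumFinEquiv.trans (finCongr (by ring))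
  refine le_trans ?_ (RG_card_le e (2 * r))
  have : Nonempty (RG (Fin (2 * r) ⊕ Fin (2 * r)) (2 * r)) := by
    refine ⟨⟨completeBipartiteGraph _ _, ?_⟩⟩
    rintro (v | v)
    · have : (completeBipartiteGraph (Fin (2 * r)) (Fin (2 * r))).neighborSet (Sum.inl v) = Set.range Sum.inr := by
        ext (u | u) <;> simp
      rw [this, ← Set.image_univ, Set.ncard_image_of_injective _ Sum.inr_injective]; simp [Set.ncard_univ]
    · have : (completeBipartiteGraph (Fin (2 * r)) (Fin (2 * r))).neighborSet (Sum.inr v) = Set.range Sum.inl := by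
        ext (u | u) <;> simp
      rw [this, ← Set.image_univ, Set.ncard_image_of_injective _ Sum.inl_injective]; simp [Set.ncard_univ]
  exact Nat.card_pos

theorem RG_lower (r : ℕ) (hr : 1 ≤ r) (t : ℕ) :
    ((2 * r) ^ t * t.factorial) ^ r ≤ Nat.card (RG (Fin (4 * r + t)) (2 * r)) * (2 * r).factorial ^ t := by
  induction t with
  | zero => simpa using RG_base r
  | succ t ih =>
    have h1 := ins_step (Fin (4 * r + t)) r
    have h2 := RG_card_le (finSuccEquiv (4 * r + t)).symm (2 * r)
    rw [Fintype.card_fin] at h1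
    have h3 : 2 * r * (t + 1) ≤ 2 * r * (4 * r + t) - 8 * r * (r - 1) := by
      obtain ⟨r, rfl⟩ := Nat.exists_eq_add_of_le hr
      simp only [add_tsub_cancel_left]
      refine Nat.le_sub_of_add_le ?_
      nlinarith
    have h4 := Nat.pow_le_pow_left h3 r
    calc ((2 * r) ^ (t + 1) * (t + 1).factorial) ^ r = ((2 * r) ^ t * t.factorial) ^ r * (2 * r * (t + 1)) ^ r := by
          rw [Nat.factorial_succ, ← mul_pow]; ring
      _ ≤ (Nat.card (RG (Fin (4 * r + t)) (2 * r)) * (2 * r).factorial ^ t) * (2 * r * (4 * r + t) - 8 * r * (r - 1)) ^ r := Nat.mul_le_mul ih h4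
      _ = (Nat.card (RG (Fin (4 * r + t)) (2 * r)) * (2 * r * (4 * r + t) - 8 * r * (r - 1)) ^ r) * (2 * r).factorial ^ t := by ring
      _ ≤ (Nat.card (RG (Option (Fin (4 * r + t))) (2 * r)) * (2 * r).factorial) * (2 * r).factorial ^ t := Nat.mul_le_mul_right _ h1
      _ ≤ (Nat.card (RG (Fin (4 * r + t + 1)) (2 * r)) * (2 * r).factorial) * (2 * r).factorial ^ t := by gcongr
      _ = _ := by rw [pow_succ]; ring_nf
end insertion
section badpairs
variable {V : Type*} [DecidableEq V]

def avoidS (a b : ℕ → V) (m : ℕ) (S : Finset V) (k : ℕ) : Finset (Finset V) :=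
  {J ∈ S.powersetCard k | ∀ i < m, ¬ (a i ∈ J ∧ b i ∈ J)}

theorem avoidS_step (a b : ℕ → V) (m : ℕ) (S : Finset V) (k : ℕ) (hab : a m ≠ b m) :
    (avoidS a b (m + 1) S (k + 1)).card ≤ (avoidS a b m ((S.erase (a m)).erase (b m)) (k + 1)).card +
      2 * (avoidS a b m ((S.erase (a m)).erase (b m)) k).card := by
  set S' := (S.erase (a m)).erase (b m) with hS'
  have hsub : avoidS a b (m + 1) S (k + 1) ⊆ avoidS a b m S' (k + 1) ∪
      ((avoidS a b m S' k).image (insert (a m)) ∪ (avoidS a b m S' k).image (insert (b m))) := by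
    intro J hJ
    simp only [avoidS, Finset.mem_filter, Finset.mem_powersetCard] at hJ
    obtain ⟨⟨hJS, hJk⟩, hav⟩ := hJ
    have hm := hav m (Nat.lt_succ_self m)
    have hav' : ∀ i < m, ¬ (a i ∈ J ∧ b i ∈ J) := fun i hi => hav i (Nat.lt_succ_of_lt hi)
    simp only [Finset.mem_union, Finset.mem_image, avoidS, Finset.mem_filter, Finset.mem_powersetCard]
    by_cases h1 : a m ∈ J
    · have h2 : b m ∉ J := fun h => hm ⟨h1, h⟩
      right; left
      refine ⟨J.erase (a m), ⟨⟨?_, ?_⟩, ?_⟩, Finset.insert_erase h1⟩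
      · intro x hx
        simp only [Finset.mem_erase, hS'] at hx ⊢
        refine ⟨?_, hx.1, hJS hx.2⟩
        rintro rfl; exact h2 hx.2
      · rw [Finset.card_erase_of_mem h1, hJk]; rfl
      · intro i hi h
        exact hav' i hi ⟨Finset.mem_of_mem_erase h.1, Finset.mem_of_mem_erase h.2⟩
    · by_cases h2 : b m ∈ J
      · right; right
        refine ⟨J.erase (b m), ⟨⟨?_, ?_⟩, ?_⟩, Finset.insert_erase h2⟩
        · intro x hx
          simp only [Finset.mem_erase, hS'] at hx ⊢
          refine ⟨hx.1, ?_, hJS hx.2⟩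
          rintro rfl; exact h1 hx.2
        · rw [Finset.card_erase_of_mem h2, hJk]; rfl
        · intro i hi h
          exact hav' i hi ⟨Finset.mem_of_mem_erase h.1, Finset.mem_of_mem_erase h.2⟩
      · left
        refine ⟨⟨?_, hJk⟩, hav'⟩
        intro x hx
        simp only [Finset.mem_erase, hS']
        refine ⟨?_, ?_, hJS hx⟩ <;> rintro rfl <;> contradiction
  refine (Finset.card_le_card hsub).trans ((Finset.card_union_le _ _).trans ?_)
  have h1 := Finset.card_union_le ((avoidS a b m S' k).image (insert (a m))) ((avoidS a b m S' k).image (insert (b m)))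
  have h2 := Finset.card_image_le (s := avoidS a b m S' k) (f := insert (a m))
  have h3 := Finset.card_image_le (s := avoidS a b m S' k) (f := insert (b m))
  omega

theorem choose_beta (n N k κ : ℕ) (hn : 0 < n) (hN : N + 2 ≤ n) (hk : κ ≤ k + 1) :
    ((N.choose (k + 2) : ℝ) + 2 * N.choose (k + 1)) ≤ (1 - ((κ : ℝ) / n) ^ 2) * (N + 2).choose (k + 2) := by
  have e1 : (N + 2).choose (k + 2) = N.choose k + 2 * N.choose (k + 1) + N.choose (k + 2) := by
    rw [Nat.choose_succ_succ' (N + 1) (k + 1), Nat.choose_succ_succ' N k, Nat.choose_succ_succ' N (k + 1)]; ring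
  have h1 := Nat.add_one_mul_choose_eq (N + 1) (k + 1)
  have h2 := Nat.add_one_mul_choose_eq N k
  have h3 : (N + 2) * ((N + 1) * N.choose k) = (N + 2).choose (k + 2) * (k + 2) * (k + 1) := by
    rw [h2, ← mul_assoc]
    have : (N + 2) * (N + 1).choose (k + 1) = (N + 2).choose (k + 2) * (k + 2) := h1
    rw [this]
  have h4 : (N + 2).choose (k + 2) * κ ^ 2 ≤ n ^ 2 * N.choose k := by
    calc (N + 2).choose (k + 2) * κ ^ 2 ≤ (N + 2).choose (k + 2) * ((k + 2) * (k + 1)) := by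
          apply Nat.mul_le_mul_left; nlinarith
      _ = (N + 2) * (N + 1) * N.choose k := by rw [mul_assoc, h3]; ring
      _ ≤ n ^ 2 * N.choose k := by apply Nat.mul_le_mul_right; nlinarith
  have h5 : ((N + 2).choose (k + 2) : ℝ) * (κ / n) ^ 2 ≤ N.choose k := by
    have : ((N + 2).choose (k + 2) : ℝ) * κ ^ 2 ≤ n ^ 2 * N.choose k := by exact_mod_cast h4
    rw [div_pow, ← mul_div_assoc, div_le_iff₀ (by positivity)]
    linarith
  have e1' : ((N + 2).choose (k + 2) : ℝ) = N.choose k + 2 * N.choose (k + 1) + N.choose (k + 2) := by exact_mod_cast e1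
  nlinarith

theorem avoidS_bound (a b : ℕ → V) (n κ : ℕ) (hn : 0 < n) (hκ : κ ≤ n) (m : ℕ) :
    ∀ (S : Finset V) (k : ℕ), S.card ≤ n → κ + 1 + m ≤ k →
    (∀ i < m, a i ∈ S ∧ b i ∈ S ∧ a i ≠ b i) →
    (∀ i < m, ∀ j < m, i ≠ j → a i ≠ a j ∧ a i ≠ b j ∧ b i ≠ b j) →
    ((avoidS a b m S k).card : ℝ) ≤ (1 - ((κ : ℝ) / n) ^ 2) ^ m * S.card.choose k := by
  have hb : 0 ≤ 1 - ((κ : ℝ) / n) ^ 2 := by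
    have : (κ : ℝ) / n ≤ 1 := by
      rw [div_le_one (by positivity)]; exact_mod_cast hκ
    have h0 : 0 ≤ (κ : ℝ) / n := by positivity
    nlinarith
  induction m with
  | zero =>
    intro S k _ _ _ _
    simp only [pow_zero, one_mul, Nat.cast_le]
    rw [← Finset.card_powersetCard]
    exact Finset.card_filter_le _ _
  | succ m ih =>
    intro S k hS hk h1 h2
    obtain ⟨k, rfl⟩ : ∃ k', k = k' + 2 := ⟨k - 2, by omega⟩
    have hm := h1 m (Nat.lt_succ_self m)
    have hc : ((S.erase (a m)).erase (b m)).card + 2 = S.card := by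
      have e1 := Finset.card_erase_add_one hm.1
      have e2 := Finset.card_erase_add_one (Finset.mem_erase.2 ⟨hm.2.2.symm, hm.2.1⟩)
      omega
    set S' := (S.erase (a m)).erase (b m) with hS'
    have h1' : ∀ i < m, a i ∈ S' ∧ b i ∈ S' ∧ a i ≠ b i := by
      intro i hi
      have q := h1 i (by omega)
      have q1 := h2 i (by omega) m (by omega) (by omega)
      have q2 := h2 m (by omega) i (by omega) (by omega)
      simp only [hS', Finset.mem_erase]
      exact ⟨⟨q1.2.1, q1.1, q.1⟩, ⟨q1.2.2, q2.2.1.symm, q.2.1⟩, q.2.2⟩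
    have h2' : ∀ i < m, ∀ j < m, i ≠ j → a i ≠ a j ∧ a i ≠ b j ∧ b i ≠ b j :=
      fun i hi j hj => h2 i (by omega) j (by omega)
    have b1 := ih S' (k + 2) (by omega) (by omega) h1' h2'
    have b2 := ih S' (k + 1) (by omega) (by omega) h1' h2'
    have b3 : ((avoidS a b (m + 1) S (k + 2)).card : ℝ) ≤ (avoidS a b m S' (k + 2)).card + 2 * (avoidS a b m S' (k + 1)).card := by
      exact_mod_cast avoidS_step a b m S (k + 1) hm.2.2
    have b4 := choose_beta n S'.card k κ hn (by omega) (by omega)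
    rw [← hc]
    calc _ ≤ _ := b3
      _ ≤ (1 - ((κ : ℝ) / n) ^ 2) ^ m * (S'.card.choose (k + 2)) + 2 * ((1 - ((κ : ℝ) / n) ^ 2) ^ m * (S'.card.choose (k + 1))) := by linarith
      _ = (1 - ((κ : ℝ) / n) ^ 2) ^ m * ((S'.card.choose (k + 2) : ℝ) + 2 * (S'.card.choose (k + 1))) := by ring
      _ ≤ (1 - ((κ : ℝ) / n) ^ 2) ^ m * ((1 - ((κ : ℝ) / n) ^ 2) * (S'.card + 2).choose (k + 2)) :=
          mul_le_mul_of_nonneg_left b4 (pow_nonneg hb _)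
      _ = _ := by rw [pow_succ]; ring

def Fails (L : ℕ) (π : Equiv.Perm V) (J : Finset V) : Prop :=
  ∃ v, (∀ s < L, ∀ t < L, (π ^ s) v = (π ^ t) v → s = t) ∧
    ∀ t, t + 1 < L → ¬ ((π ^ t) v ∈ J ∧ (π ^ (t + 1)) v ∈ J)

variable [Fintype V]

open Classical in
theorem fails_J (π : Equiv.Perm V) (L k m κ : ℕ) (hn : 0 < Fintype.card V) (hκ : κ ≤ Fintype.card V)
    (hk : κ + 1 + m ≤ k) (hL : 2 * m ≤ L) :
    (((Finset.univ.powersetCard k).filter (Fails L π)).card : ℝ) ≤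
      Fintype.card V * ((1 - ((κ : ℝ) / Fintype.card V) ^ 2) ^ m * (Fintype.card V).choose k) := by
  have hsub : (Finset.univ.powersetCard k).filter (Fails L π) ⊆
      (Finset.univ.filter fun v => ∀ s < L, ∀ t < L, (π ^ s) v = (π ^ t) v → s = t).biUnion
        fun v => avoidS (fun i => (π ^ (2 * i)) v) (fun i => (π ^ (2 * i + 1)) v) m Finset.univ k := by
    intro J hJ
    rw [Finset.mem_filter] at hJ
    obtain ⟨hJ, v, hv, ht⟩ := hJ
    rw [Finset.mem_biUnion]
    refine ⟨v, by simpa using hv, ?_⟩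
    rw [avoidS, Finset.mem_filter]
    exact ⟨hJ, fun i hi => ht (2 * i) (by omega)⟩
  have h1 := (Finset.card_le_card hsub).trans Finset.card_biUnion_le
  have h2 : ∀ v ∈ (Finset.univ.filter fun v => ∀ s < L, ∀ t < L, (π ^ s) v = (π ^ t) v → s = t),
      ((avoidS (fun i => (π ^ (2 * i)) v) (fun i => (π ^ (2 * i + 1)) v) m Finset.univ k).card : ℝ) ≤
      (1 - ((κ : ℝ) / Fintype.card V) ^ 2) ^ m * (Fintype.card V).choose k := by
    intro v hv
    replace hv := (Finset.mem_filter.1 hv).2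
    refine avoidS_bound _ _ (Fintype.card V) κ hn hκ m Finset.univ k le_rfl hk ?_ ?_
    · intro i hi
      refine ⟨Finset.mem_univ _, Finset.mem_univ _, fun h => ?_⟩
      have := hv _ (by omega) _ (by omega) h
      omega
    · intro i hi j hj hij
      refine ⟨fun h => ?_, fun h => ?_, fun h => ?_⟩ <;>
      · have := hv _ (by omega) _ (by omega) h
        omega
  calc _ ≤ ((∑ v ∈ (Finset.univ.filter fun v => ∀ s < L, ∀ t < L, (π ^ s) v = (π ^ t) v → s = t),
        (avoidS (fun i => (π ^ (2 * i)) v) (fun i => (π ^ (2 * i + 1)) v) m Finset.univ k).card : ℕ) : ℝ) := by exact_mod_cast h1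
    _ ≤ _ := by
      push_cast
      refine (Finset.sum_le_card_nsmul _ _ _ h2).trans ?_
      rw [nsmul_eq_mul]
      have hb : 0 ≤ 1 - ((κ : ℝ) / Fintype.card V) ^ 2 := by
        have : (κ : ℝ) / Fintype.card V ≤ 1 := by
          rw [div_le_one (by positivity)]; exact_mod_cast hκ
        have h0 : 0 ≤ (κ : ℝ) / Fintype.card V := by positivity
        nlinarith
      gcongr
      exact Finset.card_le_univ _

theorem fails_conj (L : ℕ) (π σ : Equiv.Perm V) (J : Finset V) :
    Fails L (σ * π * σ⁻¹) (J.map σ.toEmbedding) ↔ Fails L π J := by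
  have key : ∀ t v, ((σ * π * σ⁻¹) ^ t) (σ v) = σ ((π ^ t) v) := by
    intro t v; rw [conj_pow]; simp
  constructor
  · rintro ⟨v, h1, h2⟩
    obtain ⟨v, rfl⟩ := σ.surjective v
    refine ⟨v, fun s hs t ht h => h1 s hs t ht (by rw [key, key, h]), fun t ht h => h2 t ht ?_⟩
    rw [key, key]; simpa using h
  · rintro ⟨v, h1, h2⟩
    refine ⟨σ v, fun s hs t ht h => h1 s hs t ht ?_, fun t ht h => h2 t ht ?_⟩
    · rw [key, key] at h; exact σ.injective h
    · rw [key, key] at h; simpa using h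

open Classical in
theorem fails_card_eq (L : ℕ) (J J' : Finset V) (h : J.card = J'.card) :
    (Finset.univ.filter fun π : Equiv.Perm V => Fails L π J).card = (Finset.univ.filter fun π : Equiv.Perm V => Fails L π J').card := by
  obtain ⟨σ, hσ⟩ : ∃ σ : Equiv.Perm V, J.map σ.toEmbedding = J' := by
    have e : {x // x ∈ J} ≃ {x // x ∈ J'} := Fintype.equivOfCardEq (by simpa using h)
    refine ⟨e.extendSubtype, ?_⟩
    apply Finset.eq_of_subset_of_card_le
    · intro x hx
      simp only [Finset.mem_map, Equiv.coe_toEmbedding] at hx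
      obtain ⟨y, hy, rfl⟩ := hx
      exact e.extendSubtype_mem y hy
    · rw [Finset.card_map, h]
  subst hσ
  refine Finset.card_bij (fun π _ => σ * π * σ⁻¹) ?_ ?_ ?_
  · intro π hπ; simpa [fails_conj] using hπ
  · intro π _ π' _ h; simpa using h
  · intro π hπ
    refine ⟨σ⁻¹ * π * σ, ?_, by group⟩
    rw [Finset.mem_filter] at hπ ⊢
    refine ⟨Finset.mem_univ _, ?_⟩
    rw [← fails_conj L _ σ]
    convert hπ.2 using 1; group

open Classical in
theorem fails_pi (J : Finset V) (L k m κ : ℕ) (hn : 0 < Fintype.card V) (hκ : κ ≤ Fintype.card V)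
    (hk : κ + 1 + m ≤ k) (hL : 2 * m ≤ L) (hJ : J.card = k) :
    ((Finset.univ.filter fun π : Equiv.Perm V => Fails L π J).card : ℝ) ≤
      (Fintype.card V).factorial * (Fintype.card V * (1 - ((κ : ℝ) / Fintype.card V) ^ 2) ^ m) := by
  have h1 : ∑ J' ∈ Finset.univ.powersetCard k, (Finset.univ.filter fun π : Equiv.Perm V => Fails L π J').card =
      ∑ π : Equiv.Perm V, ((Finset.univ.powersetCard k).filter (Fails L π)).card := by
    simp only [Finset.card_filter]
    rw [Finset.sum_comm]
  have h2 : ∑ J' ∈ (Finset.univ : Finset V).powersetCard k, (Finset.univ.filter fun π : Equiv.Perm V => Fails L π J').card =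
      (Fintype.card V).choose k * (Finset.univ.filter fun π : Equiv.Perm V => Fails L π J).card := by
    rw [Finset.sum_const_nat (m := (Finset.univ.filter fun π : Equiv.Perm V => Fails L π J).card)]
    · rw [Finset.card_powersetCard, Finset.card_univ]
    · intro J' hJ'
      exact fails_card_eq L _ _ (by rw [(Finset.mem_powersetCard.1 hJ').2, hJ])
  have h3 : ((∑ π : Equiv.Perm V, ((Finset.univ.powersetCard k).filter (Fails L π)).card : ℕ) : ℝ) ≤
      (Fintype.card V).factorial * (Fintype.card V * ((1 - ((κ : ℝ) / Fintype.card V) ^ 2) ^ m * (Fintype.card V).choose k)) := by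
    push_cast
    refine (Finset.sum_le_card_nsmul _ _ _ fun π _ => fails_J π L k m κ hn hκ hk hL).trans ?_
    rw [nsmul_eq_mul, Finset.card_univ, Fintype.card_perm]
  rw [← h1, h2] at h3
  have hC : (0 : ℝ) < (Fintype.card V).choose k := by
    exact_mod_cast Nat.choose_pos (hJ ▸ Finset.card_le_univ J)
  push_cast at h3
  refine le_of_mul_le_mul_left ?_ hC
  linarith

open Classical in
theorem tuple_bad {r : ℕ} (P : Type*) [Fintype P] (F : P → P → Prop) (K : ℝ) (j j' : Fin r) (hjj : j' ≠ j)
    (hF : ∀ y, ((Finset.univ.filter fun x => F x y).card : ℝ) ≤ K) :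
    (((Finset.univ : Finset (Fin r → P)).filter fun π => F (π j) (π j')).card : ℝ) ≤ (Fintype.card P : ℝ) ^ (r - 1) * K := by
  have h1 : ((Finset.univ : Finset (Fin r → P)).filter fun π => F (π j) (π j')).card =
      ∑ g : ({i // i ≠ j} → P), (Finset.univ.filter fun x => F x (g ⟨j', hjj⟩)).card := by
    have : ∀ g : ({i // i ≠ j} → P), (Finset.univ.filter fun x => F x (g ⟨j', hjj⟩)).card = Fintype.card {x // F x (g ⟨j', hjj⟩)} := by
      intro g; rw [Fintype.card_subtype]
    rw [Finset.sum_congr rfl (fun g _ => this g), ← Fintype.card_sigma, ← Fintype.card_subtype]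
    refine Fintype.card_congr ⟨fun π => ⟨fun i => π.1 i.1, ⟨π.1 j, π.2⟩⟩,
      fun p => ⟨fun i => if h : i = j then p.2.1 else p.1 ⟨i, h⟩, ?_⟩, ?_, ?_⟩
    · have := p.2.2
      simpa [hjj] using this
    · rintro ⟨π, hπ⟩
      apply Subtype.ext
      funext i
      by_cases h : i = j
      · subst h; simp
      · simp [h]
    · rintro ⟨g, ⟨x, hx⟩⟩
      have hg : (fun i : {i // i ≠ j} => if h : i.1 = j then x else g ⟨i, h⟩) = g := by
        funext i; simp [i.2]
      refine Sigma.ext hg ?_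
      refine (Subtype.heq_iff_coe_eq ?_).2 ?_
      · intro y; simp [hjj]
      · simp
  rw [h1]
  push_cast
  refine (Finset.sum_le_card_nsmul _ _ _ fun g _ => hF _).trans ?_
  rw [nsmul_eq_mul, Finset.card_univ, Fintype.card_fun, Fintype.card_subtype_compl]
  simp
end badpairs
section coloring
variable {V : Type*} [DecidableEq V]

def Bd (σ : Equiv.Perm V) (J : Finset V) : Prop := (J.map σ.toEmbedding \ J).card ≤ 1

theorem Bd_step (σ : Equiv.Perm V) (J : Finset V) (h : Bd σ J) : Bd σ (J ∪ J.map σ.toEmbedding) := by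
  refine le_trans (Finset.card_le_card ?_) (le_trans (Finset.card_map σ.toEmbedding (s := J.map σ.toEmbedding \ J)).le h)
  intro x hx
  simp only [Finset.mem_sdiff, Finset.mem_map_equiv, Finset.mem_union, not_or] at hx ⊢
  tauto

theorem Bd_card (σ : Equiv.Perm V) (J : Finset V) : (J ∪ J.map σ.toEmbedding).card = J.card + (J.map σ.toEmbedding \ J).card := by
  rw [← Finset.union_sdiff_self_eq_union, Finset.card_union_of_disjoint Finset.disjoint_sdiff]

theorem Bd_inv (σ : Equiv.Perm V) (J : Finset V) (h : Bd σ J) : Bd σ⁻¹ J := by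
  have h1 : (J.map σ.toEmbedding \ J).card = (J \ J.map σ.toEmbedding).card :=
    Finset.card_sdiff_comm (Finset.card_map _)
  have h2 : (J \ J.map σ.toEmbedding).map σ⁻¹.toEmbedding = J.map σ⁻¹.toEmbedding \ J := by
    ext x
    simp [Finset.mem_map_equiv, Equiv.Perm.inv_def]
  unfold Bd at *
  rw [← h2, Finset.card_map, ← h1]; exact h

theorem Bd_exists [Fintype V] (σ : Equiv.Perm V) (k : ℕ) (hk : k ≤ Fintype.card V) : ∃ J : Finset V, J.card = k ∧ Bd σ J := by
  induction k with
  | zero => exact ⟨∅, by simp, by simp [Bd]⟩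
  | succ k ih =>
    obtain ⟨J, hJ, hB⟩ := ih (by omega)
    by_cases h0 : (J.map σ.toEmbedding \ J).card = 0
    · obtain ⟨x, hx⟩ : ∃ x, x ∉ J := by
        by_contra! hc
        have : J = Finset.univ := by ext; simp [hc]
        rw [this, Finset.card_univ] at hJ; omega
      refine ⟨insert x J, by rw [Finset.card_insert_of_notMem hx, hJ], ?_⟩
      refine le_trans (Finset.card_le_card (t := {σ x}) ?_) (by simp)
      intro y hy
      rw [Finset.card_eq_zero, Finset.sdiff_eq_empty_iff_subset] at h0
      simp only [Finset.map_insert, Finset.mem_sdiff, Finset.mem_insert, not_or] at hy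
      rcases hy.1 with h | h
      · simpa using h
      · exact absurd (h0 h) hy.2.2
    · refine ⟨J ∪ J.map σ.toEmbedding, ?_, Bd_step σ J hB⟩
      rw [Bd_card]; unfold Bd at hB; omega

theorem Bd_fwd (σ : Equiv.Perm V) (J : Finset V) (h : Bd σ J) (L : ℕ) :
    ∃ F : Finset V, F.card ≤ J.card + L ∧ Bd σ F ∧ ∀ x ∈ J, ∀ t ≤ L, (σ ^ t) x ∈ F := by
  induction L with
  | zero => exact ⟨J, by simp, h, fun x hx t ht => by obtain rfl : t = 0 := by omega
                                                      simpa using hx⟩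
  | succ L ih =>
    obtain ⟨F, h1, h2, h3⟩ := ih
    refine ⟨F ∪ F.map σ.toEmbedding, ?_, Bd_step _ _ h2, ?_⟩
    · rw [Bd_card]; unfold Bd at h2; omega
    · intro x hx t ht
      rw [Finset.mem_union]
      rcases Nat.lt_or_ge L t with hl | hl
      · obtain rfl : t = L + 1 := by omega
        right
        rw [pow_succ', Equiv.Perm.mul_apply]
        exact Finset.mem_map_of_mem _ (h3 x hx L le_rfl)
      · exact Or.inl (h3 x hx t hl)

theorem Bd_two (σ : Equiv.Perm V) (J : Finset V) (h : Bd σ J) (L : ℕ) :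
    ∃ T : Finset V, T.card ≤ 2 * (J.card + L) ∧ ∀ x ∈ J, ∀ i : ℤ, -L ≤ i → i ≤ L → (σ ^ i) x ∈ T := by
  obtain ⟨F, h1, _, h3⟩ := Bd_fwd σ J h L
  obtain ⟨F', h1', _, h3'⟩ := Bd_fwd σ⁻¹ J (Bd_inv σ J h) L
  refine ⟨F ∪ F', (Finset.card_union_le _ _).trans (by omega), fun x hx i hi hi' => ?_⟩
  rw [Finset.mem_union]
  rcases le_or_gt 0 i with h | h
  · left
    have := h3 x hx i.toNat (by omega)
    rw [← zpow_natCast, Int.toNat_of_nonneg h] at this; exact this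
  · right
    have := h3' x hx (-i).toNat (by omega)
    rw [← zpow_natCast, Int.toNat_of_nonneg (by omega), inv_zpow', neg_neg] at this; exact this

/-- uncut pieces -/
theorem uncut (σ : Equiv.Perm V) (J' : Finset V) (L : ℕ) (hF : ¬ Fails L σ J') (u : V) :
    ∃ lo hi : ℤ, -L ≤ lo ∧ lo ≤ 0 ∧ 0 ≤ hi ∧ hi ≤ L ∧
      ∀ i, lo ≤ i → i ≤ hi → ∀ w, ((σ ((σ ^ i) u) = w ∨ σ w = (σ ^ i) u) ∧ ¬ ((σ ^ i) u ∈ J' ∧ w ∈ J')) →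
        ∃ i', lo ≤ i' ∧ i' ≤ hi ∧ w = (σ ^ i') u := by
  have hs : ∀ i : ℤ, σ ((σ ^ i) u) = (σ ^ (i + 1)) u := by
    intro i; rw [add_comm, zpow_add, zpow_one]; rfl
  have hp : ∀ i : ℤ, ∀ w, σ w = (σ ^ i) u → w = (σ ^ (i - 1)) u := by
    intro i w h
    apply σ.injective
    rw [h, hs]; congr 2; ring
  unfold Fails at hF
  push Not at hF
  by_cases hinj : ∀ s < L, ∀ t < L, (σ ^ s) u = (σ ^ t) u → s = t
  · obtain ⟨t, ht, c1, c2⟩ := hF u hinj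
    obtain ⟨s, hs', d1, d2⟩ := hF ((σ ^ (-(L : ℤ))) u) (by
      intro s hs t ht h
      apply hinj s hs t ht
      rw [← zpow_natCast, ← zpow_natCast, ← Equiv.Perm.mul_apply, ← Equiv.Perm.mul_apply, ← zpow_add, ← zpow_add,
        add_comm, zpow_add, add_comm, zpow_add, Equiv.Perm.mul_apply, Equiv.Perm.mul_apply] at h
      have := (σ ^ (-(L : ℤ))).injective h
      simpa using this)
    rw [← zpow_natCast] at c1 c2 d1 d2
    rw [← Equiv.Perm.mul_apply, ← zpow_add] at d1 d2
    push_cast at c2 d2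
    refine ⟨s + 1 - L, t, by omega, by omega, by omega, by omega, ?_⟩
    rintro i hi hi' w ⟨h | h, hc⟩
    · rw [hs] at h
      subst h
      rcases eq_or_lt_of_le hi' with h | h
      · subst h
        exact absurd ⟨c1, c2⟩ hc
      · exact ⟨i + 1, by omega, by omega, rfl⟩
    · have h := hp i w h
      subst h
      rcases eq_or_lt_of_le hi with h | h
      · subst h
        refine absurd ⟨?_, ?_⟩ hc
        · rw [sub_eq_add_neg]; exact d2
        · convert d1 using 3; ring
      · exact ⟨i - 1, by omega, by omega, rfl⟩
  · obtain ⟨p, hp0, hpL, hpu⟩ : ∃ p : ℕ, 0 < p ∧ p < L ∧ (σ ^ p) u = u := by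
      push Not at hinj
      obtain ⟨s, hsL, t, htL, h, hne⟩ := hinj
      wlog hlt : s < t generalizing s t
      · exact this t htL s hsL h.symm hne.symm (by omega)
      refine ⟨t - s, by omega, by omega, ?_⟩
      apply (σ ^ s).injective
      rw [← Equiv.Perm.mul_apply, ← pow_add, h]; congr 2; omega
    have hpu' : ∀ i : ℤ, (σ ^ (i + p)) u = (σ ^ i) u := by
      intro i
      rw [zpow_add, Equiv.Perm.mul_apply, zpow_natCast, hpu]
    refine ⟨0, p, by omega, le_rfl, by omega, by omega, ?_⟩
    rintro i hi hi' w ⟨h | h, -⟩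
    · rw [hs] at h
      subst h
      rcases eq_or_lt_of_le hi' with h | h
      · exact ⟨1, by omega, by omega, by rw [h, add_comm, hpu']⟩
      · exact ⟨i + 1, by omega, by omega, rfl⟩
    · have h := hp i w h
      subst h
      rcases eq_or_lt_of_le hi with h | h
      · exact ⟨i - 1 + p, by omega, by omega, by rw [hpu']⟩
      · exact ⟨i - 1, by omega, by omega, rfl⟩

theorem comp_bound (H : SimpleGraph V) (σ : Equiv.Perm V) (J J' : Finset V) (L : ℕ) (hF : ¬ Fails L σ J') (hB : Bd σ J)
    (hadj : ∀ u w, H.Adj u w → ((σ u = w ∨ σ w = u) ∧ ¬ (u ∈ J' ∧ w ∈ J')) ∨ (u ∈ J ∧ w ∈ J)) (v : V) :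
    (H.connectedComponentMk v).supp.ncard ≤ 2 * J.card + 4 * L + 1 := by
  choose lo hi h1 h2 h3 h4 h5 using uncut σ J' L hF
  obtain ⟨T, hT, hT'⟩ := Bd_two σ J hB L
  let C : Set V := {w | ∃ x, (x = v ∨ x ∈ J) ∧ ∃ i, lo x ≤ i ∧ i ≤ hi x ∧ w = (σ ^ i) x}
  have hcl : ∀ a b, H.Adj a b → a ∈ C → b ∈ C := by
    rintro a b hab ⟨x, hx, i, hi1, hi2, rfl⟩
    rcases hadj _ _ hab with h | h
    · exact ⟨x, hx, h5 x i hi1 hi2 b h⟩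
    · exact ⟨b, Or.inr h.2, 0, h2 b, h3 b, by simp⟩
  have hsub : (H.connectedComponentMk v).supp ⊆ C := by
    intro w hw
    rw [SimpleGraph.ConnectedComponent.mem_supp_iff, SimpleGraph.ConnectedComponent.eq] at hw
    obtain ⟨p⟩ := hw.symm
    have : ∀ a b, H.Walk a b → a ∈ C → b ∈ C := by
      intro a b p
      induction p with
      | nil => exact id
      | cons h _ ih => exact fun ha => ih (hcl _ _ h ha)
    exact this v w p ⟨v, Or.inl rfl, 0, h2 v, h3 v, by simp⟩
  have hC : C ⊆ ((T ∪ (Finset.Icc (-(L : ℤ)) L).image fun i => (σ ^ i) v : Finset V) : Set V) := by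
    rintro w ⟨x, hx, i, hi1, hi2, rfl⟩
    have q1 := h1 x
    have q2 := h4 x
    rw [Finset.mem_coe, Finset.mem_union]
    rcases hx with rfl | hx
    · right
      exact Finset.mem_image_of_mem _ (Finset.mem_Icc.2 ⟨by omega, by omega⟩)
    · left
      exact hT' x hx i (by omega) (by omega)
  refine (Set.ncard_le_ncard (hsub.trans hC) (Finset.finite_toSet _)).trans ?_
  rw [Set.ncard_coe_finset]
  refine (Finset.card_union_le _ _).trans ?_
  have := Finset.card_image_le (s := Finset.Icc (-(L : ℤ)) L) (f := fun i => (σ ^ i) v)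
  rw [Int.card_Icc] at this
  omega

theorem coloring (r : ℕ) (G : SimpleGraph V) (π : Fin r → Equiv.Perm V) (hπ : IsDec r G π) (nx : Fin r → Fin r) (j0 : Fin r)
    (Jc : Equiv.Perm V → Finset V) (k L : ℕ) (hk : ∀ σ, (Jc σ).card = k) (hB : ∀ σ, Bd σ (Jc σ))
    (hF : ∀ j, ¬ Fails L (π j) (Jc (π (nx j)))) :
    ∃ c : Sym2 V → Fin r, ∀ (j : Fin r) (v : V),
      ((SimpleGraph.fromRel (fun u w => G.Adj u w ∧ c s(u, w) = j)).connectedComponentMk v).supp.ncard ≤ 2 * k + 4 * L + 1 := by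
  classical
  have hex : ∀ e : Sym2 V, ∃ i : Fin r → Fin r, ∀ j0 : Fin r, (∃ j u, e = s(u, π j u)) → ∃ u, e = s(u, π (i j0) u) := by
    intro e
    by_cases h : ∃ j u, e = s(u, π j u)
    · obtain ⟨j, u, h⟩ := h
      exact ⟨fun _ => j, fun _ _ => ⟨u, h⟩⟩
    · exact ⟨id, fun _ h' => absurd h' h⟩
  choose i hi using hex
  let col : Sym2 V → Fin r := fun e => if ∀ x ∈ e, x ∈ Jc (π (nx (i e j0))) then nx (i e j0) else i e j0
  refine ⟨col, fun j v => ?_⟩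
  rw [← hk (π j)]
  refine comp_bound _ (π j) (Jc (π j)) (Jc (π (nx j))) L (hF j) (hB _) ?_ v
  have key : ∀ u w, G.Adj u w ∧ col s(u, w) = j →
      ((π j u = w ∨ π j w = u) ∧ ¬ (u ∈ Jc (π (nx j)) ∧ w ∈ Jc (π (nx j)))) ∨ (u ∈ Jc (π j) ∧ w ∈ Jc (π j)) := by
    rintro u w ⟨h1, h2⟩
    have h3 := hi s(u, w) j0 (by
      obtain ⟨j, h | h⟩ := (hπ u w).1 h1
      · exact ⟨j, u, by rw [h]⟩
      · exact ⟨j, w, by rw [h, Sym2.eq_swap]⟩)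
    simp only [col] at h2
    split_ifs at h2 with h4
    · right
      subst h2
      exact ⟨h4 u (by simp), h4 w (by simp)⟩
    · left
      rw [h2] at h3 h4
      constructor
      · obtain ⟨x, hx⟩ := h3
        rw [Sym2.eq_iff] at hx
        rcases hx with ⟨rfl, hx⟩ | ⟨hx, rfl⟩
        · exact Or.inl hx.symm
        · exact Or.inr hx.symm
      · simpa using h4
  intro u w h
  rw [SimpleGraph.fromRel_adj] at h
  rcases h.2 with h | h
  · exact key u w h
  · have := key w u h
    tauto
end coloring
section assembly

def GoodG (r n : ℕ) (ε : ℝ) (G : SimpleGraph (Fin n)) : Prop :=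
  ∃ c : Sym2 (Fin n) → Fin r, ∀ (j : Fin r) (v : Fin n),
    ((((SimpleGraph.fromRel
      (fun u w => G.Adj u w ∧ c s(u, w) = j)).connectedComponentMk v).supp.ncard : ℝ)) ≤ ε * n

theorem bad_count (r : ℕ) (hr : 2 ≤ r) (ε : ℝ) (n k L m κ : ℕ) (hn : 0 < n) (hκ : κ ≤ n)
    (hk : κ + 1 + m ≤ k) (hkn : k ≤ n) (hL : 2 * m ≤ L) (hε : ((2 * k + 4 * L + 1 : ℕ) : ℝ) ≤ ε * n) :
    (Nat.card {G : SimpleGraph (Fin n) // (∀ v, (G.neighborSet v).ncard = 2 * r) ∧ ¬ GoodG r n ε G} : ℝ) *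
      (((2 * r).factorial : ℝ) / (2 * r : ℝ) ^ r) ^ n ≤
      r * ((n.factorial : ℝ) ^ r * (n * (1 - ((κ : ℝ) / n) ^ 2) ^ m)) := by
  classical
  have := Fact.mk hr
  have : Nontrivial (Fin r) := Fin.nontrivial_iff_two_le.2 hr
  choose nx hnx using fun j : Fin r => exists_ne j
  choose Jc hJk hJB using fun σ : Equiv.Perm (Fin n) => Bd_exists σ k (by simpa using hkn)
  have f1 := Fintype.ofFinite {G : SimpleGraph (Fin n) // (∀ v, (G.neighborSet v).ncard = 2 * r) ∧ ¬ GoodG r n ε G}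
  let Bt : Finset (Fin r → Equiv.Perm (Fin n)) := Finset.univ.biUnion fun j : Fin r =>
    Finset.univ.filter fun π => Fails L (π j) (Jc (π (nx j)))
  have h1 : Nat.card (Σ G : {G : SimpleGraph (Fin n) // (∀ v, (G.neighborSet v).ncard = 2 * r) ∧ ¬ GoodG r n ε G},
      {π // IsDec r G.1 π}) ≤ Nat.card Bt := by
    refine Nat.card_le_card_of_injective (fun p => ⟨p.2.1, ?_⟩) ?_
    · by_contra hc
      apply p.1.2.2
      simp only [Bt, Finset.mem_biUnion, Finset.mem_filter, Finset.mem_univ, true_and, not_exists] at hc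
      obtain ⟨c, hc⟩ := coloring r p.1.1 p.2.1 p.2.2 nx ⟨0, by omega⟩ Jc k L hJk hJB hc
      exact ⟨c, fun j v => le_trans (Nat.cast_le.2 (hc j v)) hε⟩
    · rintro ⟨⟨G, hG⟩, ⟨π, hπ⟩⟩ ⟨⟨G', hG'⟩, ⟨π', hπ'⟩⟩ h
      have h : π = π' := congrArg Subtype.val h
      subst h
      have : G = G' := by ext u v; exact (hπ u v).trans (hπ' u v).symm
      subst this
      rfl
  have h2 : (Nat.card {G : SimpleGraph (Fin n) // (∀ v, (G.neighborSet v).ncard = 2 * r) ∧ ¬ GoodG r n ε G} : ℝ) *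
      (((2 * r).factorial : ℝ) / (2 * r : ℝ) ^ r) ^ n ≤ (Nat.card Bt : ℝ) := by
    refine le_trans ?_ (Nat.cast_le.2 h1)
    rw [Nat.card_sigma, Nat.card_eq_fintype_card, ← nsmul_eq_mul, Nat.cast_sum]
    refine Finset.card_nsmul_le_sum _ _ _ fun G _ => ?_
    have := dec_count r G.1 G.2.1 (by omega)
    simpa using this
  refine h2.trans ?_
  have h3 : (Nat.card Bt : ℝ) ≤ ∑ j : Fin r, ((Finset.univ.filter fun π : Fin r → Equiv.Perm (Fin n) => Fails L (π j) (Jc (π (nx j)))).card : ℝ) := by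
    have : Nat.card Bt = Bt.card := by simp
    rw [this]
    exact_mod_cast Finset.card_biUnion_le
  refine h3.trans ?_
  have h4 : ∀ j ∈ (Finset.univ : Finset (Fin r)), ((Finset.univ.filter fun π : Fin r → Equiv.Perm (Fin n) => Fails L (π j) (Jc (π (nx j)))).card : ℝ) ≤
      (n.factorial : ℝ) ^ r * (n * (1 - ((κ : ℝ) / n) ^ 2) ^ m) := by
    intro j _
    have := tuple_bad (Equiv.Perm (Fin n)) (fun x y => Fails L x (Jc y)) _ j (nx j) (hnx j)
      (fun y => fails_pi (Jc y) L k m κ (by simpa using hn) (by simpa using hκ) hk hL (hJk y))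
    refine this.trans (le_of_eq ?_)
    simp only [Fintype.card_perm, Fintype.card_fin]
    obtain ⟨r, rfl⟩ : ∃ r', r = r' + 1 := ⟨r - 1, by omega⟩
    simp only [Nat.add_sub_cancel, pow_succ]; ring
  refine (Finset.sum_le_card_nsmul _ _ _ h4).trans ?_
  rw [nsmul_eq_mul, Finset.card_univ, Fintype.card_fin]

theorem N_lower (r : ℕ) (hr : 1 ≤ r) (n : ℕ) (hn : 4 * r ≤ n) :
    (n.factorial : ℝ) ^ r ≤ (n : ℝ) ^ (4 * r * r) * (Nat.card (RG (Fin n) (2 * r)) *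
      (((2 * r).factorial : ℝ) / (2 * r : ℝ) ^ r) ^ (n - 4 * r)) := by
  obtain ⟨t, rfl⟩ := Nat.exists_eq_add_of_le hn
  have h1 : (((2 * r : ℝ)) ^ t * t.factorial) ^ r ≤ Nat.card (RG (Fin (4 * r + t)) (2 * r)) * ((2 * r).factorial : ℝ) ^ t := by
    exact_mod_cast RG_lower r hr t
  have h2 : (4 * r + t).factorial ≤ (4 * r + t) ^ (4 * r) * t.factorial := by
    have e := Nat.factorial_mul_descFactorial hn
    rw [← e, mul_comm, Nat.add_sub_cancel_left]
    exact Nat.mul_le_mul_right _ (Nat.descFactorial_le_pow _ _)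
  have h3 : ((4 * r + t).factorial : ℝ) ≤ ((4 * r + t : ℕ) : ℝ) ^ (4 * r) * t.factorial := by exact_mod_cast h2
  have hrr : (0 : ℝ) < 2 * r := by positivity
  have h4 : (t.factorial : ℝ) ^ r ≤ Nat.card (RG (Fin (4 * r + t)) (2 * r)) * (((2 * r).factorial : ℝ) / (2 * r : ℝ) ^ r) ^ t := by
    rw [div_pow, ← mul_div_assoc, le_div_iff₀ (by positivity)]
    refine le_trans (le_of_eq ?_) h1
    rw [mul_pow ((2 * (r : ℝ)) ^ t), ← pow_mul, ← pow_mul, mul_comm r t, mul_comm]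
  rw [Nat.add_sub_cancel_left]
  calc _ ≤ (((4 * r + t : ℕ) : ℝ) ^ (4 * r) * t.factorial) ^ r := pow_le_pow_left₀ (by positivity) h3 r
    _ = ((4 * r + t : ℕ) : ℝ) ^ (4 * r * r) * (t.factorial : ℝ) ^ r := by rw [mul_pow, ← pow_mul]
    _ ≤ _ := mul_le_mul_of_nonneg_left h4 (by positivity)

theorem bad_frac (r : ℕ) (hr : 2 ≤ r) (ε : ℝ) (hε : 0 < ε) (η : ℝ) (hη : 0 < η) :
    ∃ N : ℕ, ∀ n, N ≤ n →
      (Nat.card {G : SimpleGraph (Fin n) // (∀ v, (G.neighborSet v).ncard = 2 * r) ∧ ¬ GoodG r n ε G} : ℝ) ≤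
        η * Nat.card (RG (Fin n) (2 * r)) := by
  obtain ⟨D0, hD0⟩ := exists_nat_ge (24 / ε)
  set D := D0 + 3 with hD
  have hDε : 24 ≤ ε * D := by
    rw [div_le_iff₀ hε] at hD0
    rw [hD]; push_cast; nlinarith
  have hDpos : (0 : ℝ) < D := by rw [hD]; positivity
  set c : ℝ := ((2 * r).factorial : ℝ) / (2 * r : ℝ) ^ r with hc
  have hcpos : 0 < c := by
    have : (0 : ℝ) < r := by exact_mod_cast (by omega : 0 < r)
    positivity
  set s := 4 * r * r + 1 with hs
  set q0 : ℝ := 1 - (1 / (2 * D)) ^ 2 with hq0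
  have hD3 : (3 : ℝ) ≤ D := by rw [hD]; push_cast; linarith [(Nat.cast_nonneg D0 : (0:ℝ) ≤ D0)]
  have hx : (0 : ℝ) < 1 / (2 * D) ∧ 1 / (2 * (D : ℝ)) ≤ 1 := by
    refine ⟨by positivity, ?_⟩
    rw [div_le_one (by positivity)]; linarith
  have hq0a : 0 ≤ q0 := by rw [hq0]; nlinarith
  have hq0b : q0 < 1 := by rw [hq0]; nlinarith
  set A : ℝ := r * (2 * D) ^ s / c ^ (4 * r) with hA
  have hlim : Filter.Tendsto (fun n : ℕ => A * ((n / D : ℕ) : ℝ) ^ s * q0 ^ (n / D)) Filter.atTop (nhds 0) := by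
    have h1 := tendsto_pow_const_mul_const_pow_of_abs_lt_one s (r := q0) (by rw [abs_of_nonneg hq0a]; exact hq0b)
    have h2 := (h1.comp (Nat.tendsto_div_const_atTop (n := D) (by omega))).const_mul A
    simpa [Function.comp_def, mul_assoc] using h2
  have hev := hlim.eventually (gt_mem_nhds hη)
  obtain ⟨N1, hN1⟩ := Filter.eventually_atTop.1 hev
  obtain ⟨N2, hN2⟩ := exists_nat_ge (6 / ε)
  refine ⟨N1 + N2 + D + 4 * r, fun n hn => ?_⟩
  have hb := hN1 n (by omega)
  set m := n / D with hm
  have hm1 : m * D ≤ n := Nat.div_mul_le_self n D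
  have hm2 : n < (m + 1) * D := by
    rw [mul_comm]; exact Nat.lt_mul_div_succ n (by omega)
  have hm0 : 1 ≤ m := (Nat.one_le_div_iff (by omega)).2 (by omega)
  have hm3 : n ≤ 2 * D * m := by nlinarith
  have hmn : 3 * m ≤ n := by nlinarith
  have hnpos : (0 : ℝ) < n := by exact_mod_cast (by omega : 0 < n)
  have hN2' : 6 ≤ ε * n := by
    rw [div_le_iff₀ hε] at hN2
    have : (N2 : ℝ) ≤ n := by exact_mod_cast (by omega : N2 ≤ n)
    nlinarith
  have hm1' : (m : ℝ) * D ≤ n := by exact_mod_cast hm1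
  have h24 : 24 * (m : ℝ) ≤ ε * n := by
    calc 24 * (m : ℝ) ≤ (ε * D) * m := by gcongr
      _ = ε * (m * D) := by ring
      _ ≤ ε * n := by gcongr
  have hbc := bad_count r hr ε n (2 * m + 1) (2 * m) m m (by omega) (by omega) (by omega) (by omega) le_rfl (by
    push_cast; linarith)
  have hNl := N_lower r (by omega) n (by omega)
  rw [← hc] at hbc hNl
  set Bn : ℝ := (Nat.card {G : SimpleGraph (Fin n) // (∀ v, (G.neighborSet v).ncard = 2 * r) ∧ ¬ GoodG r n ε G} : ℝ)
  set Nn : ℝ := (Nat.card (RG (Fin n) (2 * r)) : ℝ)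
  have hNn : 0 ≤ Nn := Nat.cast_nonneg _
  have hm3' : (n : ℝ) ≤ 2 * D * m := by exact_mod_cast hm3
  have hq : 0 ≤ 1 - ((m : ℝ) / n) ^ 2 ∧ 1 - ((m : ℝ) / n) ^ 2 ≤ q0 := by
    have h1 : (m : ℝ) / n ≤ 1 := by
      rw [div_le_one hnpos]; exact_mod_cast (by omega : m ≤ n)
    have h2 : 1 / (2 * (D : ℝ)) ≤ (m : ℝ) / n := by
      rw [div_le_div_iff₀ (by positivity) hnpos]; linarith
    have h3 : 0 ≤ (m : ℝ) / n := by positivity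
    constructor
    · nlinarith
    · rw [hq0]; nlinarith [hx.1]
  have hqm : (1 - ((m : ℝ) / n) ^ 2) ^ m ≤ q0 ^ m := pow_le_pow_left₀ hq.1 hq.2 m
  have hqn : 0 ≤ (n : ℝ) * (1 - ((m : ℝ) / n) ^ 2) ^ m := mul_nonneg hnpos.le (pow_nonneg hq.1 m)
  have hpow : (n : ℝ) ^ s ≤ (2 * D) ^ s * (m : ℝ) ^ s := by
    rw [← mul_pow]; exact pow_le_pow_left₀ hnpos.le hm3' s
  have e : c ^ n = c ^ (n - 4 * r) * c ^ (4 * r) := by rw [← pow_add]; congr 1; omega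
  have hct : 0 < c ^ (n - 4 * r) := pow_pos hcpos _
  have hcr : 0 < c ^ (4 * r) := pow_pos hcpos _
  have main : Bn * c ^ (4 * r) ≤ r * ((2 * D) ^ s * (m : ℝ) ^ s) * q0 ^ m * Nn := by
    refine le_of_mul_le_mul_right ?_ hct
    calc Bn * c ^ (4 * r) * c ^ (n - 4 * r) = Bn * c ^ n := by rw [e]; ring
      _ ≤ r * ((n.factorial : ℝ) ^ r * (n * (1 - ((m : ℝ) / n) ^ 2) ^ m)) := hbc
      _ ≤ r * (((n : ℝ) ^ (4 * r * r) * (Nn * c ^ (n - 4 * r))) * (n * q0 ^ m)) := by gcongr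
      _ = r * ((n : ℝ) ^ s) * q0 ^ m * Nn * c ^ (n - 4 * r) := by rw [hs, pow_succ]; ring
      _ ≤ r * ((2 * D) ^ s * (m : ℝ) ^ s) * q0 ^ m * Nn * c ^ (n - 4 * r) := by gcongr
  have hA2 : r * ((2 * D) ^ s * (m : ℝ) ^ s) * q0 ^ m = (A * (m : ℝ) ^ s * q0 ^ m) * c ^ (4 * r) := by
    rw [hA]; field_simp
  rw [hA2] at main
  have : Bn ≤ (A * (m : ℝ) ^ s * q0 ^ m) * Nn := by
    refine le_of_mul_le_mul_right ?_ hcr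
    linarith
  exact this.trans (mul_le_mul_of_nonneg_right hb.le hNn)

theorem good_split (r n : ℕ) (ε : ℝ) :
    Nat.card (RG (Fin n) (2 * r)) = Nat.card {G : SimpleGraph (Fin n) // (∀ v, (G.neighborSet v).ncard = 2 * r) ∧ GoodG r n ε G} +
      Nat.card {G : SimpleGraph (Fin n) // (∀ v, (G.neighborSet v).ncard = 2 * r) ∧ ¬ GoodG r n ε G} := by
  classical
  simp only [RG, Nat.card_eq_fintype_card, Fintype.card_subtype]
  rw [← Finset.card_filter_add_card_filter_not (s := Finset.univ.filter fun G : SimpleGraph (Fin n) => ∀ v, (G.neighborSet v).ncard = 2 * r) (GoodG r n ε)]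
  simp only [Finset.filter_filter]
end assembly
/-- Fix an integer `r ≥ 2`. For every `ε > 0`, with high probability as `n → ∞`
there exists an `r`-edge-coloring of the random `2r`-regular graph `G(n, 2r)` such that every
monochromatic component has at most `ε·n` vertices.

The uniform random model is expressed by counting: for every `p < 1`, for all sufficiently
large `n` (with the model defined, i.e. `2r ≤ n - 1` and `n·(2r)` even), the number of
`2r`-regular graphs on `Fin n` admitting such a coloring is at least `p` times the total number
of `2r`-regular graphs on `Fin n`.  The monochromatic graph of color `j` under a coloring
`c : Sym2 (Fin n) → Fin r` is `SimpleGraph.fromRel (fun u w => G.Adj u w ∧ c s(u, w) = j)`,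
and a monochromatic component is a connected component thereof. -/
theorem stmt_0 (r : ℕ) (hr : 2 ≤ r) (ε : ℝ) (hε : 0 < ε) :
    ∀ p : ℝ, p < 1 → ∃ N : ℕ, ∀ n : ℕ, N ≤ n → Even (n * (2 * r)) → 2 * r + 1 ≤ n →
      p * (Nat.card {G : SimpleGraph (Fin n) //
              ∀ v : Fin n, (G.neighborSet v).ncard = 2 * r} : ℝ) ≤
      (Nat.card {G : SimpleGraph (Fin n) //
          (∀ v : Fin n, (G.neighborSet v).ncard = 2 * r) ∧
          ∃ c : Sym2 (Fin n) → Fin r, ∀ (j : Fin r) (v : Fin n),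
            ((((SimpleGraph.fromRel
                (fun u w => G.Adj u w ∧ c s(u, w) = j)).connectedComponentMk v).supp.ncard : ℝ))
              ≤ ε * n} : ℝ) := by
  intro p hp
  obtain ⟨N, hN⟩ := bad_frac r hr ε hε (1 - p) (by linarith)
  refine ⟨N, fun n hn _ _ => ?_⟩
  have h1 := hN n hn
  have h2 : (Nat.card (RG (Fin n) (2 * r)) : ℝ) = _ := congrArg Nat.cast (good_split r n ε)
  push_cast at h2
  change p * (Nat.card (RG (Fin n) (2 * r)) : ℝ) ≤
    (Nat.card {G : SimpleGraph (Fin n) // (∀ v, (G.neighborSet v).ncard = 2 * r) ∧ GoodG r n ε G} : ℝ)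
  linarith
end

section
/- Fix an integer r ≥ 2. There exists a constant γ > 0 such that, with high probability as n → ∞ through even integers, every r-edge-coloring of the random (2r+1)-regular graph G(n,2r+1) contains a monochromatic cycle of length at least γn. -/
/-- the switched graph -/
def switchG {V : Type*} (G : SimpleGraph V) (u v x y : V) (hux : u ≠ x) (hvy : v ≠ y) :
    SimpleGraph V where
  Adj a b := (G.Adj a b ∧ s(a, b) ≠ s(u, v) ∧ s(a, b) ≠ s(x, y)) ∨ s(a, b) = s(u, x) ∨
    s(a, b) = s(v, y)
  symm := ⟨by
    intro a b h
    rw [Sym2.eq_swap (a := b) (b := a), G.adj_comm b a]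
    exact h⟩
  loopless := ⟨by
    intro a h
    rcases h with h | h | h
    · exact h.1.ne rfl
    · rw [Sym2.eq_iff] at h
      rcases h with ⟨rfl, rfl⟩ | ⟨rfl, rfl⟩ <;> exact hux rfl
    · rw [Sym2.eq_iff] at h
      rcases h with ⟨rfl, rfl⟩ | ⟨rfl, rfl⟩ <;> exact hvy rfl⟩

lemma switch_nbr {V : Type*} [Finite V] (G : SimpleGraph V) (u v x y : V) (huv : G.Adj u v)
    (hxy : G.Adj x y) (hux : u ≠ x) (hvy : v ≠ y) (h1 : ¬ G.Adj u x) (h2 : ¬ G.Adj v y) (a : V) :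
    ((switchG G u v x y hux hvy).neighborSet a).ncard = (G.neighborSet a).ncard := by
  have huv' := huv.ne
  have hxy' := hxy.ne
  have huy : u ≠ y := by rintro rfl; exact h2 huv.symm
  have hvx : v ≠ x := by rintro rfl; exact h1 huv
  by_cases hau : a = u
  · subst hau
    have : (switchG G a v x y hux hvy).neighborSet a = insert x (G.neighborSet a \ {v}) := by
      ext b
      simp only [SimpleGraph.mem_neighborSet, switchG, Set.mem_insert_iff, Set.mem_sdiff,
        Set.mem_singleton_iff, Sym2.eq_iff, ne_eq]
      grind
    rw [this]
    exact Set.ncard_exchange h1 huv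
  by_cases hav : a = v
  · subst hav
    have : (switchG G u a x y hux hvy).neighborSet a = insert y (G.neighborSet a \ {u}) := by
      ext b
      simp only [SimpleGraph.mem_neighborSet, switchG, Set.mem_insert_iff, Set.mem_sdiff,
        Set.mem_singleton_iff, Sym2.eq_iff, ne_eq]
      grind
    rw [this]
    exact Set.ncard_exchange h2 huv.symm
  by_cases hax : a = x
  · subst hax
    have : (switchG G u v a y hux hvy).neighborSet a = insert u (G.neighborSet a \ {y}) := by
      ext b
      simp only [SimpleGraph.mem_neighborSet, switchG, Set.mem_insert_iff, Set.mem_sdiff,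
        Set.mem_singleton_iff, Sym2.eq_iff, ne_eq]
      grind
    rw [this]
    exact Set.ncard_exchange (fun h => h1 (G.adj_symm h)) hxy
  by_cases hay : a = y
  · subst hay
    have : (switchG G u v x a hux hvy).neighborSet a = insert v (G.neighborSet a \ {x}) := by
      ext b
      simp only [SimpleGraph.mem_neighborSet, switchG, Set.mem_insert_iff, Set.mem_sdiff,
        Set.mem_singleton_iff, Sym2.eq_iff, ne_eq]
      grind
    rw [this]
    exact Set.ncard_exchange (fun h => h2 (G.adj_symm h)) hxy.symm
  have : (switchG G u v x y hux hvy).neighborSet a = G.neighborSet a := by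
    ext b
    simp only [SimpleGraph.mem_neighborSet, switchG, Sym2.eq_iff, ne_eq]
    grind
  rw [this]

lemma switch_inj {V : Type*} (G G' : SimpleGraph V) (u v x y : V) (huv : G.Adj u v)
    (hxy : G.Adj x y) (hux : u ≠ x) (hvy : v ≠ y) (h1 : ¬ G.Adj u x) (h2 : ¬ G.Adj v y)
    (huv' : G'.Adj u v) (hxy' : G'.Adj x y) (h1' : ¬ G'.Adj u x) (h2' : ¬ G'.Adj v y)
    (h : switchG G u v x y hux hvy = switchG G' u v x y hux hvy) : G = G' := by
  ext a b
  have hh : (switchG G u v x y hux hvy).Adj a b ↔ (switchG G' u v x y hux hvy).Adj a b := by rw [h]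
  simp only [switchG, Sym2.eq_iff, ne_eq] at hh
  have := G.adj_comm
  have := G'.adj_comm
  grind

open Classical in
/-- regular graphs containing a given set of edges -/
noncomputable def RF (n d : ℕ) (F : Finset (Sym2 (Fin n))) : Finset (SimpleGraph (Fin n)) :=
  Finset.univ.filter (fun G => (∀ v, (G.neighborSet v).ncard = d) ∧ ∀ e ∈ F, e ∈ G.edgeSet)

open Classical in
lemma card_nbr {n d : ℕ} (G : SimpleGraph (Fin n)) (hG : ∀ v, (G.neighborSet v).ncard = d)
    (v : Fin n) : (Finset.univ.filter (fun b => G.Adj v b)).card = d := by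
  rw [← hG v, Set.ncard_eq_toFinset_card']
  congr 1
  ext b
  simp

open Classical in
lemma switch_count (n d : ℕ) (F : Finset (Sym2 (Fin n))) (G : SimpleGraph (Fin n))
    (hG : ∀ v, (G.neighborSet v).ncard = d) (u v : Fin n) :
    n * d ≤ ((Finset.univ : Finset (Fin n × Fin n)).filter (fun p => G.Adj p.1 p.2 ∧ s(p.1, p.2) ∉ F ∧ u ≠ p.1 ∧
      v ≠ p.2 ∧ ¬ G.Adj u p.1 ∧ ¬ G.Adj v p.2)).card + (2 * F.card + 2 * (d * (d + 1))) := by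
  have hnb := card_nbr G hG
  have hsig : ∀ T : Finset (Fin n), ((Finset.univ : Finset (Fin n × Fin n)).filter (fun p => p.1 ∈ T ∧ G.Adj p.1 p.2)).card = T.card * d := by
    intro T
    have : ((Finset.univ : Finset (Fin n × Fin n)).filter (fun p => p.1 ∈ T ∧ G.Adj p.1 p.2)) =
      T.biUnion (fun a => (Finset.univ.filter (fun b => G.Adj a b)).image (fun b => (a, b))) := by
      ext ⟨a, b⟩
      simp
    rw [this, Finset.card_biUnion]
    · rw [Finset.sum_congr rfl (fun a _ => ?_), Finset.sum_const, smul_eq_mul]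
      rw [Finset.card_image_of_injective _ (fun b c h => (Prod.mk.inj h).2), hnb]
    · intro a _ b _ hab
      rw [Function.onFun, Finset.disjoint_left]
      intro x hx hx'
      simp only [Finset.mem_image] at hx hx'
      obtain ⟨_, _, rfl⟩ := hx
      obtain ⟨_, _, h⟩ := hx'
      exact hab (Prod.mk.inj h).1.symm
  have hsig2 : ∀ T : Finset (Fin n), ((Finset.univ : Finset (Fin n × Fin n)).filter (fun p => p.2 ∈ T ∧ G.Adj p.1 p.2)).card = T.card * d := by
    intro T
    rw [← hsig T]
    apply Finset.card_bij (fun p _ => (p.2, p.1))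
    · intro p hp
      simp only [Finset.mem_filter, Finset.mem_univ, true_and] at hp ⊢
      exact ⟨hp.1, hp.2.symm⟩
    · rintro ⟨a, b⟩ _ ⟨c, e⟩ _ h
      simp only [Prod.mk.injEq] at h ⊢
      exact ⟨h.2, h.1⟩
    · rintro ⟨a, b⟩ hp
      simp only [Finset.mem_filter, Finset.mem_univ, true_and] at hp
      exact ⟨(b, a), by simp [hp.1, hp.2.symm], rfl⟩
  have hF : ((Finset.univ : Finset (Fin n × Fin n)).filter (fun p => s(p.1, p.2) ∈ F)).card ≤ 2 * F.card := by
    have : ((Finset.univ : Finset (Fin n × Fin n)).filter (fun p => s(p.1, p.2) ∈ F)) ⊆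
        F.biUnion (fun e => (Finset.univ : Finset (Fin n × Fin n)).filter (fun p => s(p.1, p.2) = e)) := by
      intro p hp
      simpa using hp
    refine (Finset.card_le_card this).trans ?_
    refine (Finset.card_biUnion_le_card_mul _ _ 2 ?_).trans (by omega)
    intro e _
    induction e using Sym2.ind with
    | _ a b =>
      have : ((Finset.univ : Finset (Fin n × Fin n)).filter (fun p => s(p.1, p.2) = s(a, b))) ⊆ {(a, b), (b, a)} := by
        rintro ⟨x, y⟩ hp
        simpa [Sym2.eq_iff] using hp
      exact (Finset.card_le_card this).trans Finset.card_le_two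
  have hTu : ∀ u, (insert u (Finset.univ.filter (fun b => G.Adj u b))).card ≤ d + 1 := by
    intro u
    refine (Finset.card_insert_le _ _).trans ?_
    rw [hnb]
  have hall := hsig Finset.univ
  rw [Finset.card_univ, Fintype.card_fin] at hall
  rw [← hall]
  have hsub : ((Finset.univ : Finset (Fin n × Fin n)).filter (fun p => p.1 ∈ Finset.univ ∧ G.Adj p.1 p.2)) ⊆
      ((Finset.univ : Finset (Fin n × Fin n)).filter (fun p => G.Adj p.1 p.2 ∧ s(p.1, p.2) ∉ F ∧ u ≠ p.1 ∧
      v ≠ p.2 ∧ ¬ G.Adj u p.1 ∧ ¬ G.Adj v p.2)) ∪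
      (((Finset.univ : Finset (Fin n × Fin n)).filter (fun p => s(p.1, p.2) ∈ F)) ∪
      (((Finset.univ : Finset (Fin n × Fin n)).filter (fun p => p.1 ∈ (insert u (Finset.univ.filter (fun b => G.Adj u b))) ∧ G.Adj p.1 p.2)) ∪
      ((Finset.univ : Finset (Fin n × Fin n)).filter (fun p => p.2 ∈ (insert v (Finset.univ.filter (fun b => G.Adj v b))) ∧ G.Adj p.1 p.2)))) := by
    rintro ⟨a, b⟩ hp
    simp only [Finset.mem_filter, Finset.mem_univ, true_and, Finset.mem_union,
      Finset.mem_insert] at hp ⊢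
    grind
  refine (Finset.card_le_card hsub).trans ?_
  refine (Finset.card_union_le _ _).trans (Nat.add_le_add_left ?_ _)
  refine (Finset.card_union_le _ _).trans (Nat.add_le_add hF ?_)
  refine (Finset.card_union_le _ _).trans ?_
  rw [hsig, hsig2]
  have h1 := Nat.mul_le_mul_right d (hTu u)
  have h2 := Nat.mul_le_mul_right d (hTu v)
  rw [mul_comm (d + 1) d] at h1 h2
  omega

open Classical in
lemma RF_step (n d : ℕ) (F : Finset (Sym2 (Fin n))) (e : Sym2 (Fin n)) (he : e ∉ F) :
    (RF n d (insert e F)).card * (n * d) ≤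
      (RF n d (insert e F)).card * (2 * F.card + 2 * (d * (d + 1))) + (RF n d F).card * (d * d) := by
  induction e using Sym2.ind with
  | _ u v =>
  let A : SimpleGraph (Fin n) → Finset (Fin n × Fin n) := fun G =>
    (Finset.univ : Finset (Fin n × Fin n)).filter (fun p => G.Adj p.1 p.2 ∧ s(p.1, p.2) ∉ F ∧ u ≠ p.1 ∧
      v ≠ p.2 ∧ ¬ G.Adj u p.1 ∧ ¬ G.Adj v p.2)
  let B : SimpleGraph (Fin n) → Finset (Fin n × Fin n) := fun G =>
    (Finset.univ.filter (fun b => G.Adj u b)) ×ˢ (Finset.univ.filter (fun b => G.Adj v b))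
  have hA : ∀ G ∈ RF n d (insert s(u, v) F), n * d ≤ (A G).card + (2 * F.card + 2 * (d * (d + 1))) := by
    intro G hG
    simp only [RF, Finset.mem_filter, Finset.mem_univ, true_and] at hG
    exact switch_count n d F G hG.1 u v
  have hB : ∀ G ∈ RF n d F, (B G).card = d * d := by
    intro G hG
    simp only [RF, Finset.mem_filter, Finset.mem_univ, true_and] at hG
    simp only [B]
    rw [Finset.card_product, card_nbr G hG.1, card_nbr G hG.1]
  have hAB : ((RF n d (insert s(u, v) F)).sigma A).card ≤ ((RF n d F).sigma B).card := by
    apply Finset.card_le_card_of_injOn (fun X => ⟨if h : u ≠ X.2.1 ∧ v ≠ X.2.2 then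
      switchG X.1 u v X.2.1 X.2.2 h.1 h.2 else ⊥, X.2⟩)
    · rintro ⟨G, x, y⟩ hX
      simp only [Finset.coe_sigma, Set.mem_sigma_iff, Finset.mem_coe, RF, A, B, Finset.mem_filter,
        Finset.mem_univ, true_and, Finset.mem_insert, forall_eq_or_imp,
        SimpleGraph.mem_edgeSet, Finset.mem_product] at hX ⊢
      obtain ⟨⟨hreg, huv, hFG⟩, hxy, hxyF, hux, hvy, h1, h2⟩ := hX
      rw [dif_pos ⟨hux, hvy⟩]
      refine ⟨⟨?_, ?_⟩, ?_, ?_⟩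
      · intro a
        rw [switch_nbr G u v x y huv hxy hux hvy h1 h2, hreg]
      · intro e heF
        have := hFG e heF
        induction e using Sym2.ind with
        | _ a b =>
          rw [SimpleGraph.mem_edgeSet] at this ⊢
          left
          refine ⟨this, ?_, ?_⟩
          · intro h; rw [h] at heF; exact he heF
          · intro h; rw [h] at heF; exact hxyF heF
      · right; left; rfl
      · right; right; rfl
    · rintro ⟨G, x, y⟩ hX ⟨G', x', y'⟩ hX' heq
      simp only [Finset.coe_sigma, Set.mem_sigma_iff, Finset.mem_coe, RF, A, Finset.mem_filter,
        Finset.mem_univ, true_and, Finset.mem_insert, forall_eq_or_imp,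
        SimpleGraph.mem_edgeSet] at hX hX'
      obtain ⟨⟨hreg, huv, hFG⟩, hxy, hxyF, hux, hvy, h1, h2⟩ := hX
      obtain ⟨⟨hreg', huv', hFG'⟩, hxy', hxyF', hux', hvy', h1', h2'⟩ := hX'
      simp only [Sigma.mk.injEq, heq_eq_eq, Prod.mk.injEq] at heq
      obtain ⟨h3, rfl, rfl⟩ := heq
      rw [dif_pos ⟨hux, hvy⟩, dif_pos ⟨hux, hvy⟩] at h3
      have := switch_inj G G' u v x y huv hxy hux hvy h1 h2 huv' hxy' h1' h2' h3
      rw [this]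
  rw [Finset.card_sigma, Finset.card_sigma, Finset.sum_congr rfl hB, Finset.sum_const,
    smul_eq_mul] at hAB
  have h5 := Finset.sum_le_sum hA
  rw [Finset.sum_const, smul_eq_mul, Finset.sum_add_distrib, Finset.sum_const, smul_eq_mul] at h5
  omega

lemma RF_bound (n d : ℕ) (hd : 4 ≤ d) (hn : 8 * (d + 1) ≤ n) (F : Finset (Sym2 (Fin n)))
    (hF : 2 * F.card ≤ n) :
    ((RF n d F).card : ℝ) ≤ (2 * d / n) ^ F.card * (RF n d ∅).card := by
  classical
  have hn0 : (0 : ℝ) < n := by exact_mod_cast (by omega : 0 < n)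
  have hd0 : (0 : ℝ) < d := by exact_mod_cast (by omega : 0 < d)
  induction F using Finset.induction_on with
  | empty => simp
  | insert e F he ih =>
    rw [Finset.card_insert_of_notMem he] at hF ⊢
    have ih := ih (by omega)
    have hs := RF_step n d F e he
    have h1 : (2 * F.card + 2 * (d * (d + 1))) * 2 ≤ n * d := by
      have := Nat.mul_le_mul_right d hn
      have := Nat.mul_le_mul_left n hd
      nlinarith
    have h2 : (RF n d (insert e F)).card * (n * d) ≤ (RF n d F).card * (2 * (d * d)) := by
      have := Nat.mul_le_mul_left (RF n d (insert e F)).card h1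
      nlinarith
    have h3 : ((RF n d (insert e F)).card : ℝ) * (n * d) ≤ (RF n d F).card * (2 * (d * d)) := by
      exact_mod_cast h2
    have h4 : ((RF n d (insert e F)).card : ℝ) ≤ (2 * d / n) * (RF n d F).card := by
      rw [div_mul_eq_mul_div, le_div_iff₀ hn0]
      have : ((RF n d (insert e F)).card : ℝ) * n * d ≤ 2 * d * (RF n d F).card * d := by
        nlinarith
      exact le_of_mul_le_mul_right this hd0
    refine h4.trans ?_
    rw [pow_succ', mul_assoc]
    exact mul_le_mul_of_nonneg_left ih (by positivity)

/-- reachability inside a set -/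
def RW {V : Type*} (H : SimpleGraph V) (W : Finset V) (x y : V) : Prop :=
  ∃ q : H.Walk x y, ∀ z ∈ q.support, z ∈ W

lemma RW.symm {V : Type*} {H : SimpleGraph V} {W : Finset V} {x y : V} (h : RW H W x y) :
    RW H W y x := by
  obtain ⟨q, hq⟩ := h
  exact ⟨q.reverse, by simpa using hq⟩

lemma RW.trans {V : Type*} {H : SimpleGraph V} {W : Finset V} {x y z : V} (h : RW H W x y)
    (h' : RW H W y z) : RW H W x z := by
  obtain ⟨q, hq⟩ := h
  obtain ⟨q', hq'⟩ := h'
  refine ⟨q.append q', fun a ha => ?_⟩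
  rw [SimpleGraph.Walk.mem_support_append_iff] at ha
  rcases ha with ha | ha
  · exact hq a ha
  · exact hq' a ha

lemma RW.step {V : Type*} {H : SimpleGraph V} {W : Finset V} {x y : V} (h : H.Adj x y)
    (hx : x ∈ W) (hy : y ∈ W) : RW H W x y :=
  ⟨SimpleGraph.Walk.cons h SimpleGraph.Walk.nil, by simp [hx, hy]⟩

lemma RW.left {V : Type*} [DecidableEq V] {H : SimpleGraph V} {W : Finset V} {x y : V}
    (q : H.Walk x y) (hq : ∀ z ∈ q.support, z ∈ W) (z : V) (hz : z ∈ q.support) :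
    RW H W x z :=
  ⟨q.takeUntil z hz, fun a ha => hq a (q.support_takeUntil_subset_support hz ha)⟩

lemma RW.right {V : Type*} [DecidableEq V] {H : SimpleGraph V} {W : Finset V} {x y : V}
    (q : H.Walk x y) (hq : ∀ z ∈ q.support, z ∈ W) (z : V) (hz : z ∈ q.support) :
    RW H W z y :=
  ⟨q.dropUntil z hz, fun a ha => hq a (q.support_dropUntil_subset_support hz ha)⟩

lemma far_on_path {V : Type*} [DecidableEq V] {H : SimpleGraph V} {u v : V} (p : H.Walk u v)
    (hp : p.IsPath) : ∀ N : Finset V, N.Nonempty → (∀ x ∈ N, x ∈ p.support) →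
    ∃ z ∈ N, ∃ q : H.Walk u z, q.IsPath ∧ (∀ x ∈ q.support, x ∈ p.support) ∧
      N.card ≤ q.length + 1 := by
  induction p with
  | nil =>
    rename_i u
    intro N hN hs
    have h1 : ∀ x ∈ N, x = u := by simpa using hs
    obtain ⟨x, hx⟩ := hN
    have := h1 x hx
    subst this
    refine ⟨x, hx, SimpleGraph.Walk.nil, by simp, by simp, ?_⟩
    simp only [SimpleGraph.Walk.length_nil, zero_add]
    exact Finset.card_le_one.2 (fun a ha b hb => by rw [h1 a ha, h1 b hb])
  | cons h p ih =>
    rename_i u u' v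
    intro N hN hs
    rw [SimpleGraph.Walk.cons_isPath_iff] at hp
    by_cases hN' : (N.erase u).Nonempty
    · obtain ⟨z, hz, q, hq, hqs, hc⟩ := ih hp.1 (N.erase u) hN' (by
        intro x hx
        have hx2 := hs x (Finset.mem_of_mem_erase hx)
        simp only [SimpleGraph.Walk.support_cons, List.mem_cons] at hx2
        exact hx2.resolve_left (Finset.ne_of_mem_erase hx))
      refine ⟨z, Finset.mem_of_mem_erase hz, SimpleGraph.Walk.cons h q, ?_, ?_, ?_⟩
      · rw [SimpleGraph.Walk.cons_isPath_iff]
        exact ⟨hq, fun hh => hp.2 (hqs _ hh)⟩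
      · intro x hx
        simp only [SimpleGraph.Walk.support_cons, List.mem_cons] at hx ⊢
        rcases hx with hx | hx
        · exact Or.inl hx
        · exact Or.inr (hqs _ hx)
      · have := Finset.pred_card_le_card_erase (s := N) (a := u)
        simp only [SimpleGraph.Walk.length_cons]
        omega
    · rw [Finset.not_nonempty_iff_eq_empty, Finset.erase_eq_empty_iff] at hN'
      have hN2 : N = {u} := hN'.resolve_left hN.ne_empty
      subst hN2
      exact ⟨u, by simp, SimpleGraph.Walk.nil, by simp, by simp, by simp⟩

open Classical in
lemma long_cycle {V : Type*} [Fintype V] (H : SimpleGraph V) (W0 : Finset V)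
    (hW0 : ∀ x y, H.Adj x y → x ∈ W0 ∧ y ∈ W0) (r0 : V) (hr0 : r0 ∈ W0) (k a : ℕ)
    (ha : 4 * a ≤ k) (hk0 : 1 ≤ k) 
    (hexp : ∀ U : Finset V, U ⊆ W0 → U.Nonempty → U.card ≤ k →
      ∃ N : Finset V, (∀ x ∈ N, x ∉ U ∧ ∃ y ∈ U, H.Adj x y) ∧ U.card < a * N.card) :
    ∃ (v : V) (w : H.Walk v v), w.IsCycle ∧ k ≤ 2 * a * w.length := by
  let P : ℕ → Prop := fun m => ∃ (u : V) (p : H.Walk u r0) (W : Finset V), p.IsPath ∧ W ⊆ W0 ∧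
    (∀ x ∈ W, x ∉ p.support) ∧ (∀ x ∈ W, ∀ y, H.Adj x y → y ∈ W ∨ y ∈ p.support) ∧
    (∀ w ∈ W, ∃ s, H.Adj u s ∧ RW H W s w) ∧ k ≤ 2 * W.card ∧ W.card = m
  have hstart : ∃ m, P m := by
    let C : Finset V := Finset.univ.filter (fun x => H.Reachable r0 x)
    have hC0 : ∀ x ∈ C, x ∈ W0 := by
      intro x hx
      have hx : H.Reachable r0 x := by simpa [C] using hx
      obtain ⟨q⟩ := hx.symm
      cases q with
      | nil => exact hr0
      | cons h q => exact (hW0 _ _ h).1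
    have hC1 : k < C.card := by
      by_contra hcon
      obtain ⟨N, hN, this⟩ := hexp C hC0 ⟨r0, by simp [C]⟩ (by omega)
      have h0 : N = ∅ := by
        apply Finset.eq_empty_of_forall_notMem
        intro x hxN
        obtain ⟨hx, y, hy, hxy⟩ := hN x hxN
        apply hx
        simp only [C, Finset.mem_filter, Finset.mem_univ, true_and] at hy ⊢
        exact hy.trans hxy.symm.reachable
      rw [h0] at this
      simp at this
    have hr : r0 ∈ C := by simp [C]
    refine ⟨_, r0, SimpleGraph.Walk.nil, C.erase r0, by simp, ?_, ?_, ?_, ?_, ?_, rfl⟩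
    · intro x hx
      exact hC0 x (Finset.mem_of_mem_erase hx)
    · intro x hx
      simpa using Finset.ne_of_mem_erase hx
    · intro x hx y hxy
      by_cases hy : y = r0
      · right; simp [hy]
      · left
        simp only [C, Finset.mem_filter, Finset.mem_univ, true_and, Finset.mem_erase] at hx ⊢
        exact ⟨hy, hx.2.trans hxy.reachable⟩
    · intro w hw
      simp only [C, Finset.mem_filter, Finset.mem_univ, true_and, Finset.mem_erase] at hw
      obtain ⟨q, hq⟩ := hw.2.exists_isPath
      cases q with
      | nil => exact absurd rfl hw.1
      | cons h q =>
        rename_i s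
        rw [SimpleGraph.Walk.cons_isPath_iff] at hq
        refine ⟨s, h, q, ?_⟩
        intro z hz
        simp only [C, Finset.mem_filter, Finset.mem_univ, true_and, Finset.mem_erase]
        refine ⟨fun hh => hq.2 (hh ▸ hz), h.reachable.trans ⟨q.takeUntil z hz⟩⟩
    · rw [Finset.card_erase_of_mem hr]
      omega
  obtain ⟨u, p, W, hp, hWW, hdis, hcl, hre, hkW, hcard⟩ := Nat.find_spec hstart
  have hmin : ∀ m, m < W.card → ¬ P m := fun m hm => Nat.find_min hstart (by omega)
  have hWk : W.card ≤ k := by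
    by_contra hcon
    push Not at hcon
    have hne : W.Nonempty := Finset.card_pos.1 (by omega)
    obtain ⟨w0, hw0⟩ := hne
    obtain ⟨u', hu', q0, hq0⟩ := hre w0 hw0
    have hu'W : u' ∈ W := hq0 _ (SimpleGraph.Walk.start_mem_support _)
    let D := W.filter (fun x => RW H W u' x)
    have hDW : D ⊆ W := Finset.filter_subset _ _
    have huD : u' ∈ D := by
      simp only [D, Finset.mem_filter]
      exact ⟨hu'W, SimpleGraph.Walk.nil, by simpa using hu'W⟩
    by_cases hD : D = W
    · apply hmin (W.erase u').card (Finset.card_erase_lt_of_mem hu'W)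
      refine ⟨u', SimpleGraph.Walk.cons hu'.symm p, W.erase u', ?_, ?_, ?_, ?_, ?_, ?_, rfl⟩
      · rw [SimpleGraph.Walk.cons_isPath_iff]
        exact ⟨hp, hdis _ hu'W⟩
      · exact (Finset.erase_subset _ _).trans hWW
      · intro x hx
        simp only [SimpleGraph.Walk.support_cons, List.mem_cons, not_or]
        exact ⟨Finset.ne_of_mem_erase hx, hdis _ (Finset.mem_of_mem_erase hx)⟩
      · intro x hx y hxy
        simp only [SimpleGraph.Walk.support_cons, List.mem_cons, Finset.mem_erase]
        rcases hcl x (Finset.mem_of_mem_erase hx) y hxy with h | h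
        · by_cases hy : y = u'
          · exact Or.inr (Or.inl hy)
          · exact Or.inl ⟨hy, h⟩
        · exact Or.inr (Or.inr h)
      · intro w hw
        have hwD : w ∈ D := by rw [hD]; exact Finset.mem_of_mem_erase hw
        obtain ⟨-, q, hq⟩ := Finset.mem_filter.1 hwD
        have hq1 : ∀ z ∈ q.bypass.support, z ∈ W := fun z hz => hq z (q.support_bypass_subset_support hz)
        have hq2 := q.bypass_isPath
        generalize q.bypass = q' at hq1 hq2
        cases q' with
        | nil => exact absurd rfl (Finset.ne_of_mem_erase hw)
        | cons h q' =>
          rename_i s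
          rw [SimpleGraph.Walk.cons_isPath_iff] at hq2
          refine ⟨s, h, q', ?_⟩
          intro z hz
          rw [Finset.mem_erase]
          refine ⟨fun hh => hq2.2 (hh ▸ hz), hq1 z ?_⟩
          simp [hz]
      · rw [Finset.card_erase_of_mem hu'W]
        omega
    · have hDlt : D.card < W.card := Finset.card_lt_card (lt_of_le_of_ne hDW hD)
      have hsum : (W \ D).card + D.card = W.card := Finset.card_sdiff_add_card_eq_card hDW
      have hDpos : 0 < D.card := Finset.card_pos.2 ⟨u', huD⟩
      have hclD : ∀ x ∈ D, ∀ y ∈ W, H.Adj x y → y ∈ D := by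
        intro x hx y hy hxy
        simp only [D, Finset.mem_filter] at hx ⊢
        exact ⟨hy, hx.2.trans (RW.step hxy hx.1 hy)⟩
      by_cases hbig : k ≤ 2 * D.card
      · apply hmin D.card hDlt
        refine ⟨u, p, D, hp, hDW.trans hWW, fun x hx => hdis x (hDW hx), ?_, ?_, hbig, rfl⟩
        · intro x hx y hxy
          rcases hcl x (hDW hx) y hxy with h | h
          · exact Or.inl (hclD x hx y h hxy)
          · exact Or.inr h
        · intro w hw
          obtain ⟨-, q, hq⟩ := Finset.mem_filter.1 hw
          refine ⟨u', hu', q, fun z hz => ?_⟩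
          simp only [D, Finset.mem_filter]
          exact ⟨hq z hz, RW.left q hq z hz⟩
      · apply hmin (W \ D).card (by omega)
        refine ⟨u, p, W \ D, hp, Finset.sdiff_subset.trans hWW,
          fun x hx => hdis x (Finset.sdiff_subset hx), ?_, ?_, by omega, rfl⟩
        · intro x hx y hxy
          rw [Finset.mem_sdiff] at hx ⊢
          rcases hcl x hx.1 y hxy with h | h
          · exact Or.inl ⟨h, fun hy => hx.2 (hclD y hy x hx.1 hxy.symm)⟩
          · exact Or.inr h
        · intro w hw
          rw [Finset.mem_sdiff] at hw
          obtain ⟨s, hs, q, hq⟩ := hre w hw.1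
          refine ⟨s, hs, q, fun z hz => ?_⟩
          rw [Finset.mem_sdiff]
          refine ⟨hq z hz, fun hzD => hw.2 ?_⟩
          simp only [D, Finset.mem_filter] at hzD ⊢
          exact ⟨hw.1, hzD.2.trans (RW.right q hq z hz)⟩
  have hWne : W.Nonempty := Finset.card_pos.1 (by omega)
  obtain ⟨N, hNdef, hN⟩ := hexp W hWW hWne hWk
  have hN2 : 2 ≤ N.card := by
    by_contra hcon
    have : a * N.card ≤ a * 1 := Nat.mul_le_mul_left _ (by omega)
    omega
  have hNp : ∀ x ∈ N, x ∈ p.support := by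
    intro x hx
    obtain ⟨h1, y, hy, hxy⟩ := hNdef x hx
    exact (hcl y hy x hxy.symm).resolve_left h1
  obtain ⟨z, hz, q, hq, hqp, hqc⟩ := far_on_path p hp N (Finset.card_pos.1 (by omega)) hNp
  obtain ⟨hzW, w, hw, hzw⟩ := hNdef z hz
  obtain ⟨s, hs, q1, hq1⟩ := hre w hw
  have hq1' : ∀ z ∈ q1.bypass.support, z ∈ W := fun z hz => hq1 z (q1.support_bypass_subset_support hz)
  have hq2 := q1.bypass_isPath
  generalize q1.bypass = q2 at hq1' hq2
  have huz : u ≠ z := by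
    rintro rfl
    have : q = SimpleGraph.Walk.nil := by
      simpa using hq
    rw [this] at hqc
    simp at hqc
    omega
  refine ⟨w, SimpleGraph.Walk.cons hzw.symm (q.reverse.append (SimpleGraph.Walk.cons hs q2)),
    ?_, ?_⟩
  · rw [SimpleGraph.Walk.cons_isCycle_iff]
    constructor
    · rw [SimpleGraph.Walk.isPath_def, SimpleGraph.Walk.support_append]
      simp only [SimpleGraph.Walk.support_reverse, SimpleGraph.Walk.support_cons, List.tail_cons]
      rw [List.nodup_append]
      refine ⟨List.nodup_reverse.2 hq.support_nodup, hq2.support_nodup, ?_⟩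
      intro x hx y hy hxy
      subst hxy
      exact hdis x (hq1' x hy) (hqp x (List.mem_reverse.1 hx))
    · intro he
      rw [SimpleGraph.Walk.edges_append, List.mem_append] at he
      rcases he with he | he
      · rw [SimpleGraph.Walk.edges_reverse, List.mem_reverse] at he
        exact hdis w hw (hqp w (SimpleGraph.Walk.fst_mem_support_of_mem_edges _ he))
      · rw [SimpleGraph.Walk.edges_cons, List.mem_cons] at he
        rcases he with he | he
        · rw [Sym2.eq_iff] at he
          rcases he with ⟨h1, h2⟩ | ⟨h1, h2⟩
          · exact hdis w hw (h1 ▸ SimpleGraph.Walk.start_mem_support p)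
          · exact huz h2.symm
        · exact hzW (hq1' z (SimpleGraph.Walk.snd_mem_support_of_mem_edges _ he))
  · simp only [SimpleGraph.Walk.length_cons, SimpleGraph.Walk.length_append,
      SimpleGraph.Walk.length_reverse]
    have : a * N.card ≤ a * (q.length + (q2.length + 1) + 1) :=
      Nat.mul_le_mul_left _ (by omega)
    rw [mul_assoc]
    omega
open Classical in
/-- edges inside a set -/
noncomputable def ES {V : Type*} [Fintype V] (G : SimpleGraph V) (S : Finset V) : Finset (Sym2 V) :=
  Finset.univ.filter (fun e : Sym2 V => e ∈ G.edgeSet ∧ ∀ v ∈ e, v ∈ S)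

/-- number of edges inside a set -/
noncomputable def eS {V : Type*} [Fintype V] (G : SimpleGraph V) (S : Finset V) : ℕ := (ES G S).card

lemma mem_ES {V : Type*} [Fintype V] (G : SimpleGraph V) (S : Finset V) (e : Sym2 V) :
    e ∈ ES G S ↔ e ∈ G.edgeSet ∧ ∀ v ∈ e, v ∈ S := by
  simp [ES]

lemma eS_mono {V : Type*} [Fintype V] {G H : SimpleGraph V} (h : H ≤ G) (S : Finset V) :
    eS H S ≤ eS G S := by
  classical
  apply Finset.card_le_card
  intro e he
  rw [mem_ES] at he ⊢
  exact ⟨SimpleGraph.edgeSet_mono h he.1, he.2⟩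

lemma eS_split {n d : ℕ} (G H : SimpleGraph (Fin n)) (hG : ∀ v, (G.neighborSet v).ncard = d)
    (h : H ≤ G) (W U N : Finset (Fin n))
    (hN : ∀ x ∈ U, ∀ y ∈ W, y ∉ U → H.Adj x y → y ∈ N) :
    eS H W ≤ eS H (W \ U) + eS H U + d * N.card := by
  classical
  have hinc : ∀ x : Fin n, ((Finset.univ.filter (fun b => G.Adj x b)).image (fun b => s(x, b))).card ≤ d := by
    intro x
    refine Finset.card_image_le.trans ?_
    rw [card_nbr G hG]
  have hsub : (ES H (W)) ⊆
      ((ES H (W \ U)) ∪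
      (ES H (U))) ∪
      N.biUnion (fun x => (Finset.univ.filter (fun b => G.Adj x b)).image (fun b => s(x, b))) := by
    intro e he
    induction e using Sym2.ind with
    | _ a b =>
      simp only [Finset.mem_filter, Finset.mem_univ, true_and, SimpleGraph.mem_edgeSet,
        Sym2.mem_iff, forall_eq_or_imp, forall_eq, Finset.mem_union, Finset.mem_sdiff,
        Finset.mem_biUnion, Finset.mem_image, mem_ES] at he ⊢
      obtain ⟨hab, ha, hb⟩ := he
      by_cases h1 : a ∈ U <;> by_cases h2 : b ∈ U
      · exact Or.inl (Or.inr ⟨hab, h1, h2⟩)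
      · exact Or.inr ⟨b, hN a h1 b hb h2 hab, a, (h hab).symm, Sym2.eq_swap⟩
      · exact Or.inr ⟨a, hN b h2 a ha h1 hab.symm, b, h hab, rfl⟩
      · exact Or.inl (Or.inl ⟨hab, ⟨ha, h1⟩, ⟨hb, h2⟩⟩)
  have h1 := Finset.card_le_card hsub
  have h2 := Finset.card_union_le ((ES H (W \ U)) ∪
      (ES H (U)))
      (N.biUnion (fun x => (Finset.univ.filter (fun b => G.Adj x b)).image (fun b => s(x, b))))
  have h3 := Finset.card_union_le (ES H (W \ U))
      (ES H (U))
  have h4 := Finset.card_biUnion_le_card_mul N (fun x => (Finset.univ.filter (fun b => G.Adj x b)).image (fun b => s(x, b))) d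
    (fun x _ => hinc x)
  simp only [eS]
  rw [mul_comm d]
  omega

lemma eS_total {n d : ℕ} (G : SimpleGraph (Fin n)) (hG : ∀ v, (G.neighborSet v).ncard = d) :
    2 * eS G Finset.univ = n * d := by
  classical
  have h := G.sum_degrees_eq_twice_card_edges
  have h1 : ∀ v ∈ Finset.univ, G.degree v = d := by
    intro v _
    rw [← card_nbr G hG v, ← SimpleGraph.card_neighborFinset_eq_degree,
      SimpleGraph.neighborFinset_eq_filter]
  rw [Finset.sum_congr rfl h1, Finset.sum_const, Finset.card_univ, Fintype.card_fin,
    smul_eq_mul] at h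
  rw [h]
  have h2 : ES G Finset.univ = G.edgeFinset := by
    ext e
    simp [mem_ES]
  rw [eS, h2]

/-- colour class -/
def colG {V : Type*} (G : SimpleGraph V) {r : ℕ} (c : Sym2 V → Fin r) (j : Fin r) (W : Finset V) :
    SimpleGraph V where
  Adj x y := G.Adj x y ∧ c s(x, y) = j ∧ x ∈ W ∧ y ∈ W
  symm := ⟨by
    rintro a b ⟨h1, h2, h3, h4⟩
    exact ⟨h1.symm, by rw [Sym2.eq_swap]; exact h2, h4, h3⟩⟩
  loopless := ⟨fun a h => h.1.ne rfl⟩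

lemma exists_colour {n r : ℕ} (hr : 1 ≤ r) (hn : 1 ≤ n) (G : SimpleGraph (Fin n))
    (hG : ∀ v, (G.neighborSet v).ncard = 2 * r + 1) (c : Sym2 (Fin n) → Fin r) :
    ∃ j, (2 * r + 1) * n ≤ 2 * r * eS (colG G c j Finset.univ) Finset.univ := by
  classical
  by_contra hcon
  push Not at hcon
  have htot := eS_total G hG
  have hsum : eS G Finset.univ = ∑ j, eS (colG G c j Finset.univ) Finset.univ := by
    simp only [eS]
    rw [Finset.card_eq_sum_card_fiberwise (f := c) (t := Finset.univ) (by intro x _; simp)]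
    apply Finset.sum_congr rfl
    intro j _
    congr 1
    ext e
    induction e using Sym2.ind with
    | _ a b => simp [colG, mem_ES]
  have hne : (Finset.univ : Finset (Fin r)).Nonempty := ⟨⟨0, hr⟩, by simp⟩
  have h := Finset.sum_lt_sum_of_nonempty hne (fun j _ => hcon j)
  rw [← Finset.mul_sum, ← hsum, Finset.sum_const, Finset.card_univ, Fintype.card_fin,
    smul_eq_mul] at h
  have : 2 * r * eS G Finset.univ = r * (n * (2 * r + 1)) := by rw [← htot]; ring
  rw [this] at h
  have h3 : r * (n * (2 * r + 1)) = r * ((2 * r + 1) * n) := by ring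
  omega

lemma det_cycle {n r k : ℕ} (hr : 1 ≤ r) (hn : 1 ≤ n) (G : SimpleGraph (Fin n))
    (hG : ∀ v, (G.neighborSet v).ncard = 2 * r + 1)
    (hk : 4 * (4 * r * (2 * r + 1)) ≤ k)
    (hsp : ∀ S : Finset (Fin n), S.card ≤ k → 4 * r * eS G S ≤ (4 * r + 1) * S.card)
    (c : Sym2 (Fin n) → Fin r) :
    ∃ (v : Fin n) (w : G.Walk v v), w.IsCycle ∧ k ≤ 2 * (4 * r * (2 * r + 1)) * w.length ∧
      ∃ j : Fin r, ∀ e ∈ w.edges, c e = j := by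
  classical
  obtain ⟨j, hj⟩ := exists_colour hr hn G hG c
  set H := colG G c j Finset.univ with hH
  have hHG : H ≤ G := fun a b h => h.1
  let fam : Finset (Finset (Fin n)) :=
    Finset.univ.filter (fun W => W.Nonempty ∧ (2 * r + 1) * W.card ≤ 2 * r * eS H W)
  have hfam : fam.Nonempty := by
    refine ⟨Finset.univ, ?_⟩
    simp only [fam, Finset.mem_filter, Finset.mem_univ, true_and, Finset.card_univ,
      Fintype.card_fin]
    exact ⟨⟨⟨0, hn⟩, by simp⟩, hj⟩
  obtain ⟨W, hW, hWmin⟩ := Finset.exists_min_image fam Finset.card hfam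
  simp only [fam, Finset.mem_filter, Finset.mem_univ, true_and] at hW hWmin
  obtain ⟨hWne, hWe⟩ := hW
  have hWpos := Finset.card_pos.2 hWne
  have hWk : k < W.card := by
    by_contra hcon
    have h1 := hsp W (by omega)
    have h2 := Nat.mul_le_mul_left (4 * r) (eS_mono hHG W)
    nlinarith
  obtain ⟨r0, hr0⟩ := hWne
  let H2 := colG G c j W
  have hH2 : H2 ≤ G := fun a b h => h.1
  obtain ⟨v, w, hw, hlen⟩ := long_cycle H2 W (fun x y h => h.2.2) r0 hr0 k (4 * r * (2 * r + 1)) hk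
    (by nlinarith) (by
      intro U hUW hUne hUk
      set N := (Finset.univ.filter (fun x => x ∉ U ∧ ∃ y ∈ U, H2.Adj x y)) with hN
      have hUpos := Finset.card_pos.2 hUne
      refine ⟨N, fun x hx => by simpa [hN] using hx, ?_⟩
      have h1 := eS_split G H hG hHG W U N (by
        intro x hx y hy hyU hxy
        simp only [hN, Finset.mem_filter, Finset.mem_univ, true_and]
        refine ⟨hyU, x, hx, ?_⟩
        have hyx := hxy.symm
        exact ⟨hyx.1, hyx.2.1, hy, hUW hx⟩)
      have h2 := hsp U hUk
      have h3 := Nat.mul_le_mul_left (4 * r) (eS_mono hHG U)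
      have hcard : (W \ U).card + U.card = W.card := Finset.card_sdiff_add_card_eq_card hUW
      have h4 : 2 * r * eS H (W \ U) < (2 * r + 1) * (W \ U).card := by
        by_contra hcon
        push Not at hcon
        have := hWmin (W \ U) ⟨Finset.card_pos.1 (by omega), hcon⟩
        omega
      have h5 := Nat.mul_le_mul_left (4 * r) h1
      have h6 : (2 * r + 1) * W.card = (2 * r + 1) * (W \ U).card + (2 * r + 1) * U.card := by
        rw [← hcard]; ring
      nlinarith)
  refine ⟨v, w.mapLe hH2, hw.mapLe hH2, by simpa using hlen, j, ?_⟩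
  intro e he
  have he2 : e ∈ w.edges := by simpa using he
  have := w.edges_subset_edgeSet he2
  induction e using Sym2.ind with
  | _ a b => exact this.2.1

lemma choose_bd (N k : ℕ) : (N.choose k : ℝ) * (k : ℝ) ^ k ≤ 3 ^ k * (N : ℝ) ^ k := by
  have h1 : (N.choose k : ℝ) ≤ (N : ℝ) ^ k / (k.factorial : ℝ) := Nat.choose_le_pow_div k N
  have hf : (0 : ℝ) < (k.factorial : ℝ) := by exact_mod_cast Nat.factorial_pos k
  have h2 : (k : ℝ) ^ k / (k.factorial : ℝ) ≤ 3 ^ k := by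
    refine (Real.pow_div_factorial_le_exp (k : ℝ) (by positivity) k).trans ?_
    have : Real.exp (k : ℝ) = Real.exp 1 ^ k := by rw [← Real.exp_nat_mul, mul_one]
    rw [this]
    exact pow_le_pow_left₀ (Real.exp_pos 1).le (by linarith [Real.exp_one_lt_d9]) k
  calc (N.choose k : ℝ) * (k : ℝ) ^ k ≤ (N : ℝ) ^ k / (k.factorial : ℝ) * (k : ℝ) ^ k := by gcongr
    _ = (k : ℝ) ^ k / (k.factorial : ℝ) * (N : ℝ) ^ k := by ring
    _ ≤ 3 ^ k * (N : ℝ) ^ k := by gcongr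

lemma term_bd (n d q k M : ℕ) (hd : 1 ≤ d) (hq : 2 ≤ q) (hk : 1 ≤ k) (hM : M ≤ k * k) (hn : 1 ≤ n)
    (hkn : k * (2 * (108 * d ^ 2) ^ q) ≤ n) :
    (n.choose k : ℝ) * (M.choose (k + k / q + 1) : ℝ) * (2 * d / n) ^ (k + k / q + 1) ≤
      2 * ((108 * d ^ 2) ^ q : ℝ) / n * (k * (1 - 1 / (2 * q : ℝ)) ^ k) := by
  set j := k / q + 1 with hj
  have hm : k + k / q + 1 = k + j := add_assoc _ _ _
  rw [hm]
  have hkqj : k ≤ q * j := by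
    have := Nat.lt_mul_div_succ k (by omega : 0 < q)
    exact this.le
  have hjk : j ≤ k := by
    have : k / q ≤ k / 2 := Nat.div_le_div_left hq (by norm_num)
    have : k = 1 → k / q = 0 := by rintro rfl; exact Nat.div_eq_of_lt (by omega)
    clear_value j
    generalize k / q = x at *
    omega
  have hk0 : (0 : ℝ) < k := by exact_mod_cast hk
  have hn0 : (0 : ℝ) < n := by exact_mod_cast hn
  have hd1 : (1 : ℝ) ≤ d := by exact_mod_cast hd
  have hq0 : (2 : ℝ) ≤ q := by exact_mod_cast hq
  have h1 : (n.choose k : ℝ) ≤ 3 ^ k * (n : ℝ) ^ k / (k : ℝ) ^ k := by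
    rw [le_div_iff₀ (by positivity)]
    exact choose_bd n k
  have h2 : (M.choose (k + j) : ℝ) ≤ 3 ^ (k + j) * (k : ℝ) ^ (k + j) := by
    have h3 := choose_bd M (k + j)
    have h4 : (k : ℝ) ^ (k + j) ≤ ((k + j : ℕ) : ℝ) ^ (k + j) := by
      gcongr
      exact Nat.le_add_right k j
    have h5 : (M : ℝ) ^ (k + j) ≤ ((k : ℝ) * k) ^ (k + j) := by
      gcongr
      exact_mod_cast hM
    have h6 : (M.choose (k + j) : ℝ) * (k : ℝ) ^ (k + j) ≤
        (3 ^ (k + j) * (k : ℝ) ^ (k + j)) * (k : ℝ) ^ (k + j) := by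
      calc (M.choose (k + j) : ℝ) * (k : ℝ) ^ (k + j)
          ≤ (M.choose (k + j) : ℝ) * ((k + j : ℕ) : ℝ) ^ (k + j) := by gcongr
        _ ≤ 3 ^ (k + j) * (M : ℝ) ^ (k + j) := h3
        _ ≤ 3 ^ (k + j) * ((k : ℝ) * k) ^ (k + j) := by gcongr
        _ = _ := by rw [mul_pow]; ring
    exact le_of_mul_le_mul_right h6 (by positivity)
  have hA1 : (1 : ℝ) ≤ 108 * (d : ℝ) ^ 2 := by nlinarith
  set B : ℝ := (108 * (d : ℝ) ^ 2) ^ q with hB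
  have hB0 : 0 < B := by positivity
  have h7 : (n.choose k : ℝ) * (M.choose (k + j) : ℝ) * (2 * d / n) ^ (k + j) ≤
      (B * k / n) ^ j := by
    calc (n.choose k : ℝ) * (M.choose (k + j) : ℝ) * (2 * d / n) ^ (k + j)
        ≤ (3 ^ k * (n : ℝ) ^ k / (k : ℝ) ^ k) * (3 ^ (k + j) * (k : ℝ) ^ (k + j)) *
          (2 * d / n) ^ (k + j) := by gcongr
      _ = (3 ^ k * (3 ^ (k + j) * (2 * d) ^ (k + j))) * (k / n) ^ j := by
          rw [div_pow, div_pow, pow_add (k : ℝ), pow_add (n : ℝ)]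
          field_simp
      _ ≤ (3 ^ k * (3 ^ (k + k) * (2 * d) ^ (k + k))) * (k / n) ^ j := by
          have h3 : (1 : ℝ) ≤ 3 := by norm_num
          have h2d : (1 : ℝ) ≤ 2 * d := by linarith
          gcongr
      _ = (108 * (d : ℝ) ^ 2) ^ k * (k / n) ^ j := by
          congr 1
          rw [← two_mul, pow_mul, pow_mul, ← mul_pow, ← mul_pow]
          congr 1
          ring
      _ ≤ (108 * (d : ℝ) ^ 2) ^ (q * j) * (k / n) ^ j := by
          gcongr
      _ = (B * k / n) ^ j := by
          rw [pow_mul, ← mul_pow, hB, mul_div_assoc]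
  refine h7.trans ?_
  have h8 : B * k / n ≤ 1 / 2 := by
    rw [div_le_iff₀ hn0]
    have : (k : ℝ) * (2 * B) ≤ n := by
      rw [hB]
      exact_mod_cast hkn
    linarith
  have hj1 : j = (k / q) + 1 := hj
  have hbern : (1 / 2 : ℝ) ≤ (1 - 1 / (2 * q : ℝ)) ^ q := by
    have h9 : (1 / (2 * q : ℝ)) ≤ 1 := by
      rw [div_le_one (by positivity)]
      linarith
    have := one_add_mul_le_pow (a := -(1 / (2 * q : ℝ))) (by linarith) q
    have h10 : 1 + (q : ℝ) * -(1 / (2 * q : ℝ)) = 1 / 2 := by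
      field_simp
      try norm_num
    rw [h10] at this
    rw [sub_eq_add_neg]
    exact this
  have hrho0 : (0 : ℝ) ≤ 1 - 1 / (2 * q : ℝ) := by
    have h9 : (1 / (2 * q : ℝ)) ≤ 1 := by
      rw [div_le_one (by positivity)]
      linarith
    linarith
  have hrho1 : 1 - 1 / (2 * q : ℝ) ≤ 1 := by
    have : (0 : ℝ) ≤ 1 / (2 * q : ℝ) := by positivity
    linarith
  have h11 : (1 / 2 : ℝ) ^ j ≤ (1 - 1 / (2 * q : ℝ)) ^ k := by
    calc (1 / 2 : ℝ) ^ j ≤ ((1 - 1 / (2 * q : ℝ)) ^ q) ^ j := by gcongr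
      _ = (1 - 1 / (2 * q : ℝ)) ^ (q * j) := by rw [pow_mul]
      _ ≤ (1 - 1 / (2 * q : ℝ)) ^ k := pow_le_pow_of_le_one hrho0 hrho1 hkqj
  calc (B * k / n) ^ j = (B * k / n) ^ (k / q) * (B * k / n) := by rw [hj, pow_succ]
    _ ≤ (1 / 2) ^ (k / q) * (B * k / n) := by gcongr
    _ = 2 * B / n * (k * (1 / 2) ^ j) := by rw [hj, pow_succ]; ring
    _ ≤ _ := by gcongr

open Classical in
lemma bad_bound (n d q : ℕ) (hd : 4 ≤ d) (hq : 2 ≤ q) (hn : 8 * (d + 1) ≤ n) :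
    (((RF n d ∅).filter (fun G => ¬ ∀ S : Finset (Fin n), S.card ≤ n / (2 * (108 * d ^ 2) ^ q) →
      q * eS G S ≤ (q + 1) * S.card)).card : ℝ) ≤
    2 * ((108 * d ^ 2) ^ q : ℝ) / n * (∑' k : ℕ, ((k : ℝ) * (1 - 1 / (2 * q : ℝ)) ^ k)) *
      (RF n d ∅).card := by
  set D := 2 * (108 * d ^ 2) ^ q with hD
  have hDpos : 4 ≤ D := by
    have : 108 * d ^ 2 ≤ (108 * d ^ 2) ^ q := Nat.le_self_pow (by omega) _
    nlinarith
  have hq0 : (2 : ℝ) ≤ q := by exact_mod_cast hq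
  have hn0 : (0 : ℝ) < n := by exact_mod_cast (by omega : 0 < n)
  have hsub : ((RF n d ∅).filter (fun G => ¬ ∀ S : Finset (Fin n), S.card ≤ n / D →
      q * eS G S ≤ (q + 1) * S.card)) ⊆ (Finset.Icc 1 (n / D)).biUnion (fun k =>
      (Finset.powersetCard k (Finset.univ : Finset (Fin n))).biUnion (fun S =>
        (Finset.powersetCard (k + k / q + 1) S.sym2).biUnion (fun F => RF n d F))) := by
    intro G hG
    rw [Finset.mem_filter] at hG
    obtain ⟨hGR, hS⟩ := hG
    push Not at hS
    obtain ⟨S, hSc, hSe⟩ := hS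
    have hS0 : S.card ≠ 0 := by
      intro h0
      rw [Finset.card_eq_zero] at h0
      subst h0
      have : eS G ∅ = 0 := by
        rw [eS, Finset.card_eq_zero]
        apply Finset.eq_empty_of_forall_notMem
        intro e he
        obtain ⟨-, h⟩ := (mem_ES _ _ _).1 he
        induction e using Sym2.ind with
        | _ a b => exact absurd (h a (by simp)) (by simp)
      rw [this] at hSe
      simp at hSe
    have hm : S.card + S.card / q + 1 ≤ eS G S := by
      by_contra hcon
      have h1 : eS G S ≤ S.card + S.card / q := by omega
      have h2 := Nat.mul_le_mul_left q h1
      have h3 := Nat.mul_div_le S.card q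
      nlinarith
    obtain ⟨F, hF, hFc⟩ := Finset.exists_subset_card_eq hm
    simp only [Finset.mem_biUnion, Finset.mem_Icc, Finset.mem_powersetCard]
    refine ⟨S.card, ⟨by omega, hSc⟩, S, ⟨Finset.subset_univ _, rfl⟩, F, ⟨?_, hFc⟩, ?_⟩
    · intro e he
      have := (mem_ES _ _ _).1 (hF he)
      rw [Finset.mem_sym2_iff]
      exact this.2
    · simp only [RF, Finset.mem_filter, Finset.mem_univ, true_and] at hGR ⊢
      refine ⟨hGR.1, fun e he => ?_⟩
      have := (mem_ES _ _ _).1 (hF he)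
      exact this.1
  have hk4 : ∀ k ∈ Finset.Icc 1 (n / D), k * D ≤ n := by
    intro k hk
    rw [Finset.mem_Icc] at hk
    exact (Nat.mul_le_mul_right D hk.2).trans (Nat.div_mul_le_self n D)
  have hinner : ∀ k ∈ Finset.Icc 1 (n / D),
      ((((Finset.powersetCard k (Finset.univ : Finset (Fin n))).biUnion (fun S =>
        (Finset.powersetCard (k + k / q + 1) S.sym2).biUnion (fun F => RF n d F))).card : ℕ) : ℝ) ≤
      2 * ((108 * d ^ 2) ^ q : ℝ) / n * (k * (1 - 1 / (2 * q : ℝ)) ^ k) * (RF n d ∅).card := by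
    intro k hk
    have hkD := hk4 k hk
    rw [Finset.mem_Icc] at hk
    set m := k + k / q + 1 with hm
    set M := (k + 1).choose 2 with hM
    have hMk : M ≤ k * k := by
      rw [hM, Nat.choose_two_right]
      have : (k + 1) * (k + 1 - 1) ≤ 2 * (k * k) := by
        rw [Nat.add_sub_cancel]
        nlinarith
      omega
    have hmn : 2 * m ≤ n := by
      have : k / q ≤ k / 2 := Nat.div_le_div_left hq (by norm_num)
      have h4 := Nat.mul_le_mul_left k hDpos
      have : k = 1 → k / q = 0 := by rintro rfl; exact Nat.div_eq_of_lt (by omega)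
      omega
    have hF : ∀ S ∈ Finset.powersetCard k (Finset.univ : Finset (Fin n)),
        ((((Finset.powersetCard m S.sym2).biUnion (fun F => RF n d F)).card : ℕ) : ℝ) ≤
        (M.choose m : ℝ) * ((2 * d / n) ^ m * (RF n d ∅).card) := by
      intro S hS
      rw [Finset.mem_powersetCard] at hS
      calc ((((Finset.powersetCard m S.sym2).biUnion (fun F => RF n d F)).card : ℕ) : ℝ)
          ≤ ((∑ F ∈ Finset.powersetCard m S.sym2, (RF n d F).card : ℕ) : ℝ) := by
            exact_mod_cast Finset.card_biUnion_le
        _ = ∑ F ∈ Finset.powersetCard m S.sym2, ((RF n d F).card : ℝ) := by push_cast; rfl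
        _ ≤ ∑ F ∈ Finset.powersetCard m S.sym2, ((2 * d / n : ℝ) ^ m * (RF n d ∅).card) := by
            apply Finset.sum_le_sum
            intro F hF
            rw [Finset.mem_powersetCard] at hF
            have := RF_bound n d hd hn F (by omega)
            rw [hF.2] at this
            exact this
        _ = _ := by
            rw [Finset.sum_const, Finset.card_powersetCard, Finset.card_sym2, hS.2, nsmul_eq_mul]
    calc ((((Finset.powersetCard k (Finset.univ : Finset (Fin n))).biUnion (fun S =>
        (Finset.powersetCard m S.sym2).biUnion (fun F => RF n d F))).card : ℕ) : ℝ)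
        ≤ ((∑ S ∈ Finset.powersetCard k (Finset.univ : Finset (Fin n)),
          ((Finset.powersetCard m S.sym2).biUnion (fun F => RF n d F)).card : ℕ) : ℝ) := by
            exact_mod_cast Finset.card_biUnion_le
      _ = ∑ S ∈ Finset.powersetCard k (Finset.univ : Finset (Fin n)),
          (((Finset.powersetCard m S.sym2).biUnion (fun F => RF n d F)).card : ℝ) := by
            push_cast; rfl
      _ ≤ ∑ S ∈ Finset.powersetCard k (Finset.univ : Finset (Fin n)),
          (M.choose m : ℝ) * ((2 * d / n) ^ m * (RF n d ∅).card) := Finset.sum_le_sum hF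
      _ = ((n.choose k : ℝ) * (M.choose m : ℝ) * (2 * d / n) ^ m) * (RF n d ∅).card := by
            rw [Finset.sum_const, Finset.card_powersetCard, Finset.card_univ, Fintype.card_fin,
              nsmul_eq_mul]
            ring
      _ ≤ _ := by
            refine mul_le_mul_of_nonneg_right ?_ (Nat.cast_nonneg _)
            exact term_bd n d q k M (by omega) hq hk.1 hMk (by omega) (by rw [← hD]; exact hkD)
  have h9 : (1 / (2 * q : ℝ)) < 1 := by
    rw [div_lt_one (by positivity)]
    linarith
  have h9' : 0 < (1 / (2 * q : ℝ)) := by positivity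
  have hsum : Summable (fun k : ℕ => ((k : ℝ) * (1 - 1 / (2 * q : ℝ)) ^ k)) := by
    have := summable_pow_mul_geometric_of_norm_lt_one (R := ℝ) 1 (r := 1 - 1 / (2 * q : ℝ)) (by
      rw [Real.norm_eq_abs, abs_lt]; constructor <;> linarith)
    simpa using this
  calc (((RF n d ∅).filter (fun G => ¬ ∀ S : Finset (Fin n), S.card ≤ n / D →
      q * eS G S ≤ (q + 1) * S.card)).card : ℝ)
      ≤ ((∑ k ∈ Finset.Icc 1 (n / D), ((Finset.powersetCard k (Finset.univ : Finset (Fin n))).biUnion (fun S =>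
        (Finset.powersetCard (k + k / q + 1) S.sym2).biUnion (fun F => RF n d F))).card : ℕ) : ℝ) := by
          exact_mod_cast (Finset.card_le_card hsub).trans Finset.card_biUnion_le
    _ ≤ ∑ k ∈ Finset.Icc 1 (n / D), 2 * ((108 * d ^ 2) ^ q : ℝ) / n * (k * (1 - 1 / (2 * q : ℝ)) ^ k) * (RF n d ∅).card := by
          push_cast
          exact Finset.sum_le_sum hinner
    _ = 2 * ((108 * d ^ 2) ^ q : ℝ) / n * (∑ k ∈ Finset.Icc 1 (n / D), (k * (1 - 1 / (2 * q : ℝ)) ^ k)) * (RF n d ∅).card := by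
          rw [Finset.mul_sum, Finset.sum_mul]
    _ ≤ _ := by
          gcongr
          apply hsum.sum_le_tsum
          intro k _
          have : 0 ≤ 1 - 1 / (2 * q : ℝ) := by linarith
          positivity

theorem stmt_1 (r : ℕ) (hr : 2 ≤ r) :
    ∃ γ : ℝ, 0 < γ ∧
      ∀ p : ℝ, p < 1 → ∃ N : ℕ, ∀ n : ℕ, N ≤ n → Even (n * (2 * r + 1)) → 2 * r + 2 ≤ n →
        p * (Nat.card {G : SimpleGraph (Fin n) //
                ∀ v : Fin n, (G.neighborSet v).ncard = 2 * r + 1} : ℝ) ≤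
        (Nat.card {G : SimpleGraph (Fin n) //
            (∀ v : Fin n, (G.neighborSet v).ncard = 2 * r + 1) ∧
            ∀ c : Sym2 (Fin n) → Fin r, ∃ (v : Fin n) (w : G.Walk v v),
              w.IsCycle ∧ γ * n ≤ (w.length : ℝ) ∧
              ∃ j : Fin r, ∀ e ∈ w.edges, c e = j} : ℝ) := by
  classical
  set d := 2 * r + 1 with hd
  set D : ℕ := 2 * (108 * d ^ 2) ^ (4 * r) with hD
  set a : ℕ := 4 * r * d with ha
  set T : ℝ := ∑' k : ℕ, ((k : ℝ) * (1 - 1 / (2 * (4 * r : ℕ) : ℝ)) ^ k) with hT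
  have hDpos : 1 ≤ D := by
    have : 0 < (108 * d ^ 2) ^ (4 * r) := by positivity
    omega
  have hapos : 1 ≤ a := by
    have : 0 < 4 * r * d := by positivity
    omega
  have hD0 : (0 : ℝ) < D := by exact_mod_cast hDpos
  have ha0 : (0 : ℝ) < a := by exact_mod_cast hapos
  refine ⟨1 / (4 * a * D), by positivity, ?_⟩
  intro p hp
  obtain ⟨N1, hN1⟩ := exists_nat_ge (D * T / (1 - p))
  refine ⟨max (max N1 (8 * (d + 1))) (4 * a * D), ?_⟩
  intro n hn _ _
  have hn1 : N1 ≤ n := by omega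
  have hn2 : 8 * (d + 1) ≤ n := by omega
  have hn3 : 4 * a * D ≤ n := by omega
  have hn0 : (0 : ℝ) < n := by exact_mod_cast (by omega : 0 < n)
  have hkey : D * T / n ≤ 1 - p := by
    rw [div_le_iff₀ hn0]
    have h1 : D * T / (1 - p) ≤ n := hN1.trans (by exact_mod_cast hn1)
    rw [div_le_iff₀ (by linarith)] at h1
    linarith
  have hbad := bad_bound n d (4 * r) (by omega) (by omega) hn2
  rw [← hT, ← hD] at hbad
  set bad := ((RF n d ∅).filter (fun G => ¬ ∀ S : Finset (Fin n), S.card ≤ n / D →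
      (4 * r) * eS G S ≤ (4 * r + 1) * S.card)) with hbaddef
  have hDcast : 2 * ((108 * d ^ 2) ^ (4 * r) : ℝ) = D := by rw [hD]; push_cast; rfl
  rw [hDcast] at hbad
  have htotal : Nat.card {G : SimpleGraph (Fin n) //
      ∀ v : Fin n, (G.neighborSet v).ncard = d} = (RF n d ∅).card := by
    rw [Nat.card_eq_fintype_card, Fintype.card_subtype]
    congr 1
    ext G
    simp [RF]
  have hgood : (RF n d ∅).card ≤ Nat.card {G : SimpleGraph (Fin n) //
            (∀ v : Fin n, (G.neighborSet v).ncard = d) ∧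
            ∀ c : Sym2 (Fin n) → Fin r, ∃ (v : Fin n) (w : G.Walk v v),
              w.IsCycle ∧ 1 / (4 * a * D : ℝ) * n ≤ (w.length : ℝ) ∧
              ∃ j : Fin r, ∀ e ∈ w.edges, c e = j} + bad.card := by
    rw [Nat.card_eq_fintype_card, Fintype.card_subtype]
    refine le_trans (Finset.card_le_card ?_) (Finset.card_union_le _ _)
    intro G hG
    rw [Finset.mem_union]
    by_cases hGb : G ∈ bad
    · exact Or.inr hGb
    left
    have hsp : ∀ S : Finset (Fin n), S.card ≤ n / D →
      (4 * r) * eS G S ≤ (4 * r + 1) * S.card := by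
      by_contra hcon
      exact hGb (Finset.mem_filter.2 ⟨hG, hcon⟩)
    simp only [RF, Finset.mem_filter, Finset.mem_univ, true_and] at hG ⊢
    refine ⟨hG.1, fun c => ?_⟩
    obtain ⟨v, w, hw, hlen, hj⟩ := det_cycle (k := n / D) (by omega) (by omega) G hG.1
      ((Nat.le_div_iff_mul_le (by omega)).2 hn3) hsp c
    refine ⟨v, w, hw, ?_, hj⟩
    have hlt : n < D * (n / D + 1) := Nat.lt_mul_div_succ n (by omega)
    have h1 : 1 ≤ n / D := by
      have : 4 * a ≤ n / D := (Nat.le_div_iff_mul_le (by omega)).2 hn3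
      omega
    have h2 : n ≤ D * (2 * (2 * a * w.length)) := by
      refine hlt.le.trans (Nat.mul_le_mul_left D ?_)
      have : n / D ≤ 2 * a * w.length := hlen
      omega
    have h3 : (n : ℝ) ≤ D * (2 * (2 * a * w.length)) := by exact_mod_cast h2
    rw [div_mul_eq_mul_div, div_le_iff₀ (by positivity)]
    linarith
  rw [htotal]
  have hgood' := (Nat.cast_le (α := ℝ)).2 hgood
  rw [Nat.cast_add] at hgood'
  have h5 : (bad.card : ℝ) ≤ (1 - p) * (RF n d ∅).card := by
    refine hbad.trans ?_
    have : (D : ℝ) / n * T = D * T / n := by ring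
    rw [this]
    gcongr
  linarith
end
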